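/- Let k be an algebraically closed field of characteristic zero and let G be a finite subgroup of GL_3(k). Then for any faithful finite-dimensional linear representation V of G over k, the field of invariants k(V)^G is stably pure over k. -/

import Mathlib

open IntermediateField in
/-- An intermediate field is purely transcendental with a finite transcendence basis. -/
def InPure {k F : Type*} [Field k] [Field F] [Algebra k F] (K : IntermediateField k F) : Prop :=
  ∃ (ι : Type) (_ : Finite ι) (y : ι → F), AlgebraicIndependent k y ∧ adjoin k (Set.range y) = K

open IntermediateField in
/-- `M` is purely transcendental over `K`, with a transcendence basis indexed by `ι`. -/
def PureOver {k F : Type*} [Field k] [Field F] [Algebra k F] (ι : Type)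
    (K M : IntermediateField k F) : Prop :=
  ∃ y : ι → F, AlgebraicIndependent K y ∧ (adjoin K (Set.range y)).restrictScalars k = M

theorem InPure.of_pureOver {k F : Type*} [Field k] [Field F] [Algebra k F] {ι : Type} [Finite ι]
    {K M : IntermediateField k F} (hK : InPure K) (hM : PureOver ι K M) : InPure M := by
  obtain ⟨κ, hκ, x, hx, rfl⟩ := hK
  obtain ⟨y, hy, rfl⟩ := hM
  refine ⟨ι ⊕ κ, inferInstance, Sum.elim y x, ?_, ?_⟩
  · refine hx.sumElim_of_tower ?_ hy
    rintro _ ⟨i, rfl⟩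
    exact ⟨⟨x i, IntermediateField.subset_adjoin _ _ ⟨i, rfl⟩⟩, rfl⟩
  · rw [Set.Sum.elim_range, Set.union_comm, ← IntermediateField.adjoin_adjoin_left]

/-- The invariants of a group acting on a field, inside an intermediate field. -/
def inv {k F G : Type*} [Field k] [Field F] [Algebra k F] [Group G] (a : G →* (F ≃ₐ[k] F))
    (L : IntermediateField k F) : IntermediateField k F :=
  L ⊓ IntermediateField.fixedField a.range

section
variable {k F G : Type*} [Field k] [Field F] [Algebra k F] [Group G] {a : G →* (F ≃ₐ[k] F)}
  {L : IntermediateField k F}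

theorem mem_inv {y : F} : y ∈ inv a L ↔ y ∈ L ∧ ∀ g, a g y = y := by
  simp [inv, IntermediateField.mem_inf]

theorem inv_top : inv a (⊤ : IntermediateField k F) = IntermediateField.fixedField a.range := by
  simp [inv]

theorem inv_le : inv a L ≤ L := inf_le_left

theorem algebraicIndependent_inv {ι : Type*} {y : ι → F} (hy : AlgebraicIndependent L y) :
    AlgebraicIndependent (inv a L) y := by
  let : Algebra (inv a L) L := (IntermediateField.inclusion inv_le).toAlgebra
  have : IsScalarTower (inv a L) L F := IsScalarTower.of_algebraMap_eq fun _ => rfl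
  exact hy.restrictScalars (algebraMap (inv a L) L).injective

/-- The ring homomorphism which an automorphism induces on a stable subfield. -/
def restrictHom (e : F ≃ₐ[k] F) (L : IntermediateField k F) (h : ∀ y ∈ L, e y ∈ L) : L →+* L where
  toFun y := ⟨e y, h y y.2⟩
  map_one' := by ext; simp
  map_mul' x y := by ext; simp
  map_zero' := by ext; simp
  map_add' x y := by ext; simp

theorem affine_poly (e : F ≃ₐ[k] F) (h : ∀ y ∈ L, e y ∈ L) {t : F} {α β : L}
    (ht : e t = α * t + β) (p : Polynomial L) :
    ∃ q : Polynomial L, q.natDegree ≤ p.natDegree ∧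
      Polynomial.aeval t q = e (Polynomial.aeval t p) := by
  refine ⟨(p.map (restrictHom e L h)).comp (Polynomial.C α * Polynomial.X + Polynomial.C β), ?_, ?_⟩
  · refine Polynomial.natDegree_comp_le.trans ?_
    calc _ ≤ p.natDegree * 1 := Nat.mul_le_mul Polynomial.natDegree_map_le
            Polynomial.natDegree_linear_le
      _ = _ := mul_one _
  · rw [Polynomial.aeval_comp]
    have : Polynomial.aeval t (Polynomial.C α * Polynomial.X + Polynomial.C β) = e t := by
      rw [ht]; simp
    rw [this, Polynomial.aeval_def, Polynomial.aeval_def, Polynomial.eval₂_map]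
    have := Polynomial.hom_eval₂ p (algebraMap L F) (e : F →+* F) t
    simp only [RingHom.coe_coe] at this
    rw [this]
    rfl

theorem exists_invariant_poly [Finite G] (hL : ∀ g, ∀ y ∈ L, a g y ∈ L) {t : F}
    (ht : Transcendental L t) (hta : ∀ g, ∃ α β : L, a g t = α * t + β) :
    ∃ p : Polynomial L, 0 < p.natDegree ∧ ∀ g, a g (Polynomial.aeval t p) = Polynomial.aeval t p := by
  classical
  have := Fintype.ofFinite G
  choose α β h using hta
  have hα : ∀ g, α g ≠ 0 := by
    intro g h0
    have h1 := h g
    rw [h0] at h1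
    have h2 : t = a g⁻¹ (β g) := by
      have : a g⁻¹ (a g t) = t := by
        rw [← AlgEquiv.mul_apply, ← map_mul]; simp
      rw [← this, h1]; simp
    apply ht
    rw [h2]
    exact isAlgebraic_algebraMap (⟨_, hL g⁻¹ _ (β g).2⟩ : L)
  refine ⟨∏ g, (Polynomial.C (α g) * Polynomial.X + Polynomial.C (β g)), ?_, ?_⟩
  · rw [Polynomial.natDegree_prod]
    · simp_rw [Polynomial.natDegree_linear (hα _)]
      simp [Fintype.card_pos]
    · intro g _ h0
      have := Polynomial.natDegree_linear (b := β g) (hα g)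
      rw [h0] at this
      simp at this
  · have : Polynomial.aeval t (∏ g, (Polynomial.C (α g) * Polynomial.X + Polynomial.C (β g))) =
        ∏ g, a g t := by
      rw [map_prod]
      refine Finset.prod_congr rfl fun g _ => ?_
      rw [h]; simp
    intro g
    rw [this, map_prod]
    refine Fintype.prod_equiv (Equiv.mulLeft g) _ _ fun x => ?_
    simp

open Polynomial in
/-- Miyata's theorem: if a finite group acts on `L(t)` by affine substitutions of `t`, then
the invariants are purely transcendental over the invariants of `L`. -/
theorem miyata [Finite G] (hL : ∀ g, ∀ y ∈ L, a g y ∈ L) {t : F}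
    (ht : Transcendental L t) (hta : ∀ g, ∃ α β : L, a g t = α * t + β) :
    PureOver Unit (inv a L)
      (inv a ((IntermediateField.adjoin L {t}).restrictScalars k)) := by
  classical
  have := Fintype.ofFinite G
  have hinj : Function.Injective (aeval t : L[X] →ₐ[L] F) :=
    transcendental_iff_injective.1 ht
  have hpoly : ∀ g (p : L[X]), ∃ q : L[X], q.natDegree ≤ p.natDegree ∧ aeval t q = a g (aeval t p) := by
    intro g p
    obtain ⟨α, β, h⟩ := hta g
    exact affine_poly (a g) (hL g) h p
  let P : ℕ → Prop := fun n => ∃ p : L[X], p.natDegree = n ∧ 0 < n ∧ ∀ g, a g (aeval t p) = aeval t p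
  have hP : ∃ n, P n := by
    obtain ⟨p, h1, h2⟩ := exists_invariant_poly hL ht hta
    exact ⟨_, p, rfl, h1, h2⟩
  obtain ⟨f, hfd, hf0, hf⟩ := Nat.find_spec hP
  have hmin : ∀ p : L[X], (∀ g, a g (aeval t p) = aeval t p) → p.natDegree < f.natDegree →
      p.natDegree = 0 := by
    intro p hp hlt
    by_contra h0
    exact Nat.find_min hP (hfd ▸ hlt) ⟨p, rfl, Nat.pos_of_ne_zero h0, hp⟩
  rw [← hfd] at hf0
  have hfne : f ≠ 0 := by rintro rfl; simp at hf0
  set s : F := aeval t f with hs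
  have hsinv : s ∈ inv a ((IntermediateField.adjoin L {t}).restrictScalars k) := by
    refine mem_inv.2 ⟨?_, hf⟩
    exact IntermediateField.algebra_adjoin_le_adjoin L {t}
      (aeval_mem_adjoin_singleton L t)
  have hconst : ∀ c : L, (∀ g, a g c = c) → (c : F) ∈ inv a L := fun c hc => mem_inv.2 ⟨c.2, hc⟩
  have key : ∀ n (p : L[X]), p.natDegree ≤ n → (∀ g, a g (aeval t p) = aeval t p) →
      aeval t p ∈ IntermediateField.adjoin (inv a L) {s} := by
    intro n
    induction n with
    | zero =>
      intro p hp hinv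
      have hC := eq_C_of_natDegree_le_zero hp
      rw [hC, aeval_C] at hinv ⊢
      exact (IntermediateField.adjoin (inv a L) {s}).algebraMap_mem ⟨_, hconst _ hinv⟩
    | succ n ih =>
      intro p hp hinv
      have hdiv := EuclideanDomain.div_add_mod p f
      set q := p / f
      set r := p % f
      have hrlt : r.degree < f.degree := EuclideanDomain.mod_lt p hfne
      have hrlt' : r.natDegree < f.natDegree := natDegree_mod_lt p hf0.ne'
      have hqr : ∀ g, a g (aeval t q) = aeval t q ∧ a g (aeval t r) = aeval t r := by
        intro g
        obtain ⟨q', -, hq'⟩ := hpoly g q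
        obtain ⟨r', hr'd, hr'⟩ := hpoly g r
        have e1 : f * q' + r' = f * q + r := by
          apply hinj
          rw [hdiv, ← hinv g, ← hdiv]
          simp only [map_add, map_mul, hq', hr']
          rw [← hs, hf]
        have e2 : f * (q' - q) = r - r' := by linear_combination e1
        have e3 : q' - q = 0 := by
          by_contra hne
          have := natDegree_mul hfne hne
          rw [e2] at this
          have h4 := natDegree_sub_le r r'
          omega
        rw [e3, mul_zero] at e2
        rw [← hq', ← hr', sub_eq_zero.1 e3, sub_eq_zero.1 e2.symm]
        exact ⟨rfl, rfl⟩
      have hr0 : r.natDegree = 0 := hmin r (fun g => (hqr g).2) hrlt'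
      rw [← hdiv, map_add, map_mul]
      refine add_mem (mul_mem (IntermediateField.mem_adjoin_simple_self _ s) (ih q ?_ fun g => (hqr g).1)) ?_
      · by_cases hq0 : q = 0
        · simp [hq0]
        · have h5 : (f * q + r).natDegree = (f * q).natDegree := by
            apply natDegree_add_eq_left_of_natDegree_lt
            rw [natDegree_mul hfne hq0]; omega
          rw [hdiv, natDegree_mul hfne hq0] at h5
          omega
      · have hC := eq_C_of_natDegree_eq_zero hr0
        have hinv' := fun g => (hqr g).2
        rw [hC] at hinv' ⊢
        simp only [aeval_C] at hinv' ⊢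
        exact (IntermediateField.adjoin (inv a L) {s}).algebraMap_mem ⟨_, hconst _ hinv'⟩
  refine ⟨fun _ => s, ?_, ?_⟩
  · apply algebraicIndependent_inv
    rw [algebraicIndependent_unique_type_iff]
    rw [transcendental_iff_injective]
    intro p p' hpp
    have h1 : aeval t (p.comp f) = aeval t (p'.comp f) := by
      simpa [aeval_comp] using hpp
    have h2 := hinj h1
    have h3 : (p - p').comp f = 0 := by simp [h2]
    rcases comp_eq_zero_iff.1 h3 with h | ⟨-, h⟩
    · exact sub_eq_zero.1 h
    · rw [h] at hf0; simp at hf0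
  · have hr : Set.range (fun _ : Unit => s) = {s} := by simp
    rw [hr]
    apply le_antisymm
    · have : IntermediateField.adjoin (inv a L) {s} ≤ IntermediateField.extendScalars
          (F := inv a L) (E := inv a ((IntermediateField.adjoin L {t}).restrictScalars k)) (by
            intro y hy
            obtain ⟨h1, h2⟩ := mem_inv.1 hy
            exact mem_inv.2 ⟨(IntermediateField.adjoin L {t}).algebraMap_mem ⟨y, h1⟩, h2⟩) := by
        rw [IntermediateField.adjoin_simple_le_iff]
        exact hsinv
      intro y hy
      exact this hy
    · intro y hy
      obtain ⟨h1, h2⟩ := mem_inv.1 hy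
      rw [IntermediateField.mem_restrictScalars, IntermediateField.mem_adjoin_simple_iff] at h1
      obtain ⟨p, q, rfl⟩ := h1
      by_cases hq0 : q = 0
      · simp [hq0]
      rw [IntermediateField.mem_restrictScalars]
      choose Q _ hQ using fun g => hpoly g q
      have hqt : ∀ g, a g (aeval t q) ≠ 0 := by
        intro g
        rw [map_ne_zero_iff _ (a g).injective, map_ne_zero_iff _ hinj]
        exact hq0
      have hNinv : ∀ g, a g (aeval t (∏ h, Q h)) = aeval t (∏ h, Q h) := by
        intro g
        rw [map_prod, map_prod]
        refine Fintype.prod_equiv (Equiv.mulLeft g) _ _ fun x => ?_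
        simp [hQ]
      have hN0 : aeval t (∏ h, Q h) ≠ 0 := by
        rw [map_prod]
        exact Finset.prod_ne_zero_iff.2 fun g _ => by rw [hQ]; exact hqt g
      have hmul : aeval t p / aeval t q * aeval t (∏ h, Q h) =
          aeval t (p * ∏ h ∈ Finset.univ.erase 1, Q h) := by
        have h1 : aeval t (∏ h, Q h) = aeval t q * aeval t (∏ h ∈ Finset.univ.erase 1, Q h) := by
          rw [← Finset.mul_prod_erase Finset.univ Q (Finset.mem_univ 1), map_mul, hQ]
          simp
        have h2 := hqt 1
        simp only [map_one, AlgEquiv.one_apply] at h2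
        rw [h1, map_mul]
        field_simp
      have : aeval t p / aeval t q =
          aeval t (p * ∏ h ∈ Finset.univ.erase 1, Q h) / aeval t (∏ h, Q h) := by
        rw [← hmul]; field_simp
      rw [this]
      refine div_mem (key _ _ le_rfl ?_) (key _ _ le_rfl hNinv)
      intro g
      rw [← hmul, map_mul, hNinv, h2]

end

section
variable {k F : Type*} [Field k] [Field F] [Algebra k F]

open Algebra.IsAlgebraic in
/-- A finite family, not larger than an algebraically independent family which is algebraic
over it, is algebraically independent. -/
theorem algebraicIndependent_of_isAlgebraic {ι κ : Type*} [Finite κ] {x : ι → F} {y : κ → F}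
    (hx : AlgebraicIndependent k x)
    (h : ∀ i, IsAlgebraic (IntermediateField.adjoin k (Set.range y)) (x i))
    (hc : Nat.card κ ≤ Nat.card ι) : AlgebraicIndependent k y := by
  have : FaithfulSMul k F := inferInstance
  let M := AlgebraicIndependent.matroid k F
  have hMx : M.Indep (Set.range x) :=
    AlgebraicIndependent.matroid_indep_iff.2 hx.to_subtype_range
  have hsub : Set.range x ⊆ M.closure (Set.range y) := by
    rintro _ ⟨i, rfl⟩
    rw [AlgebraicIndependent.matroid_closure_eq]
    exact IntermediateField.isAlgebraic_adjoin_iff.1 (h i)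
  have hle : (Set.range x).encard ≤ M.eRk (Set.range y) := by
    rw [← hMx.eRk_eq_encard, ← M.eRk_closure_eq (Set.range y)]
    exact M.eRk_mono hsub
  have hfin : (Set.range y).Finite := Set.finite_range y
  have hle2 := M.eRk_le_encard (Set.range y)
  have hxe : (Set.range x).encard = ENat.card ι := by
    rw [← Set.image_univ, hx.injective.encard_image, Set.encard_univ]
  have hιfin : Finite ι := by
    have : (Set.range x).encard ≠ ⊤ :=
      ne_top_of_le_ne_top (Set.encard_ne_top_iff.2 hfin) (hle.trans hle2)
    rw [hxe] at this
    exact ENat.card_lt_top.1 (lt_top_iff_ne_top.2 this)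
  have hcard : ENat.card κ ≤ ENat.card ι := by
    rw [ENat.card_eq_coe_natCard, ENat.card_eq_coe_natCard]
    exact_mod_cast hc
  have hyle : (Set.range y).encard ≤ ENat.card κ := by
    rw [← Set.image_univ, ← Set.encard_univ]
    exact Set.encard_image_le _ _
  have hye : (Set.range y).encard = ENat.card κ :=
    le_antisymm hyle (hcard.trans (hxe ▸ hle.trans hle2))
  have hinj : Function.Injective y := by
    have h2 : (y '' Set.univ).encard = (Set.univ : Set κ).encard := by
      rw [Set.image_univ, hye, Set.encard_univ]
    exact Set.injOn_univ.1 (Set.finite_univ.injOn_of_encard_image_eq h2)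
  have hind : M.Indep (Set.range y) := by
    rw [Matroid.indep_iff_eRk_eq_encard_of_finite hfin]
    refine le_antisymm hle2 ?_
    rw [hye]
    exact hcard.trans (hxe ▸ hle)
  exact .of_subtype_range hinj (AlgebraicIndependent.matroid_indep_iff.1 hind)

theorem algebraicIndependent_of_mem_adjoin {ι κ : Type*} [Finite κ] {x : ι → F} {y : κ → F}
    (hx : AlgebraicIndependent k x)
    (h : ∀ i, x i ∈ IntermediateField.adjoin k (Set.range y))
    (hc : Nat.card κ ≤ Nat.card ι) : AlgebraicIndependent k y :=
  algebraicIndependent_of_isAlgebraic hx (fun i => isAlgebraic_algebraMap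
    (⟨x i, h i⟩ : IntermediateField.adjoin k (Set.range y))) hc

theorem inPure_bot : InPure (⊥ : IntermediateField k F) :=
  ⟨Empty, inferInstance, Empty.elim, algebraicIndependent_empty_type_iff.2
    (algebraMap k F).injective, by simp [Set.range_eq_empty]⟩

/-- Lüroth's theorem for subfields of a simple transcendental extension. -/
theorem inPure_of_le_adjoin_simple {t : F} (ht : Transcendental k t) {K : IntermediateField k F}
    (hK : K ≤ IntermediateField.adjoin k {t}) : InPure K := by
  let φ : RatFunc k →ₐ[k] F :=
    (IntermediateField.val _).comp (RatFunc.algEquivOfTranscendental t ht).toAlgHom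
  have hφ : φ.fieldRange = IntermediateField.adjoin k {t} := by
    ext y
    constructor
    · rintro ⟨u, rfl⟩
      exact (RatFunc.algEquivOfTranscendental t ht u).2
    · intro hy
      exact ⟨(RatFunc.algEquivOfTranscendental t ht).symm ⟨y, hy⟩, by simp [φ]⟩
  have hmap : (K.comap φ).map φ = K := by
    ext y
    constructor
    · rintro ⟨u, hu, rfl⟩
      exact hu
    · intro hy
      obtain ⟨u, rfl⟩ : y ∈ φ.fieldRange := hφ ▸ hK hy
      exact ⟨u, hy, rfl⟩
  by_cases hE : K.comap φ = ⊥
  · rw [← hmap, hE, IntermediateField.map_bot]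
    exact inPure_bot
  · have h1 := RatFunc.Luroth.eq_adjoin_generator (E := K.comap φ)
    have h2 : Transcendental k (RatFunc.Luroth.generator (K.comap φ)) :=
      RatFunc.Luroth.transcendental_generator hE
    refine ⟨Unit, inferInstance, fun _ => φ (RatFunc.Luroth.generator (K.comap φ)), ?_, ?_⟩
    · rw [algebraicIndependent_unique_type_iff]
      exact fun h => h2 ((isAlgebraic_algHom_iff φ φ.injective).1 h)
    · refine Eq.trans ?_ hmap
      conv_rhs => rw [h1]
      rw [IntermediateField.adjoin_map]
      simp
end

section
variable {k F G : Type*} [Field k] [Field F] [Algebra k F] [Group G] {a : G →* (F ≃ₐ[k] F)}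

open IntermediateField

theorem stable_adjoin {s : Set F} {e : F ≃ₐ[k] F} (h : ∀ y ∈ s, e y ∈ adjoin k s) :
    ∀ y ∈ adjoin k s, e y ∈ adjoin k s := by
  have : adjoin k s ≤ (adjoin k s).comap (e : F →ₐ[k] F) := adjoin_le_iff.2 fun y hy => h y hy
  exact fun y hy => this hy

theorem pureOver_inv_insert [Finite G] {s : Set F} (hs : ∀ g, ∀ y ∈ s, a g y ∈ adjoin k s) {t : F}
    (ht : Transcendental (adjoin k s) t)
    (hta : ∀ g, ∃ α ∈ adjoin k s, ∃ β ∈ adjoin k s, a g t = α * t + β) :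
    PureOver Unit (inv a (adjoin k s)) (inv a (adjoin k (insert t s))) := by
  have := miyata (a := a) (L := adjoin k s) (fun g => stable_adjoin (hs g)) ht fun g => by
    obtain ⟨α, hα, β, hβ, h⟩ := hta g
    exact ⟨⟨α, hα⟩, ⟨β, hβ⟩, h⟩
  rwa [adjoin_adjoin_left, Set.union_singleton] at this

theorem inPure_inv_pair [Finite G] {p q : F} (hi : AlgebraicIndependent k ![p, q])
    (hp : ∀ g, a g p ∈ adjoin k {p})
    (hq : ∀ g, ∃ α ∈ adjoin k {p}, ∃ β ∈ adjoin k {p}, a g q = α * q + β) :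
    InPure (inv a (adjoin k {q, p})) := by
  have h1 : InPure (inv a (adjoin k {p})) :=
    inPure_of_le_adjoin_simple (hi.transcendental 0) inv_le
  have h2 := hi.transcendental_adjoin (s := {0}) (i := 1) (by simp)
  rw [Set.image_singleton, ← transcendental_adjoin_iff] at h2
  exact h1.of_pureOver (pureOver_inv_insert (by simpa using hp) h2 hq)

/-- A finite group acting linearly on algebraically independent elements through a
representation. -/
structure LinAct {n : ℕ} (a : G →* (F ≃ₐ[k] F)) (x : Fin n → F)
    (ρ : G →* Matrix.GeneralLinearGroup (Fin n) k) : Prop where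
  indep : AlgebraicIndependent k x
  act : ∀ g i, a g (x i) = ∑ j, (ρ g⁻¹ : Matrix (Fin n) (Fin n) k) i j • x j

namespace LinAct
variable {n : ℕ} {x : Fin n → F} {ρ : G →* Matrix.GeneralLinearGroup (Fin n) k}

theorem mem_adjoin (h : LinAct a x ρ) (g : G) : ∀ y ∈ Set.range x, a g y ∈ adjoin k (Set.range x) := by
  rintro _ ⟨i, rfl⟩
  rw [h.act]
  exact sum_mem fun j _ => IntermediateField.smul_mem _ (subset_adjoin _ _ (Set.mem_range_self j))

theorem stable (h : LinAct a x ρ) (g : G) : ∀ y ∈ adjoin k (Set.range x),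
    a g y ∈ adjoin k (Set.range x) :=
  stable_adjoin (h.mem_adjoin g)

theorem ne_zero (h : LinAct a x ρ) (i : Fin n) : x i ≠ 0 := h.indep.ne_zero i

end LinAct

theorem range_fin_three {α : Type*} (x : Fin 3 → α) : Set.range x = {x 0, x 1, x 2} := by
  ext y; simp [Fin.exists_fin_succ, eq_comm]

theorem adjoin_ratios {x : Fin 3 → F} (h : x 2 ≠ 0) :
    adjoin k {x 2, x 0 / x 2, x 1 / x 2} = adjoin k (Set.range x) := by
  rw [range_fin_three]
  apply le_antisymm <;> rw [adjoin_le_iff]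
  · have h0 : x 0 ∈ adjoin k {x 0, x 1, x 2} := subset_adjoin _ _ (by simp)
    have h1 : x 1 ∈ adjoin k {x 0, x 1, x 2} := subset_adjoin _ _ (by simp)
    have h2 : x 2 ∈ adjoin k {x 0, x 1, x 2} := subset_adjoin _ _ (by simp)
    rintro y (rfl | rfl | rfl)
    exacts [h2, div_mem h0 h2, div_mem h1 h2]
  · have h2 : x 2 ∈ adjoin k {x 2, x 0 / x 2, x 1 / x 2} := subset_adjoin _ _ (by simp)
    have h0 : x 0 / x 2 ∈ adjoin k {x 2, x 0 / x 2, x 1 / x 2} := subset_adjoin _ _ (by simp)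
    have h1 : x 1 / x 2 ∈ adjoin k {x 2, x 0 / x 2, x 1 / x 2} := subset_adjoin _ _ (by simp)
    rintro y (rfl | rfl | rfl)
    · have := mul_mem h0 h2; rwa [div_mul_cancel₀ _ h] at this
    · have := mul_mem h1 h2; rwa [div_mul_cancel₀ _ h] at this
    · exact h2

theorem algebraicIndependent_ratios {x : Fin 3 → F} (h : AlgebraicIndependent k x) :
    AlgebraicIndependent k ![x 2, x 0 / x 2, x 1 / x 2] := by
  refine algebraicIndependent_of_mem_adjoin h (fun i => ?_) le_rfl
  have : Set.range ![x 2, x 0 / x 2, x 1 / x 2] = {x 2, x 0 / x 2, x 1 / x 2} :=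
    range_fin_three _
  rw [this, adjoin_ratios (h.ne_zero 2)]
  exact subset_adjoin _ _ ⟨i, rfl⟩

theorem LinAct.ratio_act {x : Fin 3 → F} {ρ : G →* Matrix.GeneralLinearGroup (Fin 3) k}
    (h : LinAct a x ρ) (g : G) (i : Fin 3) :
    ∃ α ∈ adjoin k {x 0 / x 2, x 1 / x 2}, a g (x i) = α * x 2 := by
  have h0 : x 0 / x 2 ∈ adjoin k {x 0 / x 2, x 1 / x 2} := subset_adjoin _ _ (by simp)
  have h1 : x 1 / x 2 ∈ adjoin k {x 0 / x 2, x 1 / x 2} := subset_adjoin _ _ (by simp)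
  have hx := h.ne_zero 2
  refine ⟨(ρ g⁻¹ : Matrix (Fin 3) (Fin 3) k) i 0 • (x 0 / x 2) + (ρ g⁻¹ : Matrix (Fin 3) (Fin 3) k) i 1 • (x 1 / x 2) +
    (ρ g⁻¹ : Matrix (Fin 3) (Fin 3) k) i 2 • 1, ?_, ?_⟩
  · exact add_mem (add_mem (IntermediateField.smul_mem _ h0) (IntermediateField.smul_mem _ h1))
      (IntermediateField.smul_mem _ (one_mem _))
  · rw [h.act, Fin.sum_univ_three]
    simp only [Algebra.smul_def]
    field_simp

/-- The invariants of a linear action in three variables are purely transcendental of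
degree one over the invariants of degree zero. -/
theorem LinAct.cone [Finite G] {x : Fin 3 → F} {ρ : G →* Matrix.GeneralLinearGroup (Fin 3) k}
    (h : LinAct a x ρ) : PureOver Unit (inv a (adjoin k {x 0 / x 2, x 1 / x 2}))
      (inv a (adjoin k (Set.range x))) := by
  rw [← adjoin_ratios (h.ne_zero 2)]
  refine pureOver_inv_insert (fun g => ?_) ?_ fun g => ?_
  · have key : ∀ i, a g (x i / x 2) ∈ adjoin k {x 0 / x 2, x 1 / x 2} := by
      intro i
      obtain ⟨α, hα, e⟩ := h.ratio_act g i
      obtain ⟨β, hβ, e'⟩ := h.ratio_act g 2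
      rw [map_div₀, e, e', mul_div_mul_right _ _ (h.ne_zero 2)]
      exact div_mem hα hβ
    rintro y (rfl | rfl)
    exacts [key 0, key 1]
  · have h2 := (algebraicIndependent_ratios h.indep).transcendental_adjoin (s := {1, 2}) (i := 0)
      (by simp)
    rw [Set.image_pair, ← transcendental_adjoin_iff] at h2
    exact h2
  · obtain ⟨α, hα, e⟩ := h.ratio_act g 2
    exact ⟨α, hα, 0, zero_mem _, by rw [e, add_zero]⟩

/-- If the span of the first two variables is stable, the invariants are purely transcendental. -/
theorem LinAct.inPure_of_stable_plane [Finite G] {x : Fin 3 → F}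
    {ρ : G →* Matrix.GeneralLinearGroup (Fin 3) k}
    (h : LinAct a x ρ) (h0 : ∀ g, (ρ g : Matrix (Fin 3) (Fin 3) k) 0 2 = 0)
    (h1 : ∀ g, (ρ g : Matrix (Fin 3) (Fin 3) k) 1 2 = 0) : InPure (inv a (adjoin k (Set.range x))) := by
  have hx1 := h.ne_zero 1
  set u := x 0 / x 1 with hu
  have hadj : adjoin k {x 2, x 1, u} = adjoin k (Set.range x) := by
    rw [range_fin_three]
    apply le_antisymm <;> rw [adjoin_le_iff]
    · have h0 : x 0 ∈ adjoin k {x 0, x 1, x 2} := subset_adjoin _ _ (by simp)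
      have h1 : x 1 ∈ adjoin k {x 0, x 1, x 2} := subset_adjoin _ _ (by simp)
      have h2 : x 2 ∈ adjoin k {x 0, x 1, x 2} := subset_adjoin _ _ (by simp)
      rintro y (rfl | rfl | rfl)
      exacts [h2, h1, div_mem h0 h1]
    · have h2 : x 2 ∈ adjoin k {x 2, x 1, u} := subset_adjoin _ _ (by simp)
      have h0 : u ∈ adjoin k {x 2, x 1, u} := subset_adjoin _ _ (by simp)
      have h1 : x 1 ∈ adjoin k {x 2, x 1, u} := subset_adjoin _ _ (by simp)
      rintro y (rfl | rfl | rfl)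
      · have := mul_mem h0 h1; rwa [div_mul_cancel₀ _ hx1] at this
      · exact h1
      · exact h2
  have hind : AlgebraicIndependent k ![u, x 1, x 2] := by
    refine algebraicIndependent_of_mem_adjoin h.indep (fun i => ?_) le_rfl
    have : Set.range ![u, x 1, x 2] = {x 2, x 1, u} :=
      (range_fin_three _).trans (by simp only [Matrix.cons_val]; ext; simp; tauto)
    rw [this, hadj]
    exact subset_adjoin _ _ ⟨i, rfl⟩
  have act0 : ∀ g, a g (x 0) = ((ρ g⁻¹ : Matrix (Fin 3) (Fin 3) k) 0 0 • u + (ρ g⁻¹ : Matrix (Fin 3) (Fin 3) k) 0 1 • 1) * x 1 := by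
    intro g
    rw [h.act, Fin.sum_univ_three, h0]
    simp only [Algebra.smul_def, hu]
    field_simp
    simp
  have act1 : ∀ g, a g (x 1) = ((ρ g⁻¹ : Matrix (Fin 3) (Fin 3) k) 1 0 • u + (ρ g⁻¹ : Matrix (Fin 3) (Fin 3) k) 1 1 • 1) * x 1 := by
    intro g
    rw [h.act, Fin.sum_univ_three, h1]
    simp only [Algebra.smul_def, hu]
    field_simp
    simp
  have hmem : ∀ c d : k, c • u + d • 1 ∈ adjoin k {u} := fun c d =>
    add_mem (IntermediateField.smul_mem _ (mem_adjoin_simple_self k u))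
      (IntermediateField.smul_mem _ (one_mem _))
  have hp : ∀ g, a g u ∈ adjoin k {u} := by
    intro g
    rw [hu, map_div₀, act0, act1, mul_div_mul_right _ _ hx1]
    exact div_mem (hmem _ _) (hmem _ _)
  have hq : ∀ g, ∃ α ∈ adjoin k {u}, ∃ β ∈ adjoin k {u}, a g (x 1) = α * x 1 + β := fun g =>
    ⟨_, hmem _ _, 0, zero_mem _, by rw [act1, add_zero]⟩
  have hle : adjoin k {u} ≤ adjoin k {x 1, u} := adjoin.mono _ _ _ (by simp)
  have hm1 : x 1 ∈ adjoin k {x 1, u} := subset_adjoin _ _ (by simp)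
  have hm0 : u ∈ adjoin k {x 1, u} := subset_adjoin _ _ (by simp)
  have p2 : InPure (inv a (adjoin k {x 1, u})) := by
    refine inPure_inv_pair ?_ hp hq
    have := hind.comp ![0, 1] (by decide)
    convert this using 1
    ext i; fin_cases i <;> rfl
  rw [← hadj]
  refine p2.of_pureOver (pureOver_inv_insert (fun g => ?_) ?_ fun g => ?_)
  · rintro y (rfl | rfl)
    · rw [act1]
      exact mul_mem (hle (hmem _ _)) hm1
    · exact hle (hp g)
  · have h2 := hind.transcendental_adjoin (s := {1, 0}) (i := 2) (by simp)
    rw [Set.image_pair, ← transcendental_adjoin_iff] at h2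
    exact h2
  · let c := (ρ g⁻¹ : Matrix (Fin 3) (Fin 3) k) 2
    refine ⟨c 2 • 1, IntermediateField.smul_mem _ (one_mem _), c 0 • (u * x 1) + c 1 • x 1,
      add_mem (IntermediateField.smul_mem _ (mul_mem hm0 hm1)) (IntermediateField.smul_mem _ hm1), ?_⟩
    rw [h.act, Fin.sum_univ_three]
    simp only [Algebra.smul_def, hu, c]
    field_simp
    ring
end

section
variable {k F F' G : Type*} [Field k] [Field F] [Algebra k F] [Field F'] [Algebra k F'] [Group G]
  {a : G →* (F ≃ₐ[k] F)} {a' : G →* (F' ≃ₐ[k] F')}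

open IntermediateField

theorem InPure.map {K : IntermediateField k F} (h : InPure K) (φ : F →ₐ[k] F') :
    InPure (K.map φ) := by
  obtain ⟨ι, hι, y, hy, rfl⟩ := h
  refine ⟨ι, hι, φ ∘ y, hy.map' φ.injective, ?_⟩
  rw [adjoin_map, Set.range_comp]

theorem InPure.comap_val {K L : IntermediateField k F} (h : InPure K) (hKL : K ≤ L) :
    InPure (K.comap L.val) := by
  obtain ⟨ι, hι, y, hy, rfl⟩ := h
  have hmem : ∀ i, y i ∈ L := fun i => hKL (subset_adjoin _ _ ⟨i, rfl⟩)
  refine ⟨ι, hι, fun i => ⟨y i, hmem i⟩, hy.of_comp L.val, ?_⟩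
  apply IntermediateField.map_injective L.val
  rw [adjoin_map, ← Set.range_comp]
  change adjoin k (Set.range y) = _
  ext z
  constructor
  · intro hz
    exact ⟨⟨z, hKL hz⟩, hz, rfl⟩
  · rintro ⟨z, hz, rfl⟩
    exact hz

theorem InPure.congr {K : IntermediateField k F} {K' : IntermediateField k F'} (h : InPure K)
    (e : K ≃ₐ[k] K') : InPure K' := by
  have h1 := (h.comap_val le_rfl).map (K'.val.comp (e : K →ₐ[k] K'))
  convert h1
  ext z
  constructor
  · intro hz
    exact ⟨e.symm ⟨z, hz⟩, (e.symm ⟨z, hz⟩).2, by simp⟩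
  · rintro ⟨u, -, rfl⟩
    exact (e u).2

theorem PureOver.nonempty_algEquiv {ι : Type} {K M : IntermediateField k F} (h : PureOver ι K M) :
    Nonempty (FractionRing (MvPolynomial ι K) ≃ₐ[k] M) := by
  obtain ⟨y, hy, rfl⟩ := h
  exact ⟨hy.aevalEquivField.restrictScalars k⟩

theorem PureOver.inPure_of_inPure {ι : Type} {K M M' : IntermediateField k F}
    (h : PureOver ι K M) (h' : PureOver ι K M') (hM : InPure M) : InPure M' := by
  obtain ⟨e⟩ := h.nonempty_algEquiv
  obtain ⟨e'⟩ := h'.nonempty_algEquiv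
  exact hM.congr (e.symm.trans e')

namespace LinAct
variable {n : ℕ} {x : Fin n → F} {x' : Fin n → F'} {ρ : G →* Matrix.GeneralLinearGroup (Fin n) k}

/-- The invariants of a linear action only depend on the representation. -/
theorem nonempty_algEquiv (h : LinAct a x ρ) (h' : LinAct a' x' ρ) :
    Nonempty (inv a (adjoin k (Set.range x)) ≃ₐ[k] inv a' (adjoin k (Set.range x'))) := by
  let ψ := h.indep.aevalEquivField.symm.trans h'.indep.aevalEquivField
  have hψx : ∀ i (hi : x i ∈ adjoin k (Set.range x)), (ψ ⟨x i, hi⟩ : F') = x' i := by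
    intro i hi
    have : h.indep.aevalEquivField.symm ⟨x i, hi⟩ =
        algebraMap _ _ (MvPolynomial.X i : MvPolynomial (Fin n) k) := by
      rw [AlgEquiv.symm_apply_eq]
      ext
      rw [AlgebraicIndependent.aevalEquivField_algebraMap_apply_coe]
      simp
    simp only [ψ, AlgEquiv.trans_apply, this]
    rw [AlgebraicIndependent.aevalEquivField_algebraMap_apply_coe]
    simp
  let Ψ : adjoin k (Set.range x) →ₐ[k] F' := (adjoin k (Set.range x')).val.comp (ψ : _ →ₐ[k] _)
  have heq : ∀ g (u : adjoin k (Set.range x)), a' g (Ψ u) = Ψ ⟨a g u, h.stable g _ u.2⟩ := by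
    intro g
    let r : adjoin k (Set.range x) →ₐ[k] adjoin k (Set.range x) :=
      ((a g : F →ₐ[k] F).comp (adjoin k (Set.range x)).val).codRestrict
        (adjoin k (Set.range x)).toSubalgebra fun u => h.stable g _ u.2
    have : (a' g : F' →ₐ[k] F').comp Ψ = Ψ.comp r := by
      apply adjoin_algHom_ext
      rintro _ ⟨i, rfl⟩
      have hr : ∀ hx, r ⟨x i, hx⟩ = ∑ j, (ρ g⁻¹ : Matrix (Fin n) (Fin n) k) i j •
          ⟨x j, subset_adjoin _ _ ⟨j, rfl⟩⟩ := by
        intro hx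
        ext
        rw [IntermediateField.coe_sum]
        exact h.act g i
      have hΨ : ∀ j hj, Ψ ⟨x j, hj⟩ = x' j := hψx
      change a' g (Ψ ⟨x i, _⟩) = Ψ (r ⟨x i, _⟩)
      rw [hΨ, hr, map_sum]
      simp_rw [map_smul, hΨ]
      exact h'.act g i
    exact fun u => DFunLike.congr_fun this u
  have hmem : ∀ u : inv a (adjoin k (Set.range x)), Ψ (IntermediateField.inclusion inv_le u) ∈
      inv a' (adjoin k (Set.range x')) := by
    refine fun u => mem_inv.2 ⟨(ψ _).2, fun g => ?_⟩
    rw [heq]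
    congr 1
    exact Subtype.ext ((mem_inv.1 u.2).2 g)
  refine ⟨AlgEquiv.ofBijective ((Ψ.comp (IntermediateField.inclusion inv_le)).codRestrict
    (inv a' (adjoin k (Set.range x'))).toSubalgebra hmem) ⟨RingHom.injective _, ?_⟩⟩
  rintro ⟨z, hz⟩
  obtain ⟨h1, h2⟩ := mem_inv.1 hz
  obtain ⟨u, hu⟩ := ψ.surjective ⟨z, h1⟩
  have hu' : Ψ u = z := congrArg Subtype.val hu
  refine ⟨⟨u, mem_inv.2 ⟨u.2, fun g => ?_⟩⟩, Subtype.ext hu'⟩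
  have h3 := heq g u
  rw [hu', h2, ← hu'] at h3
  exact (congrArg Subtype.val (Ψ.injective h3)).symm

theorem inPure_of_inPure (h : LinAct a x ρ) (h' : LinAct a' x' ρ)
    (hp : InPure (inv a (adjoin k (Set.range x)))) :
    InPure (inv a' (adjoin k (Set.range x'))) :=
  hp.congr (h.nonempty_algEquiv h').some

end LinAct

/-- The algebra endomorphism of a polynomial ring given by a matrix. -/
noncomputable def linSubst {n : ℕ} (M : Matrix (Fin n) (Fin n) k) :
    MvPolynomial (Fin n) k →ₐ[k] MvPolynomial (Fin n) k :=
  MvPolynomial.aeval fun i => ∑ j, M i j • MvPolynomial.X j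

theorem linSubst_X {n : ℕ} (M : Matrix (Fin n) (Fin n) k) (i : Fin n) :
    linSubst M (MvPolynomial.X i) = ∑ j, M i j • MvPolynomial.X j := by
  simp [linSubst]

theorem linSubst_comp {n : ℕ} (M N : Matrix (Fin n) (Fin n) k) :
    (linSubst M).comp (linSubst N) = linSubst (N * M) := by
  apply MvPolynomial.algHom_ext
  intro i
  rw [AlgHom.comp_apply, linSubst_X, linSubst_X, map_sum]
  simp_rw [map_smul, linSubst_X, Finset.smul_sum, smul_smul, Matrix.mul_apply, Finset.sum_smul]
  exact Finset.sum_comm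

theorem linSubst_one {n : ℕ} : linSubst (1 : Matrix (Fin n) (Fin n) k) = AlgHom.id k _ := by
  apply MvPolynomial.algHom_ext
  intro i
  rw [linSubst_X]
  simp [Matrix.one_apply]

/-- The action of a group on a polynomial ring through a matrix representation. -/
noncomputable def polyAct {n : ℕ} (ρ : G →* Matrix.GeneralLinearGroup (Fin n) k) :
    G →* (MvPolynomial (Fin n) k ≃ₐ[k] MvPolynomial (Fin n) k) where
  toFun g := AlgEquiv.ofAlgHom (linSubst (ρ g⁻¹ : Matrix (Fin n) (Fin n) k))
    (linSubst (ρ g : Matrix (Fin n) (Fin n) k))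
    (by rw [linSubst_comp, ← Units.val_mul, ← map_mul]; simp [linSubst_one])
    (by rw [linSubst_comp, ← Units.val_mul, ← map_mul]; simp [linSubst_one])
  map_one' := by
    ext i
    simp [linSubst_one]
  map_mul' g h := by
    apply AlgEquiv.ext
    intro p
    change linSubst _ p = (linSubst _).comp (linSubst _) p
    rw [linSubst_comp, ← Units.val_mul, ← map_mul, mul_inv_rev]

theorem polyAct_X {n : ℕ} (ρ : G →* Matrix.GeneralLinearGroup (Fin n) k) (g : G) (i : Fin n) :
    polyAct ρ g (MvPolynomial.X i) =
      ∑ j, (ρ g⁻¹ : Matrix (Fin n) (Fin n) k) i j • MvPolynomial.X j :=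
  linSubst_X _ i

/-- The action of a group on a field of rational functions through a matrix representation. -/
noncomputable def ratAct {n : ℕ} (ρ : G →* Matrix.GeneralLinearGroup (Fin n) k) :
    G →* (FractionRing (MvPolynomial (Fin n) k) ≃ₐ[k] FractionRing (MvPolynomial (Fin n) k)) :=
  (IsFractionRing.fieldEquivOfAlgEquivHom k (FractionRing (MvPolynomial (Fin n) k))).comp (polyAct ρ)

/-- The coordinates, as rational functions. -/
noncomputable def ratX (k : Type*) [Field k] (n : ℕ) (i : Fin n) :
    FractionRing (MvPolynomial (Fin n) k) :=
  algebraMap (MvPolynomial (Fin n) k) _ (MvPolynomial.X i)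

theorem ratX_indep (n : ℕ) : AlgebraicIndependent k (ratX k n) := by
  have := (MvPolynomial.algebraicIndependent_X (Fin n) k).map'
    (f := IsScalarTower.toAlgHom k (MvPolynomial (Fin n) k) (FractionRing (MvPolynomial (Fin n) k)))
    (IsFractionRing.injective _ _)
  exact this

theorem ratAct_algebraMap {n : ℕ} (ρ : G →* Matrix.GeneralLinearGroup (Fin n) k) (g : G)
    (p : MvPolynomial (Fin n) k) :
    ratAct ρ g (algebraMap _ _ p) = algebraMap _ _ (polyAct ρ g p) := by
  simp [ratAct]

theorem linAct_ratAct {n : ℕ} (ρ : G →* Matrix.GeneralLinearGroup (Fin n) k) :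
    LinAct (ratAct ρ) (ratX k n) ρ where
  indep := ratX_indep n
  act g i := by
    have := ratAct_algebraMap ρ g (MvPolynomial.X i)
    rw [polyAct_X, map_sum] at this
    refine this.trans (Finset.sum_congr rfl fun j _ => ?_)
    rw [Algebra.smul_def, Algebra.smul_def, map_mul, ← IsScalarTower.algebraMap_apply]
    rfl
end

section
variable {k F G : Type*} [Field k] [Field F] [Algebra k F] [Group G] {a : G →* (F ≃ₐ[k] F)}

open IntermediateField

/-- The linear change of variables given by a matrix. -/
def changeVar {n : ℕ} (P : Matrix (Fin n) (Fin n) k) (x : Fin n → F) : Fin n → F :=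
  fun i => ∑ j, P i j • x j

theorem changeVar_mul {n : ℕ} (P Q : Matrix (Fin n) (Fin n) k) (x : Fin n → F) :
    changeVar P (changeVar Q x) = changeVar (P * Q) x := by
  funext i
  simp only [changeVar, Finset.smul_sum, smul_smul, Matrix.mul_apply, Finset.sum_smul]
  exact Finset.sum_comm

theorem changeVar_one {n : ℕ} (x : Fin n → F) :
    changeVar (1 : Matrix (Fin n) (Fin n) k) x = x := by
  funext i
  simp [changeVar, Matrix.one_apply]

theorem changeVar_mem_adjoin {n : ℕ} (P : Matrix (Fin n) (Fin n) k) (x : Fin n → F) (i : Fin n) :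
    changeVar P x i ∈ adjoin k (Set.range x) :=
  sum_mem fun j _ => IntermediateField.smul_mem _ (subset_adjoin _ _ (Set.mem_range_self j))

theorem adjoin_changeVar {n : ℕ} (P : Matrix.GeneralLinearGroup (Fin n) k) (x : Fin n → F) :
    adjoin k (Set.range (changeVar (P : Matrix (Fin n) (Fin n) k) x)) = adjoin k (Set.range x) := by
  apply le_antisymm <;> rw [adjoin_le_iff]
  · rintro _ ⟨i, rfl⟩
    exact changeVar_mem_adjoin _ _ i
  · rintro _ ⟨i, rfl⟩
    have := changeVar_mem_adjoin (P⁻¹ : Matrix.GeneralLinearGroup (Fin n) k).val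
      (changeVar (P : Matrix (Fin n) (Fin n) k) x) i
    rwa [changeVar_mul, ← Units.val_mul, inv_mul_cancel, Units.val_one, changeVar_one] at this

namespace LinAct
variable {n : ℕ} {x : Fin n → F} {ρ : G →* Matrix.GeneralLinearGroup (Fin n) k}

theorem act_changeVar (h : LinAct a x ρ) (P : Matrix (Fin n) (Fin n) k) (g : G) (i : Fin n) :
    a g (changeVar P x i) = changeVar (P * (ρ g⁻¹ : Matrix (Fin n) (Fin n) k)) x i := by
  rw [← changeVar_mul]
  simp only [changeVar, map_sum, map_smul, h.act]

theorem change (h : LinAct a x ρ) (P : Matrix.GeneralLinearGroup (Fin n) k) :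
    LinAct a (changeVar (P : Matrix (Fin n) (Fin n) k) x) ((MulAut.conj P).toMonoidHom.comp ρ) where
  indep := by
    refine algebraicIndependent_of_mem_adjoin h.indep (fun i => ?_) le_rfl
    rw [adjoin_changeVar]
    exact subset_adjoin _ _ ⟨i, rfl⟩
  act g i := by
    change _ = changeVar ((P * ρ g⁻¹ * P⁻¹ : Matrix.GeneralLinearGroup (Fin n) k) :
      Matrix (Fin n) (Fin n) k) _ i
    rw [changeVar_mul, ← Units.val_mul, inv_mul_cancel_right, Units.val_mul]
    exact h.act_changeVar _ g i

end LinAct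

theorem LinAct.inPure_of_submodule [Finite G] {x : Fin 3 → F}
    {ρ : G →* Matrix.GeneralLinearGroup (Fin 3) k} (h : LinAct a x ρ)
    (W : Submodule k (Fin 3 → k)) (hW : Module.finrank k W = 2)
    (hs : ∀ g, ∀ v ∈ W, Matrix.vecMul v (ρ g : Matrix (Fin 3) (Fin 3) k) ∈ W) :
    InPure (inv a (adjoin k (Set.range x))) := by
  let b := Module.finBasisOfFinrankEq k W hW
  let v : Fin 2 → (Fin 3 → k) := fun i => b i
  have hv : LinearIndependent k v := b.linearIndependent.map' W.subtype W.ker_subtype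
  have hspan : Submodule.span k (Set.range v) = W := by
    have := b.span_eq
    have h2 := congrArg (Submodule.map W.subtype) this
    rw [Submodule.map_span, ← Set.range_comp, Submodule.map_top, Submodule.range_subtype] at h2
    exact h2
  obtain ⟨w, hw⟩ : ∃ w, w ∉ W := by
    by_contra! hc
    have : W = ⊤ := eq_top_iff.2 fun w _ => hc w
    rw [this] at hW
    simp at hW
  have hind : LinearIndependent k (Fin.snoc v w : Fin 3 → (Fin 3 → k)) :=
    linearIndependent_finSnoc.2 ⟨hv, by rwa [hspan]⟩
  let P : Matrix (Fin 3) (Fin 3) k := Matrix.of (Fin.snoc v w : Fin 3 → (Fin 3 → k))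
  obtain ⟨Q, hQ⟩ : IsUnit P := Matrix.linearIndependent_rows_iff_isUnit.1 hind
  have hP : ∀ i : Fin 2, P i.castSucc = v i := fun i => Fin.snoc_castSucc (α := fun _ => Fin 3 → k) ..
  have key : ∀ g (i : Fin 2),
      (((MulAut.conj Q).toMonoidHom.comp ρ) g : Matrix (Fin 3) (Fin 3) k) i.castSucc 2 = 0 := by
    intro g i
    change (((Q * ρ g * Q⁻¹ : Matrix.GeneralLinearGroup (Fin 3) k)) :
      Matrix (Fin 3) (Fin 3) k) i.castSucc 2 = 0
    have h1 : Matrix.vecMul (v i) (ρ g : Matrix (Fin 3) (Fin 3) k) ∈ Submodule.span k (Set.range v) := by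
      rw [hspan]
      exact hs g _ (b i).2
    obtain ⟨c, hc⟩ := (Submodule.mem_span_range_iff_exists_fun k).1 h1
    have h2 : Matrix.vecMul (v i) (ρ g : Matrix (Fin 3) (Fin 3) k) = Matrix.vecMul ![c 0, c 1, 0] P := by
      rw [← hc, Matrix.vecMul_eq_sum, Fin.sum_univ_two, Fin.sum_univ_three]
      have e0 : P 0 = v 0 := hP 0
      have e1 : P 1 = v 1 := hP 1
      simp [e0, e1]
    have h3 : ((Q * ρ g * Q⁻¹ : Matrix.GeneralLinearGroup (Fin 3) k) :
        Matrix (Fin 3) (Fin 3) k) i.castSucc =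
        Matrix.vecMul (Matrix.vecMul (v i) (ρ g : Matrix (Fin 3) (Fin 3) k)) (Q⁻¹).val := by
      rw [Units.val_mul, Units.val_mul, hQ, Matrix.mul_apply_eq_vecMul, Matrix.mul_apply_eq_vecMul, hP]
    rw [h3, h2, ← hQ, Matrix.vecMul_vecMul, ← Units.val_mul, mul_inv_cancel]
    simp
  have := (h.change Q).inPure_of_stable_plane (fun g => key g 0) (fun g => key g 1)
  rwa [adjoin_changeVar] at this

/-- A nonzero singular matrix which the group preserves up to scalars makes the
invariants purely transcendental. -/
theorem LinAct.inPure_of_det_eq_zero [Finite G] {x : Fin 3 → F}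
    {ρ : G →* Matrix.GeneralLinearGroup (Fin 3) k} (h : LinAct a x ρ)
    {M : Matrix (Fin 3) (Fin 3) k} (hM0 : M ≠ 0) (hM : M.det = 0)
    (hc : ∀ g, ∃ c : k, (ρ g : Matrix (Fin 3) (Fin 3) k) * M =
      c • (M * (ρ g : Matrix (Fin 3) (Fin 3) k))) :
    InPure (inv a (adjoin k (Set.range x))) := by
  let T := M.vecMulLinear
  have hT0 : T ≠ 0 := by
    intro h0
    apply hM0
    ext i j
    have := congrFun (LinearMap.congr_fun h0 (Pi.single i 1)) j
    simpa [T, Matrix.vecMulLinear] using this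
  have hrn := T.finrank_range_add_finrank_ker
  have hk1 : 1 ≤ Module.finrank k (LinearMap.ker T) := by
    rw [Nat.one_le_iff_ne_zero, ne_eq, Submodule.finrank_eq_zero]
    intro hbot
    obtain ⟨v, hv0, hv⟩ := Matrix.exists_vecMul_eq_zero_iff.2 hM
    exact hv0 ((Submodule.mem_bot k).1 (hbot ▸ (LinearMap.mem_ker.2 hv : v ∈ LinearMap.ker T)))
  have hr1 : 1 ≤ Module.finrank k (LinearMap.range T) := by
    rw [Nat.one_le_iff_ne_zero, ne_eq, Submodule.finrank_eq_zero, LinearMap.range_eq_bot]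
    exact hT0
  have h3 : Module.finrank k (Fin 3 → k) = 3 := by simp
  rw [h3] at hrn
  by_cases hk : Module.finrank k (LinearMap.ker T) = 2
  · refine h.inPure_of_submodule _ hk fun g v hv => ?_
    obtain ⟨c, hc⟩ := hc g
    rw [LinearMap.mem_ker] at hv ⊢
    change Matrix.vecMul v M = 0 at hv
    change Matrix.vecMul _ M = 0
    rw [Matrix.vecMul_vecMul, hc, Matrix.vecMul_smul, ← Matrix.vecMul_vecMul, hv]
    simp
  · refine h.inPure_of_submodule (LinearMap.range T) (by omega) ?_
    rintro g _ ⟨v, rfl⟩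
    obtain ⟨c, hc⟩ := hc g
    have hc0 : c ≠ 0 := by
      rintro rfl
      rw [zero_smul] at hc
      apply hM0
      have := congrArg (fun N => ((ρ g)⁻¹).val * N) hc
      simpa [← mul_assoc, ← Units.val_mul] using this
    refine ⟨Matrix.vecMul v (c⁻¹ • (ρ g : Matrix (Fin 3) (Fin 3) k)), ?_⟩
    change Matrix.vecMul _ M = Matrix.vecMul (Matrix.vecMul v M) _
    rw [Matrix.vecMul_vecMul, Matrix.vecMul_vecMul, Matrix.smul_mul, hc, smul_smul,
      inv_mul_cancel₀ hc0, one_smul]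

theorem LinAct.inPure_of_commute [IsAlgClosed k] [Finite G] {x : Fin 3 → F}
    {ρ : G →* Matrix.GeneralLinearGroup (Fin 3) k} (h : LinAct a x ρ)
    {M : Matrix (Fin 3) (Fin 3) k} (hM : ∀ c : k, M ≠ c • 1)
    (hc : ∀ g, Commute (ρ g : Matrix (Fin 3) (Fin 3) k) M) :
    InPure (inv a (adjoin k (Set.range x))) := by
  obtain ⟨c, hr⟩ := IsAlgClosed.exists_root M.charpoly (by
    rw [Matrix.charpoly_degree_eq_dim]; simp)
  refine h.inPure_of_det_eq_zero (M := c • 1 - M) (sub_ne_zero.2 (hM c).symm) ?_ fun g => ⟨1, ?_⟩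
  · rw [Polynomial.IsRoot, Matrix.eval_charpoly] at hr
    rw [← hr, Matrix.scalar_apply, Matrix.smul_one_eq_diagonal]
  · rw [one_smul, mul_sub, sub_mul, (hc g).eq]
    simp
end

open MvPolynomial in
section
variable {k G : Type*} [Field k] [Group G] {n : ℕ}
  {ρ : G →* Matrix.GeneralLinearGroup (Fin n) k}

theorem polyAct_isHomogeneous {p : MvPolynomial (Fin n) k} {d : ℕ} (hp : p.IsHomogeneous d)
    (g : G) : (polyAct ρ g p).IsHomogeneous d := by
  have := hp.aeval (fun i => ∑ j, (ρ g⁻¹ : Matrix (Fin n) (Fin n) k) i j • X j)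
    (n := 1) fun i => IsHomogeneous.sum _ _ _ fun j _ =>
      (homogeneousSubmodule (Fin n) k 1).smul_mem _ (isHomogeneous_X k j)
  rwa [one_mul] at this

theorem polyAct_homogeneousComponent (p : MvPolynomial (Fin n) k) (d : ℕ) (g : G) :
    polyAct ρ g (homogeneousComponent d p) = homogeneousComponent d (polyAct ρ g p) := by
  conv_rhs => rw [← sum_homogeneousComponent p, map_sum, map_sum]
  simp_rw [homogeneousComponent_of_mem
    (polyAct_isHomogeneous (homogeneousComponent_isHomogeneous _ p) g)]
  rw [Finset.sum_ite_eq]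
  split_ifs with h
  · rfl
  · rw [homogeneousComponent_eq_zero, map_zero]
    simpa using h

theorem constantCoeff_polyAct (p : MvPolynomial (Fin n) k) (g : G) :
    constantCoeff (polyAct ρ g p) = constantCoeff p := by
  have h0 := polyAct_homogeneousComponent (ρ := ρ) p 0 g
  rw [homogeneousComponent_zero, homogeneousComponent_zero, ← algebraMap_eq, AlgEquiv.commutes] at h0
  exact (C_injective _ _ h0).symm

theorem totalDegree_polyAct_le (p : MvPolynomial (Fin n) k) (g : G) :
    (polyAct ρ g p).totalDegree ≤ p.totalDegree := by
  conv_lhs => rw [← sum_homogeneousComponent p, map_sum]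
  refine (totalDegree_finsetSum _ _).trans (Finset.sup_le fun d hd => ?_)
  refine (polyAct_isHomogeneous (homogeneousComponent_isHomogeneous _ p) g).totalDegree_le.trans ?_
  simpa [Nat.lt_succ_iff] using hd

/-- An element acting as a transvection or a reflection (or trivially). -/
def ActsAsReflection (ρ : G →* Matrix.GeneralLinearGroup (Fin n) k) (s : G) : Prop :=
  ∃ α β : Fin n → k, (ρ s⁻¹ : Matrix (Fin n) (Fin n) k) = 1 + Matrix.vecMulVec α β

theorem ActsAsReflection.exists_sub_eq {s : G} (hs : ActsAsReflection ρ s) : ∃ ℓ : MvPolynomial (Fin n) k,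
    ∀ p, ∃ q, polyAct ρ s p - p = ℓ * q ∧ (q = 0 ∨ q.totalDegree < p.totalDegree) := by
  obtain ⟨α, β, h⟩ := hs
  set ℓ : MvPolynomial (Fin n) k := ∑ j, β j • X j with hℓ
  have hX : ∀ i, polyAct ρ s (X i) = X i + ℓ * C (α i) := by
    intro i
    rw [polyAct_X, h, hℓ, Finset.sum_mul]
    simp only [Matrix.add_apply, Matrix.vecMulVec_apply, add_smul, Finset.sum_add_distrib]
    congr 1
    · simp [Matrix.one_apply]
    · refine Finset.sum_congr rfl fun j _ => ?_
      simp only [smul_eq_C_mul, map_mul]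
      ring
  have hd : ∀ p, ℓ ∣ polyAct ρ s p - p := by
    intro p
    rw [← Ideal.mem_span_singleton, ← Ideal.Quotient.mk_eq_mk_iff_sub_mem]
    have : ((Ideal.Quotient.mkₐ k (Ideal.span {ℓ})).comp (polyAct ρ s).toAlgHom) =
        Ideal.Quotient.mkₐ k (Ideal.span {ℓ}) := by
      apply algHom_ext
      intro i
      simp only [AlgHom.comp_apply]
      change Ideal.Quotient.mk _ (polyAct ρ s (X i)) = Ideal.Quotient.mk _ (X i)
      rw [hX, Ideal.Quotient.mk_eq_mk_iff_sub_mem, Ideal.mem_span_singleton]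
      exact ⟨C (α i), by ring⟩
    exact DFunLike.congr_fun this p
  refine ⟨ℓ, fun p => ?_⟩
  obtain ⟨q, hq⟩ := hd p
  by_cases hℓ0 : ℓ = 0
  · exact ⟨0, by rw [hq, hℓ0]; simp, Or.inl rfl⟩
  refine ⟨q, hq, or_iff_not_imp_left.2 fun hq0 => ?_⟩
  have hℓ1 : ℓ.IsHomogeneous 1 := IsHomogeneous.sum _ _ _ fun j _ =>
      (homogeneousSubmodule (Fin n) k 1).smul_mem _ (isHomogeneous_X k j)
  have h1 := totalDegree_mul_of_isDomain hℓ0 hq0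
  rw [hℓ1.totalDegree hℓ0, ← hq] at h1
  have h2 := totalDegree_sub (polyAct ρ s p) p
  rw [max_eq_right (totalDegree_polyAct_le p s)] at h2
  omega

/-- The algebra of invariant polynomials. -/
noncomputable def invPoly (ρ : G →* Matrix.GeneralLinearGroup (Fin n) k) :
    Subalgebra k (MvPolynomial (Fin n) k) where
  carrier := {p | ∀ g, polyAct ρ g p = p}
  mul_mem' hp hq g := by rw [map_mul, hp g, hq g]
  add_mem' hp hq g := by rw [map_add, hp g, hq g]
  algebraMap_mem' c g := AlgEquiv.commutes _ _

/-- The invariant polynomials without constant term. -/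
noncomputable def invPos (ρ : G →* Matrix.GeneralLinearGroup (Fin n) k) :
    Submodule k (MvPolynomial (Fin n) k) where
  carrier := {p | p ∈ invPoly ρ ∧ constantCoeff p = 0}
  zero_mem' := ⟨zero_mem _, map_zero _⟩
  add_mem' hp hq := ⟨add_mem hp.1 hq.1, by rw [map_add, hp.2, hq.2, add_zero]⟩
  smul_mem' c p hp := ⟨(invPoly ρ).smul_mem hp.1 c, by rw [constantCoeff_smul, hp.2, smul_zero]⟩

/-- Averaging over a finite group. -/
noncomputable def reynolds [Finite G] (ρ : G →* Matrix.GeneralLinearGroup (Fin n) k) :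
    MvPolynomial (Fin n) k →ₗ[k] MvPolynomial (Fin n) k :=
  have := Fintype.ofFinite G
  (Nat.card G : k)⁻¹ • ∑ g : G, (polyAct ρ g).toLinearMap

variable [Finite G]

theorem reynolds_apply [Fintype G] (p : MvPolynomial (Fin n) k) :
    reynolds ρ p = (Nat.card G : k)⁻¹ • ∑ g : G, polyAct ρ g p := by
  simp only [reynolds, LinearMap.smul_apply, LinearMap.sum_apply, AlgEquiv.toLinearMap_apply]
  congr! 

theorem reynolds_mem (p : MvPolynomial (Fin n) k) : reynolds ρ p ∈ invPoly ρ := by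
  have := Fintype.ofFinite G
  intro g
  rw [reynolds_apply, map_smul, map_sum]
  congr 1
  simp_rw [← AlgEquiv.mul_apply, ← map_mul]
  exact Equiv.sum_comp (Equiv.mulLeft g) fun h => polyAct ρ h p

theorem reynolds_mul (p : MvPolynomial (Fin n) k) {s : MvPolynomial (Fin n) k}
    (hs : s ∈ invPoly ρ) : reynolds ρ (p * s) = reynolds ρ p * s := by
  have := Fintype.ofFinite G
  rw [reynolds_apply, reynolds_apply, smul_mul_assoc, Finset.sum_mul]
  congr 1
  exact Finset.sum_congr rfl fun g _ => by rw [map_mul, hs g]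

theorem constantCoeff_reynolds [CharZero k] (p : MvPolynomial (Fin n) k) :
    constantCoeff (reynolds ρ p) = constantCoeff p := by
  have := Fintype.ofFinite G
  rw [reynolds_apply, constantCoeff_smul, map_sum]
  simp_rw [constantCoeff_polyAct]
  rw [Finset.sum_const, Finset.card_univ, Nat.card_eq_fintype_card, nsmul_eq_mul, smul_eq_mul,
    inv_mul_cancel_left₀ (Nat.cast_ne_zero.2 Fintype.card_ne_zero)]

theorem reynolds_of_mem [CharZero k] {s : MvPolynomial (Fin n) k} (hs : s ∈ invPoly ρ) :
    reynolds ρ s = s := by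
  have := Fintype.ofFinite G
  rw [reynolds_apply, Finset.sum_congr rfl fun g _ => hs g, Finset.sum_const, Finset.card_univ,
    Nat.card_eq_fintype_card, ← Nat.cast_smul_eq_nsmul k, smul_smul,
    inv_mul_cancel₀ (Nat.cast_ne_zero.2 Fintype.card_ne_zero), one_smul]

omit [Finite G] in
theorem exists_functional {ι : Type*} [Finite ι] {h : ι → MvPolynomial (Fin n) k}
    (h0 : h ≠ 0) : ∃ φ : MvPolynomial (Fin n) k →ₗ[k] k,
      (∀ s ∈ invPoly ρ, ∀ i, φ (s * h i) = constantCoeff s * φ (h i)) ∧ ∃ i, φ (h i) ≠ 0 := by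
  let m : Ideal (invPoly ρ) := RingHom.ker (constantCoeff.comp (invPoly ρ).val.toRingHom)
  let N : Submodule (invPoly ρ) (MvPolynomial (Fin n) k) := Submodule.span _ (Set.range h)
  have hN : ¬ N ≤ m • N := by
    intro hle
    obtain ⟨r, hr, hr'⟩ := Submodule.exists_sub_one_mem_and_smul_eq_zero_of_fg_of_le_smul m N
      (Submodule.fg_span (Set.finite_range h)) hle
    apply h0
    funext i
    have h1 : (r : MvPolynomial (Fin n) k) * h i = 0 := hr' _ (Submodule.subset_span ⟨i, rfl⟩)
    refine (mul_eq_zero.1 h1).resolve_left fun h2 => ?_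
    have h3 : constantCoeff ((r : MvPolynomial (Fin n) k) - 1) = 0 := hr
    simp [h2] at h3
  obtain ⟨i, hi⟩ : ∃ i, h i ∉ m • N := by
    by_contra! hc
    exact hN (Submodule.span_le.2 (by rintro _ ⟨i, rfl⟩; exact hc i))
  obtain ⟨φ, hφ, hφN⟩ := Submodule.exists_le_ker_of_notMem
    (p := (m • N).restrictScalars k) (v := h i) hi
  refine ⟨φ, fun s hs j => ?_, i, hφ⟩
  have hm : (s - C (constantCoeff s)) * h j ∈ (m • N).restrictScalars k := by
    have hs' : s - C (constantCoeff s) ∈ invPoly ρ :=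
      sub_mem hs ((invPoly ρ).algebraMap_mem _)
    have h1 : (⟨_, hs'⟩ : invPoly ρ) ∈ m := by
      change constantCoeff (s - C (constantCoeff s)) = 0
      rw [map_sub, constantCoeff_C, sub_self]
    have h2 : (⟨_, hs'⟩ : invPoly ρ) • h j ∈ m • N :=
      Submodule.smul_mem_smul h1 (Submodule.subset_span ⟨j, rfl⟩)
    rw [Submodule.restrictScalars_mem]
    rwa [Subalgebra.smul_def, smul_eq_mul] at h2
  have := hφN hm
  rw [LinearMap.mem_ker, sub_mul, map_sub, ← smul_eq_C_mul, map_smul, sub_eq_zero] at this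
  exact this

theorem sum_smul_mem_span [CharZero k] (hG : Subgroup.closure {s | ActsAsReflection ρ s} = ⊤)
    {ι : Type*} [Fintype ι] {h : ι → MvPolynomial (Fin n) k} (hh : ∀ i, h i ∈ invPoly ρ)
    {φ : MvPolynomial (Fin n) k →ₗ[k] k}
    (hφ : ∀ s ∈ invPoly ρ, ∀ i, φ (s * h i) = constantCoeff s * φ (h i))
    {p : ι → MvPolynomial (Fin n) k} (hp : ∑ i, p i * h i = 0) :
    ∑ i, φ (h i) • p i ∈ Ideal.span (invPos ρ : Set (MvPolynomial (Fin n) k)) := by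
  have := Fintype.ofFinite G
  obtain ⟨D, hD⟩ : ∃ D, ∀ i, p i = 0 ∨ (p i).totalDegree < D :=
    ⟨(Finset.univ.sup fun i => (p i).totalDegree) + 1, fun i => Or.inr
      (Nat.lt_succ_of_le (Finset.le_sup (f := fun i => (p i).totalDegree) (Finset.mem_univ i)))⟩
  induction D generalizing p with
  | zero =>
    have : p = 0 := funext fun i => (hD i).resolve_right (by simp)
    simp [this]
  | succ D ih =>
    set I := Ideal.span (invPos ρ : Set (MvPolynomial (Fin n) k)) with hI
    set P := ∑ i, φ (h i) • p i with hP
    have hIst : ∀ g, ∀ x ∈ I, polyAct ρ g x ∈ I := by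
      intro g x hx
      have : I ≤ I.comap (polyAct ρ g) := by
        rw [hI, Ideal.span_le]
        intro y hy
        change polyAct ρ g y ∈ Ideal.span (invPos ρ : Set (MvPolynomial (Fin n) k))
        rw [hy.1 g]
        exact Ideal.subset_span hy
      exact this hx
    have hs : ∀ s, ActsAsReflection ρ s → polyAct ρ s P - P ∈ I := by
      intro s hs
      obtain ⟨ℓ, hℓ⟩ := hs.exists_sub_eq
      by_cases hℓ0 : ℓ = 0
      · obtain ⟨q, hq, -⟩ := hℓ P
        rw [hq, hℓ0, zero_mul]
        exact zero_mem _
      choose q hq hqd using fun i => hℓ (p i)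
      have h1 : ∑ i, q i * h i = 0 := by
        refine (mul_eq_zero.1 ?_).resolve_left hℓ0
        have h2 : polyAct ρ s (∑ i, p i * h i) - ∑ i, p i * h i = 0 := by rw [hp]; simp
        rw [← h2, map_sum, ← Finset.sum_sub_distrib, Finset.mul_sum]
        refine Finset.sum_congr rfl fun i _ => ?_
        rw [map_mul, hh i s, ← sub_mul, hq, mul_assoc]
      have h3 := ih h1 fun i => by
        rcases hqd i with h4 | h4
        · exact Or.inl h4
        · rcases hD i with h5 | h5
          · rw [h5] at h4
            simp at h4
          · exact Or.inr (by omega)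
      have h4 : polyAct ρ s P - P = ℓ * ∑ i, φ (h i) • q i := by
        rw [hP, map_sum, ← Finset.sum_sub_distrib, Finset.mul_sum]
        refine Finset.sum_congr rfl fun i _ => ?_
        rw [map_smul, ← smul_sub, hq, mul_smul_comm]
      rw [h4]
      exact I.mul_mem_left _ h3
    have hg : ∀ g, polyAct ρ g P - P ∈ I := by
      intro g
      have : g ∈ Subgroup.closure {s | ActsAsReflection ρ s} := hG ▸ Subgroup.mem_top g
      induction this using Subgroup.closure_induction with
      | mem s h => exact hs s h
      | one => simp
      | mul x y _ _ hx hy =>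
        rw [map_mul, AlgEquiv.mul_apply]
        have := add_mem (hIst x _ hy) hx
        rwa [map_sub, sub_add_sub_cancel] at this
      | inv x _ hx =>
        have := neg_mem (hIst x⁻¹ _ hx)
        rwa [map_sub, ← AlgEquiv.mul_apply, ← map_mul, inv_mul_cancel, map_one, AlgEquiv.one_apply,
          neg_sub] at this
    have hR : reynolds ρ P - P ∈ I := by
      have h1 : reynolds ρ P - P = C (Nat.card G : k)⁻¹ * ∑ g : G, (polyAct ρ g P - P) := by
        rw [Finset.sum_sub_distrib, mul_sub, ← smul_eq_C_mul, ← smul_eq_C_mul, reynolds_apply,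
          Finset.sum_const, Finset.card_univ, Nat.card_eq_fintype_card, ← Nat.cast_smul_eq_nsmul k,
          smul_smul, inv_mul_cancel₀ (Nat.cast_ne_zero.2 Fintype.card_ne_zero), one_smul]
      rw [h1]
      exact I.mul_mem_left _ (sum_mem fun g _ => hg g)
    have hR0 : reynolds ρ P ∈ I := by
      refine Ideal.subset_span ⟨reynolds_mem P, ?_⟩
      have h1 : ∑ i, reynolds ρ (p i) * h i = 0 := by
        rw [← map_zero (reynolds ρ), ← hp, map_sum]
        exact Finset.sum_congr rfl fun i _ => (reynolds_mul _ (hh i)).symm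
      have h2 := congrArg φ h1
      rw [map_sum, map_zero] at h2
      rw [hP, map_sum, map_sum, ← h2]
      refine Finset.sum_congr rfl fun i _ => ?_
      rw [hφ _ (reynolds_mem _), map_smul, constantCoeff_smul, smul_eq_mul, mul_comm]
    have := sub_mem hR0 hR
    rwa [sub_sub_cancel] at this
end

open MvPolynomial in
section
variable {k : Type*} [Field k]

theorem pderiv_eq_zero_or_totalDegree_lt {σ : Type*} (i : σ) (p : MvPolynomial σ k) :
    pderiv i p = 0 ∨ (pderiv i p).totalDegree < p.totalDegree := by
  refine or_iff_not_imp_left.2 fun h => ?_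
  have h1 : ∀ m ∈ (pderiv i p).support, m.degree + 1 ≤ p.totalDegree := by
    intro m hm
    rw [mem_support_iff, coeff_pderiv] at hm
    have h2 : m + Finsupp.single i 1 ∈ p.support := mem_support_iff.2 (left_ne_zero_of_mul hm)
    have h3 := le_totalDegree h2
    have h4 : (m + Finsupp.single i 1).degree = m.degree + 1 := by simp
    rw [← h4]
    exact h3
  obtain ⟨m, hm⟩ := exists_coeff_ne_zero h
  have h2 := h1 m (mem_support_iff.2 hm)
  have h3 : (pderiv i p).totalDegree ≤ p.totalDegree - 1 :=
    Finset.sup_le fun m hm => Nat.le_sub_one_of_lt (h1 m hm)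
  omega

theorem eq_C_of_pderiv_eq_zero [CharZero k] {σ : Type*} {p : MvPolynomial σ k}
    (h : ∀ i, pderiv i p = 0) : p = C (coeff 0 p) := by
  classical
  ext m
  rw [coeff_C]
  split_ifs with h0
  · rw [h0]
  obtain ⟨i, hi⟩ : ∃ i, m i ≠ 0 := by
    by_contra! hc
    exact h0 (Finsupp.ext fun i => (hc i).symm)
  have h1 := congrArg (coeff (m - Finsupp.single i 1)) (h i)
  have h2 : m - Finsupp.single i 1 + Finsupp.single i 1 = m := by
    ext j
    by_cases hj : j = i
    · subst hj
      simp
      omega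
    · simp [Finsupp.single_eq_of_ne hj]
  rw [coeff_pderiv, h2, coeff_zero] at h1
  refine (mul_eq_zero.1 h1).resolve_right ?_
  exact Nat.cast_add_one_ne_zero _

theorem pderiv_aeval {σ τ : Type*} [Fintype σ] (f : σ → MvPolynomial τ k) (j : τ)
    (p : MvPolynomial σ k) :
    pderiv j (aeval f p) = ∑ i, aeval f (pderiv i p) * pderiv j (f i) := by
  classical
  induction p using MvPolynomial.induction_on with
  | C c => simp [algebraMap_eq]
  | add p q hp hq => simp only [map_add, hp, hq, add_mul, Finset.sum_add_distrib]
  | mul_X p i hp =>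
    simp only [map_mul, aeval_X, pderiv_mul, hp, map_add, add_mul, Finset.sum_add_distrib,
      Finset.sum_mul, pderiv_X]
    congr 1
    · exact Finset.sum_congr rfl fun l _ => by ring
    · rw [Finset.sum_eq_single i]
      · simp
      · intro l _ hl
        simp [Pi.single_eq_of_ne hl.symm]
      · simp

variable {G : Type*} [Group G] {n : ℕ}
  {ρ : G →* Matrix.GeneralLinearGroup (Fin n) k} [Finite G] [CharZero k]

theorem algebraicIndependent_of_reflections_of_finite
    (hG : Subgroup.closure {s | ActsAsReflection ρ s} = ⊤)
    {ι : Type*} [Finite ι] {f : ι → MvPolynomial (Fin n) k} {d : ι → ℕ} (hd : ∀ i, 0 < d i)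
    (hf : ∀ i, (f i).IsHomogeneous (d i)) (hM : ∀ i, f i ∈ invPos ρ)
    (hl : LinearIndependent k fun i => (invPos ρ * invPos ρ).mkQ (f i)) :
    AlgebraicIndependent k f := by
  have := Fintype.ofFinite ι
  suffices h : ∀ D (H : MvPolynomial ι k), H.totalDegree < D → aeval f H = 0 → H = 0 by
    rw [algebraicIndependent_iff]
    exact fun H => h _ H (Nat.lt_succ_self _)
  intro D
  induction D with
  | zero => exact fun H h => by simp at h
  | succ D ih =>
    intro H hHD hH
    by_contra hH0
    have hinv : ∀ p : MvPolynomial ι k, aeval f p ∈ invPoly ρ := by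
      intro p
      have : (aeval f : MvPolynomial ι k →ₐ[k] _).range ≤ invPoly ρ := by
        rw [← Algebra.adjoin_range_eq_range_aeval]
        exact Algebra.adjoin_le (by rintro _ ⟨i, rfl⟩; exact (hM i).1)
      exact this ⟨p, rfl⟩
    by_cases h0 : (fun i => aeval f (pderiv i H)) = 0
    · have h1 : ∀ i, pderiv i H = 0 := by
        intro i
        rcases pderiv_eq_zero_or_totalDegree_lt i H with h | h
        · exact h
        · exact ih _ (by omega) (congrFun h0 i)
      have h2 := eq_C_of_pderiv_eq_zero h1
      rw [h2, aeval_C, algebraMap_eq, C_eq_zero] at hH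
      rw [hH, C_0] at h2
      exact hH0 h2
    obtain ⟨φ, hφ, i₀, hi₀⟩ := exists_functional (ρ := ρ) h0
    have hj : ∀ j, ∑ i, φ (aeval f (pderiv i H)) • pderiv j (f i) ∈
        Ideal.span (invPos ρ : Set (MvPolynomial (Fin n) k)) := by
      intro j
      refine sum_smul_mem_span hG (fun i => hinv _) hφ ?_
      have := pderiv_aeval f j H
      rw [hH, map_zero] at this
      rw [this]
      exact Finset.sum_congr rfl fun i _ => mul_comm _ _
    have hR : ∀ j, ∀ r ∈ Ideal.span (invPos ρ : Set (MvPolynomial (Fin n) k)), ∀ a,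
        reynolds ρ (X j * a * r) ∈ invPos ρ * invPos ρ := by
      intro j r hr
      induction hr using Submodule.span_induction with
      | mem r hr =>
        intro a
        rw [reynolds_mul _ hr.1]
        refine Submodule.mul_mem_mul ⟨reynolds_mem _, ?_⟩ hr
        rw [constantCoeff_reynolds, map_mul, constantCoeff_X, zero_mul]
      | zero => simp
      | add x y _ _ hx hy =>
        intro a
        rw [mul_add, map_add]
        exact add_mem (hx a) (hy a)
      | smul b x _ hx =>
        intro a
        have := hx (a * b)
        rwa [smul_eq_mul, ← mul_assoc, mul_assoc _ a b]
    have hE : ∑ i, (φ (aeval f (pderiv i H)) * d i) • f i ∈ invPos ρ * invPos ρ := by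
      have h1 : ∑ i, (φ (aeval f (pderiv i H)) * d i) • f i =
          ∑ j, X j * 1 * ∑ i, φ (aeval f (pderiv i H)) • pderiv j (f i) := by
        simp_rw [mul_one, Finset.mul_sum]
        rw [Finset.sum_comm]
        refine Finset.sum_congr rfl fun i _ => ?_
        simp_rw [mul_smul_comm]
        rw [← Finset.smul_sum, (hf i).sum_X_mul_pderiv, mul_smul, Nat.cast_smul_eq_nsmul]
      have h2 : ∑ i, (φ (aeval f (pderiv i H)) * d i) • f i ∈ invPoly ρ :=
        sum_mem fun i _ => (invPoly ρ).smul_mem (hM i).1 _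
      rw [← reynolds_of_mem h2, h1, map_sum]
      exact sum_mem fun j _ => hR j _ (hj j) 1
    have h3 := Fintype.linearIndependent_iff.1 hl
      (fun i => φ (aeval f (pderiv i H)) * d i) (by
        simp_rw [← map_smul]
        rw [← map_sum, Submodule.mkQ_apply, Submodule.Quotient.mk_eq_zero]
        exact hE) i₀
    exact (mul_ne_zero hi₀ (Nat.cast_ne_zero.2 (hd i₀).ne')) h3

theorem algebraicIndependent_of_reflections
    (hG : Subgroup.closure {s | ActsAsReflection ρ s} = ⊤)
    {ι : Type*} {f : ι → MvPolynomial (Fin n) k} {d : ι → ℕ} (hd : ∀ i, 0 < d i)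
    (hf : ∀ i, (f i).IsHomogeneous (d i)) (hM : ∀ i, f i ∈ invPos ρ)
    (hl : LinearIndependent k fun i => (invPos ρ * invPos ρ).mkQ (f i)) :
    AlgebraicIndependent k f :=
  algebraicIndependent_of_finite_type fun t ht => by
    have : Finite t := ht
    exact algebraicIndependent_of_reflections_of_finite hG (d := fun i : t => d i)
      (fun i => hd i) (fun i => hf i) (fun i => hM i) (hl.comp _ Subtype.val_injective)
end

open MvPolynomial IntermediateField in
section
variable {k : Type*} [Field k] {F G : Type*} [Field F] [Algebra k F] [Group G] {n : ℕ}

theorem exists_linAct {a : G →* (F ≃ₐ[k] F)} {x : Fin n → F} (hx : AlgebraicIndependent k x)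
    (h : ∀ g i, a g (x i) ∈ Submodule.span k (Set.range x)) :
    ∃ ρ : G →* Matrix.GeneralLinearGroup (Fin n) k, LinAct a x ρ := by
  have hl : LinearIndependent k x := hx.linearIndependent
  choose A hA using fun g i => (Submodule.mem_span_range_iff_exists_fun k).1 (h g i)
  have huniq : ∀ c c' : Fin n → k, ∑ j, c j • x j = ∑ j, c' j • x j → c = c' := by
    intro c c' hc
    funext j
    refine sub_eq_zero.1 (Fintype.linearIndependent_iff.1 hl (fun j => c j - c' j) ?_ j)
    simp_rw [sub_smul]
    rw [Finset.sum_sub_distrib, hc, sub_self]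
  have h1 : ∀ i, A 1 i = (1 : Matrix (Fin n) (Fin n) k) i := by
    intro i
    apply huniq
    rw [hA, map_one]
    simp [Matrix.one_apply]
  have hmul : ∀ g h i, A (g * h) i = (Matrix.of (A h) * Matrix.of (A g) : Matrix _ _ k) i := by
    intro g h i
    apply huniq
    rw [hA, map_mul, AlgEquiv.mul_apply, ← hA h, map_sum]
    simp_rw [map_smul, ← hA g, Matrix.mul_apply, Finset.smul_sum, Finset.sum_smul, smul_smul]
    exact Finset.sum_comm
  let ψ : G →* Matrix (Fin n) (Fin n) k :=
    { toFun := fun g => Matrix.of (A g⁻¹)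
      map_one' := by
        ext i j
        rw [inv_one]
        exact congrFun (h1 i) j
      map_mul' := fun g h => by
        ext i j
        rw [mul_inv_rev]
        exact congrFun (hmul _ _ i) j }
  refine ⟨ψ.toHomUnits, hx, fun g i => ?_⟩
  rw [← hA]
  refine Finset.sum_congr rfl fun j _ => ?_
  change _ = (A (g⁻¹)⁻¹ i j) • x j
  rw [inv_inv]

theorem LinAct.eq_one {a : G →* (F ≃ₐ[k] F)} {x : Fin n → F}
    {ρ : G →* Matrix.GeneralLinearGroup (Fin n) k} (h : LinAct a x ρ) {g : G}
    (hg : ∀ i, a g (x i) = x i) : ρ g = 1 := by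
  have hl : LinearIndependent k x := h.indep.linearIndependent
  rw [← inv_inj, ← map_inv, inv_one]
  ext i j
  refine sub_eq_zero.1 (Fintype.linearIndependent_iff.1 hl
    (fun j => (ρ g⁻¹ : Matrix (Fin n) (Fin n) k) i j - (1 : Matrix (Fin n) (Fin n) k) i j) ?_ j)
  simp_rw [sub_smul]
  rw [Finset.sum_sub_distrib, ← h.act, hg]
  simp [Matrix.one_apply]

theorem isAlgebraic_inv [Finite G] (a : G →* (F ≃ₐ[k] F)) {L : IntermediateField k F}
    (hL : ∀ g, ∀ y ∈ L, a g y ∈ L) {y : F} (hy : y ∈ L) : IsAlgebraic (inv a L) y := by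
  have := Fintype.ofFinite G
  let p : Polynomial F := ∏ g : G, (Polynomial.X - Polynomial.C (a g y))
  have hp : ∀ g, p.map (a g : F →+* F) = p := by
    intro g
    rw [Polynomial.map_prod]
    simp only [Polynomial.map_sub, Polynomial.map_X, Polynomial.map_C]
    refine (Finset.prod_congr rfl fun h _ => ?_).trans
      (Equiv.prod_comp (Equiv.mulLeft g) fun h => Polynomial.X - Polynomial.C (a h y))
    change _ = Polynomial.X - Polynomial.C (a (g * h) y)
    rw [map_mul]
    rfl
  have hpL : p ∈ Polynomial.lifts (algebraMap L F) :=
    prod_mem fun g _ => by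
      rw [sub_eq_add_neg, ← map_neg]
      exact add_mem (Polynomial.X_mem_lifts _)
        (Polynomial.C_mem_lifts (algebraMap L F) ⟨-a g y, neg_mem (hL g y hy)⟩)
  have hc : ∀ i, p.coeff i ∈ inv a L := by
    intro i
    refine mem_inv.2 ⟨?_, fun g => ?_⟩
    · obtain ⟨c, hc⟩ := (Polynomial.lifts_iff_coeff_lifts p).1 hpL i
      rw [← hc]
      exact c.2
    · have := congrArg (fun q => q.coeff i) (hp g)
      rwa [Polynomial.coeff_map] at this
  have hl : p ∈ Polynomial.lifts (algebraMap (inv a L) F) := by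
    rw [Polynomial.lifts_iff_coeff_lifts]
    exact fun i => ⟨⟨_, hc i⟩, rfl⟩
  obtain ⟨q, hq⟩ := hl
  refine ⟨q, ?_, ?_⟩
  · rintro rfl
    have h0 : p ≠ 0 := Finset.prod_ne_zero_iff.2 fun g _ => Polynomial.X_sub_C_ne_zero _
    exact h0 (by rw [← hq]; exact map_zero _)
  · have h1 : Polynomial.map (algebraMap (inv a L) F) q = p := hq
    rw [Polynomial.aeval_def, Polynomial.eval₂_eq_eval_map, h1, Polynomial.eval_prod]
    exact Finset.prod_eq_zero (Finset.mem_univ 1) (by simp)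

theorem isAlgebraic_fixedField [Finite G] (a : G →* (F ≃ₐ[k] F)) (y : F) :
    IsAlgebraic (fixedField a.range) y := by
  rw [← inv_top]
  exact isAlgebraic_inv a (fun _ _ _ => mem_top) mem_top

variable [Finite G] {ρ : G →* Matrix.GeneralLinearGroup (Fin n) k}

theorem exists_invPoly_div {y : FractionRing (MvPolynomial (Fin n) k)}
    (hy : ∀ g, ratAct ρ g y = y) : ∃ p ∈ invPoly ρ, ∃ q ∈ invPoly ρ,
      y = algebraMap _ _ p / algebraMap _ _ q := by
  have := Fintype.ofFinite G
  classical
  obtain ⟨p, q, hq, hpq⟩ := IsFractionRing.div_surjective (A := MvPolynomial (Fin n) k) y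
  have hq0 : q ≠ 0 := nonZeroDivisors.ne_zero hq
  let N : MvPolynomial (Fin n) k := ∏ g : G, polyAct ρ g q
  let r : MvPolynomial (Fin n) k := ∏ g ∈ Finset.univ.erase (1 : G), polyAct ρ g q
  have hN : N ∈ invPoly ρ := by
    intro g
    rw [map_prod]
    simp_rw [← AlgEquiv.mul_apply, ← map_mul]
    exact Equiv.prod_comp (Equiv.mulLeft g) fun h => polyAct ρ h q
  have hN0 : N ≠ 0 := Finset.prod_ne_zero_iff.2 fun g _ => by simpa using hq0
  have hNr : N = q * r := by
    change ∏ g : G, _ = _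
    rw [← Finset.mul_prod_erase _ _ (Finset.mem_univ (1 : G)), map_one]
    rfl
  let φ := algebraMap (MvPolynomial (Fin n) k) (FractionRing (MvPolynomial (Fin n) k))
  have hφ : Function.Injective φ := IsFractionRing.injective _ _
  have hφN : φ N ≠ 0 := by rwa [Ne, map_eq_zero_iff _ hφ]
  have hφq : φ q ≠ 0 := by rwa [Ne, map_eq_zero_iff _ hφ]
  have hyN : y * φ N = φ (p * r) := by
    rw [hNr, ← hpq, map_mul, map_mul]
    change φ p / φ q * _ = _
    field_simp
  refine ⟨p * r, fun g => hφ ?_, N, hN, ?_⟩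
  · rw [← hyN]
    rw [← ratAct_algebraMap]
    change ratAct ρ g (φ (p * r)) = _
    rw [← hyN, map_mul, hy]
    congr 1
    rw [ratAct_algebraMap, hN g]
  · rw [eq_div_iff hφN, hyN]

theorem exists_stable_complement [CharZero k] (ρ : G →* Matrix.GeneralLinearGroup (Fin n) k)
    {W W' : Submodule k (MvPolynomial (Fin n) k)} (hW : W ≤ W')
    (h : ∀ g, ∀ p ∈ W, polyAct ρ g p ∈ W) (h' : ∀ g, ∀ p ∈ W', polyAct ρ g p ∈ W') :
    ∃ U : Submodule k (MvPolynomial (Fin n) k), (∀ g, ∀ p ∈ U, polyAct ρ g p ∈ U) ∧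
      U ⊓ W = ⊥ ∧ U ⊔ W = W' := by
  have := Fintype.ofFinite G
  obtain ⟨π₀, hπ₀⟩ := W.subtype.exists_leftInverse_of_injective W.ker_subtype
  let π : MvPolynomial (Fin n) k →ₗ[k] MvPolynomial (Fin n) k := (Fintype.card G : k)⁻¹ •
    ∑ g : G, (polyAct ρ g).toLinearMap ∘ₗ W.subtype ∘ₗ π₀ ∘ₗ (polyAct ρ g⁻¹).toLinearMap
  have hπ : ∀ p, π p = (Fintype.card G : k)⁻¹ • ∑ g : G, polyAct ρ g (π₀ (polyAct ρ g⁻¹ p)) := by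
    intro p
    simp [π]
  have hmem : ∀ p, π p ∈ W := by
    intro p
    rw [hπ]
    exact W.smul_mem _ (sum_mem fun g _ => h g _ (π₀ _).2)
  have hid : ∀ p ∈ W, π p = p := by
    intro p hp
    rw [hπ, Finset.sum_congr rfl (g := fun _ => p), Finset.sum_const, Finset.card_univ,
      ← Nat.cast_smul_eq_nsmul k, smul_smul,
      inv_mul_cancel₀ (Nat.cast_ne_zero.2 Fintype.card_ne_zero), one_smul]
    intro g _
    have h1 : π₀ (polyAct ρ g⁻¹ p) = ⟨polyAct ρ g⁻¹ p, h _ _ hp⟩ :=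
      LinearMap.congr_fun hπ₀ (⟨polyAct ρ g⁻¹ p, h _ _ hp⟩ : W)
    rw [h1, ← AlgEquiv.mul_apply, ← map_mul, mul_inv_cancel, map_one, AlgEquiv.one_apply]
  have hcomm : ∀ g p, π (polyAct ρ g p) = polyAct ρ g (π p) := by
    intro g p
    rw [hπ, hπ, map_smul, map_sum]
    congr 1
    refine (Equiv.sum_comp (Equiv.mulLeft g) _).symm.trans (Finset.sum_congr rfl fun s _ => ?_)
    rw [Equiv.coe_mulLeft, mul_inv_rev, map_mul, map_mul, AlgEquiv.mul_apply, AlgEquiv.mul_apply,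
      ← AlgEquiv.mul_apply (polyAct ρ g⁻¹), ← map_mul, inv_mul_cancel, map_one, AlgEquiv.one_apply]
  refine ⟨W' ⊓ LinearMap.ker π, fun g p hp => ⟨h' g p hp.1, ?_⟩, ?_, ?_⟩
  · have h1 : π p = 0 := hp.2
    change π (polyAct ρ g p) = 0
    rw [hcomm, h1, map_zero]
  · rw [eq_bot_iff]
    rintro p ⟨hp, hpW⟩
    have h1 : π p = 0 := hp.2
    rw [hid p hpW] at h1
    exact h1
  · refine le_antisymm (sup_le inf_le_left hW) fun p hp => ?_
    rw [← sub_add_cancel p (π p)]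
    refine Submodule.add_mem_sup ⟨sub_mem hp (hW (hmem p)), ?_⟩ (hmem p)
    change π (p - π p) = 0
    rw [map_sub, hid _ (hmem p), sub_self]
end

open MvPolynomial IntermediateField in
section
universe u
variable {k : Type u} [Field k] {G : Type*} [Group G] {n : ℕ}
  {ρ : G →* Matrix.GeneralLinearGroup (Fin n) k}

theorem homogeneousComponent_mem_invPos {p : MvPolynomial (Fin n) k} (hp : p ∈ invPos ρ) (d : ℕ) :
    homogeneousComponent d p ∈ invPos ρ := by
  refine ⟨fun g => by rw [polyAct_homogeneousComponent, hp.1 g], ?_⟩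
  rw [constantCoeff_eq, coeff_homogeneousComponent]
  split_ifs
  · exact hp.2
  · rfl

theorem homogeneousComponent_zero_of_mem_invPos {p : MvPolynomial (Fin n) k} (hp : p ∈ invPos ρ) :
    homogeneousComponent 0 p = 0 := by
  rw [homogeneousComponent_zero, ← constantCoeff_eq, hp.2, C_0]

theorem homogeneousComponent_mem_of_mem_mul {B : Submodule k (MvPolynomial (Fin n) k)} {d : ℕ}
    (hB : ∀ i j, 0 < i → 0 < j → i + j = d → ∀ p ∈ invPos ρ, ∀ q ∈ invPos ρ,
      p.IsHomogeneous i → q.IsHomogeneous j → p * q ∈ B)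
    {w : MvPolynomial (Fin n) k} (hw : w ∈ invPos ρ * invPos ρ) :
    homogeneousComponent d w ∈ B := by
  induction hw using Submodule.mul_induction_on' with
  | mem_mul_mem p hp q hq =>
    rw [← sum_homogeneousComponent p, ← sum_homogeneousComponent q, Finset.sum_mul_sum]
    simp_rw [map_sum]
    refine sum_mem fun i _ => sum_mem fun j _ => ?_
    rw [homogeneousComponent_of_mem ((homogeneousComponent_isHomogeneous i p).mul
      (homogeneousComponent_isHomogeneous j q))]
    split_ifs with hd
    · rcases Nat.eq_zero_or_pos i with rfl | hi
      · rw [homogeneousComponent_zero_of_mem_invPos hp, zero_mul]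
        exact zero_mem _
      rcases Nat.eq_zero_or_pos j with rfl | hj
      · rw [homogeneousComponent_zero_of_mem_invPos hq, mul_zero]
        exact zero_mem _
      exact hB i j hi hj hd.symm _ (homogeneousComponent_mem_invPos hp i) _
        (homogeneousComponent_mem_invPos hq j) (homogeneousComponent_isHomogeneous i p)
        (homogeneousComponent_isHomogeneous j q)
    · exact zero_mem _
  | add x _ y _ hx hy =>
    rw [map_add]
    exact add_mem hx hy

theorem homogeneousComponent_mem_mul {w : MvPolynomial (Fin n) k}
    (hw : w ∈ invPos ρ * invPos ρ) (d : ℕ) : homogeneousComponent d w ∈ invPos ρ * invPos ρ :=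
  homogeneousComponent_mem_of_mem_mul
    (fun _ _ _ _ _ _ hp _ hq _ _ => Submodule.mul_mem_mul hp hq) hw

theorem mul_invPos_le : invPos ρ * invPos ρ ≤ invPos ρ :=
  Submodule.mul_le.2 fun p hp q hq => ⟨mul_mem hp.1 hq.1, by rw [map_mul, hp.2, zero_mul]⟩

theorem mem_adjoin_of_generators {s : Set (MvPolynomial (Fin n) k)}
    (h : ∀ d, ∀ p ∈ invPos ρ, p.IsHomogeneous d →
      ∃ u ∈ Submodule.span k s, ∃ w ∈ invPos ρ * invPos ρ, w.IsHomogeneous d ∧ p = u + w) :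
    invPoly ρ ≤ Algebra.adjoin k s := by
  have key : ∀ d, ∀ p ∈ invPos ρ, p.IsHomogeneous d → p ∈ Algebra.adjoin k s := by
    intro d
    induction d using Nat.strong_induction_on with
    | _ d ih =>
      intro p hp hpd
      obtain ⟨u, hu, w, hw, hwd, rfl⟩ := h d p hp hpd
      refine add_mem (Algebra.span_le_adjoin k s hu) ?_
      have := homogeneousComponent_mem_of_mem_mul (B := (Algebra.adjoin k s).toSubmodule) (d := d)
        (fun i j hi hj hij p hp q hq hpi hqj => (Algebra.adjoin k s).mul_mem
          (ih i (by omega) p hp hpi) (ih j (by omega) q hq hqj)) hw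
      rwa [homogeneousComponent_eq_self hwd] at this
  intro p hp
  rw [← sum_homogeneousComponent p]
  refine sum_mem fun d _ => ?_
  rcases Nat.eq_zero_or_pos d with rfl | hd
  · rw [homogeneousComponent_zero]
    exact (Algebra.adjoin k s).algebraMap_mem _
  · refine key d _ ⟨fun g => by rw [polyAct_homogeneousComponent, hp g], ?_⟩
      (homogeneousComponent_isHomogeneous d p)
    rw [constantCoeff_eq, coeff_homogeneousComponent, if_neg]
    simp
    omega

variable [Finite G] [CharZero k]

theorem exists_generators (ρ : G →* Matrix.GeneralLinearGroup (Fin n) k) (N : Subgroup G)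
    [N.Normal] : ∃ (ι : Type u) (f : ι → MvPolynomial (Fin n) k) (d : ι → ℕ),
      (∀ i, 0 < d i) ∧ (∀ i, (f i).IsHomogeneous (d i)) ∧
      (∀ i, f i ∈ invPos (ρ.comp N.subtype)) ∧
      (LinearIndependent k fun i =>
        (invPos (ρ.comp N.subtype) * invPos (ρ.comp N.subtype)).mkQ (f i)) ∧
      (∀ g i, polyAct ρ g (f i) ∈ Submodule.span k (Set.range f)) ∧
      invPoly (ρ.comp N.subtype) ≤ Algebra.adjoin k (Set.range f) := by
  classical
  set M := invPos (ρ.comp N.subtype) with hM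
  have hst : ∀ g, ∀ p ∈ M, polyAct ρ g p ∈ M := by
    intro g p hp
    refine ⟨fun s => ?_, by rw [constantCoeff_polyAct, hp.2]⟩
    change polyAct ρ s (polyAct ρ g p) = _
    have h1 := hp.1 ⟨g⁻¹ * s * g, by simpa using ‹N.Normal›.conj_mem s s.2 g⁻¹⟩
    change polyAct ρ (g⁻¹ * s * g) p = p at h1
    conv_rhs => rw [← h1]
    simp only [← AlgEquiv.mul_apply, ← map_mul]
    congr 2
    group
  have hst2 : ∀ g, ∀ p ∈ M * M, polyAct ρ g p ∈ M * M := by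
    intro g p hp
    induction hp using Submodule.mul_induction_on' with
    | mem_mul_mem p hp q hq =>
      rw [map_mul]
      exact Submodule.mul_mem_mul (hst g p hp) (hst g q hq)
    | add x _ y _ hx hy =>
      rw [map_add]
      exact add_mem hx hy
  choose U hUst hUi hUs using fun d => exists_stable_complement ρ
    (W := (M * M) ⊓ homogeneousSubmodule (Fin n) k d) (W' := M ⊓ homogeneousSubmodule (Fin n) k d)
    (inf_le_inf_right _ mul_invPos_le)
    (fun g p hp => ⟨hst2 g p hp.1, polyAct_isHomogeneous hp.2 g⟩)
    (fun g p hp => ⟨hst g p hp.1, polyAct_isHomogeneous hp.2 g⟩)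
  have hU : ∀ d, U d ≤ M ⊓ homogeneousSubmodule (Fin n) k d := fun d => hUs d ▸ le_sup_left
  let B := fun d => Module.Basis.ofVectorSpace k (U d)
  let f : (Σ d, Module.Basis.ofVectorSpaceIndex k (U d)) → MvPolynomial (Fin n) k :=
    fun i => (B i.1 i.2 : U i.1)
  have hspan : ∀ d, ∀ u ∈ U d, u ∈ Submodule.span k (Set.range f) := by
    intro d u hu
    have h1 : (⟨u, hu⟩ : U d) ∈ Submodule.span k (Set.range (B d)) := by
      rw [(B d).span_eq]
      trivial
    have h2 := Submodule.mem_map_of_mem (f := (U d).subtype) h1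
    rw [Submodule.map_span] at h2
    refine Submodule.span_mono ?_ h2
    rintro _ ⟨_, ⟨b, rfl⟩, rfl⟩
    exact ⟨⟨d, b⟩, rfl⟩
  have hfM : ∀ i, f i ∈ M := fun i => (hU i.1 (B i.1 i.2).2).1
  have hfd : ∀ i, (f i).IsHomogeneous i.1 := fun i => (hU i.1 (B i.1 i.2).2).2
  refine ⟨Σ d, Module.Basis.ofVectorSpaceIndex k (U d), f, fun i => i.1, fun i => ?_, hfd, hfM, ?_, fun g i => ?_, ?_⟩
  · rw [pos_iff_ne_zero]
    intro h0
    have h1 := homogeneousComponent_zero_of_mem_invPos (hfM i)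
    rw [homogeneousComponent_eq_self (h0 ▸ hfd i)] at h1
    exact (B i.1).ne_zero i.2 (Subtype.ext h1)
  · rw [linearIndependent_iff']
    rintro s g hg ⟨d, b⟩ hi
    simp_rw [← map_smul] at hg
    rw [← map_sum, Submodule.mkQ_apply, Submodule.Quotient.mk_eq_zero] at hg
    let t : (Σ d, Module.Basis.ofVectorSpaceIndex k (U d)) → U d := fun i =>
      if h : i.1 = d then B d (h ▸ i.2) else 0
    have ht : ∀ i, (t i : MvPolynomial (Fin n) k) = homogeneousComponent d (f i) := by
      rintro ⟨e, c⟩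
      rw [homogeneousComponent_of_mem (hfd _)]
      by_cases h : e = d
      · subst h
        simp [t, f]
      · simp [t, h, Ne.symm h]
    have htc : ∀ i, (B d).coord b (t i) = if i = ⟨d, b⟩ then 1 else 0 := by
      rintro ⟨e, c⟩
      by_cases h : e = d
      · subst h
        simp [t, Finsupp.single_apply]
      · simp [t, h]
    have h1 := homogeneousComponent_mem_mul hg d
    rw [map_sum] at h1
    simp_rw [map_smul, ← ht] at h1
    have h2 : ∑ i ∈ s, g i • t i = 0 := by
      apply Subtype.ext
      have h3 : ((∑ i ∈ s, g i • t i : U d) : MvPolynomial (Fin n) k) ∈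
          U d ⊓ ((M * M) ⊓ homogeneousSubmodule (Fin n) k d) := by
        refine ⟨Subtype.mem _, ?_, (hU d (Subtype.mem _)).2⟩
        push_cast
        exact h1
      rw [hUi] at h3
      exact h3
    have h3 := congrArg ((B d).coord b) h2
    rw [map_sum, map_zero] at h3
    simp_rw [map_smul, htc] at h3
    simpa [hi] using h3
  · exact hspan i.1 _ (hUst i.1 g _ (B i.1 i.2).2)
  · refine mem_adjoin_of_generators fun d p hp hpd => ?_
    have h1 : p ∈ U d ⊔ (M * M) ⊓ homogeneousSubmodule (Fin n) k d := hUs d ▸ ⟨hp, hpd⟩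
    obtain ⟨u, hu, w, hw, rfl⟩ := Submodule.mem_sup.1 h1
    exact ⟨u, hspan d u hu, w, hw.1, hw.2, rfl⟩
end

open MvPolynomial IntermediateField in
section
variable {k : Type*} [Field k] {G : Type*} [Group G] {n : ℕ}

theorem adjoin_ratX : adjoin k (Set.range (ratX k n)) = ⊤ := by
  rw [eq_top_iff]
  rintro y -
  obtain ⟨p, q, -, rfl⟩ := IsFractionRing.div_surjective (A := MvPolynomial (Fin n) k) y
  have h : ∀ p : MvPolynomial (Fin n) k, algebraMap (MvPolynomial (Fin n) k)
      (FractionRing (MvPolynomial (Fin n) k)) p ∈ adjoin k (Set.range (ratX k n)) := by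
    intro p
    induction p using MvPolynomial.induction_on with
    | C c => exact (adjoin k (Set.range (ratX k n))).algebraMap_mem c
    | add p q hp hq =>
      rw [map_add]
      exact add_mem hp hq
    | mul_X p i hp =>
      rw [map_mul]
      exact mul_mem hp (subset_adjoin _ _ ⟨i, rfl⟩)
  exact div_mem (h p) (h q)

variable [Finite G] [CharZero k]

/-- A form of the Chevalley–Shephard–Todd theorem: the field of invariants of a finite linear group
is the field of invariants of a linear action in which a normal subgroup generated by reflections
acts trivially. -/
theorem exists_linAct_of_reflections (ρ : G →* Matrix.GeneralLinearGroup (Fin n) k)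
    (N : Subgroup G) [N.Normal]
    (hN : Subgroup.closure {s : N | ActsAsReflection (ρ.comp N.subtype) s} = ⊤) :
    ∃ (x : Fin n → FractionRing (MvPolynomial (Fin n) k))
      (ρ' : G →* Matrix.GeneralLinearGroup (Fin n) k), LinAct (ratAct ρ) x ρ' ∧
      (∀ s ∈ N, ρ' s = 1) ∧
      inv (ratAct ρ) (adjoin k (Set.range x)) =
        inv (ratAct ρ) (adjoin k (Set.range (ratX k n))) := by
  obtain ⟨ι, f, d, hd, hfd, hfM, hfl, hfst, hgen⟩ := exists_generators ρ N
  let σ := ρ.comp N.subtype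
  have hind := algebraicIndependent_of_reflections hN hd hfd hfM hfl
  have hcard := hind.cardinalMk_le_trdeg
  rw [MvPolynomial.trdeg_of_isDomain, Cardinal.mk_fin, Cardinal.lift_natCast] at hcard
  have hfin : Finite ι := Cardinal.mk_lt_aleph0_iff.1 (hcard.trans_lt (Cardinal.natCast_lt_aleph0))
  have hle : Nat.card ι ≤ n := by
    have := Cardinal.toNat_le_toNat hcard Cardinal.natCast_lt_aleph0
    rwa [Cardinal.toNat_natCast] at this
  let φ := IsScalarTower.toAlgHom k (MvPolynomial (Fin n) k) (FractionRing (MvPolynomial (Fin n) k))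
  have hφ : Function.Injective φ := IsFractionRing.injective _ _
  have hindF : AlgebraicIndependent k (φ ∘ f) := hind.map' hφ
  have hfix : ∀ y, (∀ g, ratAct σ g y = y) → y ∈ adjoin k (Set.range (φ ∘ f)) := by
    intro y hy
    obtain ⟨p, hp, q, hq, rfl⟩ := exists_invPoly_div hy
    have h1 : ∀ p ∈ invPoly σ, φ p ∈ adjoin k (Set.range (φ ∘ f)) := by
      intro p hp
      have h2 : φ p ∈ (Algebra.adjoin k (Set.range f)).map φ := ⟨p, hgen hp, rfl⟩
      rw [← Algebra.adjoin_image, ← Set.range_comp] at h2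
      exact algebra_adjoin_le_adjoin _ _ h2
    exact div_mem (h1 p hp) (h1 q hq)
  have halg : ∀ y : FractionRing (MvPolynomial (Fin n) k),
      IsAlgebraic (adjoin k (Set.range (φ ∘ f))) y := by
    intro y
    have h1 := isAlgebraic_fixedField (ratAct σ) y
    have h2 : fixedField (ratAct σ).range ≤ adjoin k (Set.range (φ ∘ f)) := fun y hy =>
      hfix y fun g => (mem_fixedField_iff _ _).1 hy _ ⟨g, rfl⟩
    let : Algebra (fixedField (ratAct σ).range) (adjoin k (Set.range (φ ∘ f))) :=
      (IntermediateField.inclusion h2).toAlgebra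
    have : IsScalarTower (fixedField (ratAct σ).range) (adjoin k (Set.range (φ ∘ f)))
      (FractionRing (MvPolynomial (Fin n) k)) := IsScalarTower.of_algebraMap_eq fun _ => rfl
    exact h1.tower_top _
  have hge : n ≤ Nat.card ι := by
    by_contra! hlt
    have h1 : Set.range (fun i : Option ι => i.elim 0 (φ ∘ f)) = insert 0 (Set.range (φ ∘ f)) := by
      ext y
      simp [Option.exists, eq_comm]
    have h2 := algebraicIndependent_of_isAlgebraic (ratX_indep (k := k) n)
      (y := fun i : Option ι => i.elim 0 (φ ∘ f)) (fun i => by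
        rw [h1, show adjoin k (insert 0 (Set.range (φ ∘ f))) = adjoin k (Set.range (φ ∘ f)) from
          le_antisymm (adjoin_le_iff.2 (Set.insert_subset (zero_mem _) (subset_adjoin _ _)))
            (adjoin.mono _ _ _ (Set.subset_insert _ _))]
        exact halg _) (by simpa using hlt)
    exact h2.ne_zero none rfl
  let e : Fin n ≃ ι := (finCongr (le_antisymm hge hle)).trans (Finite.equivFin ι).symm
  have hrange : Set.range (φ ∘ f ∘ e) = Set.range (φ ∘ f) := by
    rw [← Function.comp_assoc, e.surjective.range_comp]
  have hact : ∀ g p, ratAct ρ g (φ p) = φ (polyAct ρ g p) := ratAct_algebraMap ρ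
  obtain ⟨ρ', hρ'⟩ := exists_linAct (a := ratAct ρ) (x := φ ∘ f ∘ e)
    (hindF.comp e e.injective) (fun g i => by
      change ratAct ρ g (φ (f (e i))) ∈ _
      rw [hact, hrange, Set.range_comp]
      have := Submodule.mem_map_of_mem (f := φ.toLinearMap) (hfst g (e i))
      rwa [Submodule.map_span] at this)
  refine ⟨_, ρ', hρ', fun s hs => hρ'.eq_one fun i => ?_, ?_⟩
  · change ratAct ρ s (φ (f (e i))) = φ (f (e i))
    rw [hact]
    exact congrArg φ ((hfM (e i)).1 ⟨s, hs⟩)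
  · rw [adjoin_ratX]
    ext y
    rw [mem_inv, mem_inv, hrange]
    refine ⟨fun h => ⟨mem_top, h.2⟩, fun h => ⟨hfix y fun g => ?_, h.2⟩⟩
    exact h.2 g
end

open MvPolynomial IntermediateField Matrix in
section
variable {k : Type*} [Field k] {G : Type*} [Group G]

/-- The subgroup of elements acting as scalars. -/
def scalarSubgroup {n : ℕ} (ρ : G →* GeneralLinearGroup (Fin n) k) : Subgroup G :=
  (Subgroup.center (GeneralLinearGroup (Fin n) k)).comap ρ

theorem mem_scalarSubgroup {n : ℕ} {ρ : G →* GeneralLinearGroup (Fin n) k} {g : G} :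
    g ∈ scalarSubgroup ρ ↔ ∃ c : k, (ρ g : Matrix (Fin n) (Fin n) k) = c • 1 := by
  rw [scalarSubgroup, Subgroup.mem_comap, GeneralLinearGroup.mem_center_iff_val_mem_range_scalar]
  simp only [Set.mem_range, scalar_apply, smul_one_eq_diagonal]
  exact exists_congr fun c => eq_comm

instance {n : ℕ} (ρ : G →* GeneralLinearGroup (Fin n) k) : (scalarSubgroup ρ).Normal :=
  inferInstanceAs ((Subgroup.center _).comap ρ).Normal

theorem ratAct_eq_one {n : ℕ} {ρ : G →* GeneralLinearGroup (Fin n) k} {g : G} (hg : ρ g = 1) :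
    ratAct ρ g = 1 := by
  have h : polyAct ρ g = 1 := by
    apply AlgEquiv.ext
    intro p
    change linSubst (ρ g⁻¹ : Matrix (Fin n) (Fin n) k) p = p
    rw [map_inv, hg, inv_one, Units.val_one, linSubst_one]
    rfl
  rw [ratAct, MonoidHom.comp_apply, h, map_one]

/-- A representation with the roots of unity of a given order adjoined as scalars. -/
noncomputable def withScalars {n : ℕ} (ρ : G →* GeneralLinearGroup (Fin n) k) (d : ℕ) :
    G × rootsOfUnity d k →* GeneralLinearGroup (Fin n) k :=
  ρ.noncommCoprod ((Units.map (algebraMap k (Matrix (Fin n) (Fin n) k)).toMonoidHom).comp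
    (rootsOfUnity d k).subtype) fun g c => by
      apply Units.ext
      exact (Algebra.commutes _ _).symm

theorem withScalars_apply {n : ℕ} (ρ : G →* GeneralLinearGroup (Fin n) k) (d : ℕ) (g : G)
    (c : rootsOfUnity d k) : (withScalars ρ d (g, c) : Matrix (Fin n) (Fin n) k) =
      ((c : kˣ) : k) • (ρ g : Matrix (Fin n) (Fin n) k) := by
  rw [Algebra.smul_def, Algebra.commutes]
  rfl

theorem index_scalarSubgroup_withScalars {n : ℕ} (ρ : G →* GeneralLinearGroup (Fin n) k) (d : ℕ) :
    (scalarSubgroup (withScalars ρ d)).index = (scalarSubgroup ρ).index := by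
  have h : scalarSubgroup (withScalars ρ d) =
      (scalarSubgroup ρ).comap (MonoidHom.fst G (rootsOfUnity d k)) := by
    ext ⟨g, c⟩
    rw [Subgroup.mem_comap, mem_scalarSubgroup, mem_scalarSubgroup]
    simp only [withScalars_apply, MonoidHom.coe_fst]
    constructor
    · rintro ⟨e, he⟩
      exact ⟨((c : kˣ) : k)⁻¹ * e, by rw [mul_smul, ← he, inv_smul_smul₀ (Units.ne_zero _)]⟩
    · rintro ⟨e, he⟩
      exact ⟨((c : kˣ) : k) * e, by rw [he, mul_smul]⟩
  rw [h, Subgroup.index_comap_of_surjective _ Prod.fst_surjective]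

theorem inPure_of_withScalars [Finite G] (ρ : G →* GeneralLinearGroup (Fin 3) k) (d : ℕ) [NeZero d]
    (h : InPure (inv (ratAct (withScalars ρ d)) (adjoin k (Set.range (ratX k 3))))) :
    InPure (inv (ratAct ρ) (adjoin k (Set.range (ratX k 3)))) := by
  have h1 := (linAct_ratAct ρ).cone
  have h2 := (linAct_ratAct (withScalars ρ d)).cone
  set L := adjoin k {ratX k 3 0 / ratX k 3 2, ratX k 3 1 / ratX k 3 2} with hL
  have hact : ∀ g c, ∀ y ∈ L, ratAct (withScalars ρ d) (g, c) y = ratAct ρ g y := by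
    intro g c y hy
    induction hy using adjoin_induction with
    | mem y hy =>
      have key : ∀ i, ratAct (withScalars ρ d) (g, c) (ratX k 3 i) =
          (((c⁻¹ : rootsOfUnity d k) : kˣ) : k) • ratAct ρ g (ratX k 3 i) := by
        intro i
        rw [(linAct_ratAct (withScalars ρ d)).act, (linAct_ratAct ρ).act, Finset.smul_sum]
        refine Finset.sum_congr rfl fun j _ => ?_
        rw [Prod.inv_mk, withScalars_apply, Matrix.smul_apply, smul_smul, smul_eq_mul]
      have key' : ∀ i j, ratAct (withScalars ρ d) (g, c) (ratX k 3 i / ratX k 3 j) =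
          ratAct ρ g (ratX k 3 i / ratX k 3 j) := by
        intro i j
        rw [map_div₀, map_div₀, key, key, Algebra.smul_def, Algebra.smul_def,
          mul_div_mul_left]
        rw [Ne, map_eq_zero]
        exact Units.ne_zero _
      rcases hy with rfl | rfl
      · exact key' 0 2
      · exact key' 1 2
    | algebraMap c => rw [AlgEquiv.commutes, AlgEquiv.commutes]
    | add x y _ _ hx hy => rw [map_add, map_add, hx, hy]
    | inv x _ hx => rw [map_inv₀, map_inv₀, hx]
    | mul x y _ _ hx hy => rw [map_mul, map_mul, hx, hy]
  have hinv : inv (ratAct (withScalars ρ d)) L = inv (ratAct ρ) L := by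
    ext y
    rw [mem_inv, mem_inv]
    refine and_congr_right fun hy => ⟨fun h g => ?_, fun h g => ?_⟩
    · rw [← hact g 1 y hy, h]
    · rw [hact g.1 g.2 y hy, h]
  rw [hinv] at h2
  exact h2.inPure_of_inPure h1 h

theorem exists_eq_vecMulVec_of_rank_le_one {n : ℕ} {M : Matrix (Fin n) (Fin n) k}
    (h : M.rank ≤ 1) : ∃ α β : Fin n → k, M = vecMulVec α β := by
  rw [Matrix.rank, finrank_le_one_iff] at h
  obtain ⟨⟨v, hv⟩, h⟩ := h
  choose c hc using fun j => h ⟨M.mulVecLin (Pi.single j 1), ⟨_, rfl⟩⟩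
  refine ⟨v, c, ?_⟩
  ext i j
  have := congrFun (congrArg Subtype.val (hc j)) i
  simp at this
  rw [vecMulVec_apply, mul_comm, this]

theorem exists_reflection {A : Matrix (Fin 3) (Fin 3) k} (hA : A * A = 1) :
    (∃ α β, A = 1 + vecMulVec α β) ∨ ∃ α β, -A = 1 + vecMulVec α β := by
  have h := rank_add_rank_le_card_of_mul_eq_zero (A := A - 1) (B := A + 1) (by
    rw [sub_mul, mul_add, hA, mul_one, one_mul]
    abel)
  rw [Fintype.card_fin] at h
  by_cases h1 : (A - 1).rank ≤ 1
  · obtain ⟨α, β, h2⟩ := exists_eq_vecMulVec_of_rank_le_one h1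
    exact Or.inl ⟨α, β, by rw [← h2]; abel⟩
  · obtain ⟨α, β, h2⟩ := exists_eq_vecMulVec_of_rank_le_one (M := A + 1) (by omega)
    exact Or.inr ⟨-α, β, by rw [neg_vecMulVec, ← h2]; abel⟩

theorem ActsAsReflection.conj {n : ℕ} {ρ : G →* GeneralLinearGroup (Fin n) k} {s : G}
    (h : ActsAsReflection ρ s) (g : G) : ActsAsReflection ρ (g * s * g⁻¹) := by
  obtain ⟨α, β, h⟩ := h
  refine ⟨(ρ g : Matrix (Fin n) (Fin n) k) *ᵥ α, β ᵥ* (ρ g⁻¹ : Matrix (Fin n) (Fin n) k), ?_⟩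
  have h1 : (g * s * g⁻¹)⁻¹ = g * s⁻¹ * g⁻¹ := by group
  rw [h1, map_mul, map_mul, Units.val_mul, Units.val_mul, h, mul_add, add_mul, mul_one,
    ← Units.val_mul, ← map_mul, mul_inv_cancel, map_one, mul_vecMulVec, vecMulVec_mul]
  rfl
end

open MvPolynomial IntermediateField Matrix in
section
variable {k : Type} [Field k] {G : Type} [Group G]

theorem exists_reflection_withScalars [IsAlgClosed k] [Finite G]
    (ρ : G →* GeneralLinearGroup (Fin 3) k) (he : Even (scalarSubgroup ρ).index) :
    ∃ r, ActsAsReflection (withScalars ρ (2 * Nat.card G)) r ∧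
      r ∉ scalarSubgroup (withScalars ρ (2 * Nat.card G)) := by
  obtain ⟨q, hq⟩ := exists_prime_orderOf_dvd_card' (G := G ⧸ scalarSubgroup ρ) 2
    (even_iff_two_dvd.1 he)
  obtain ⟨g, rfl⟩ := QuotientGroup.mk_surjective q
  have hg : g ∉ scalarSubgroup ρ := fun h => by
    rw [(QuotientGroup.eq_one_iff g).2 h, orderOf_one] at hq
    omega
  have hg2 : g ^ 2 ∈ scalarSubgroup ρ := by
    rw [← QuotientGroup.eq_one_iff, QuotientGroup.mk_pow, ← hq, pow_orderOf_eq_one]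
  obtain ⟨c, hc⟩ := mem_scalarSubgroup.1 hg2
  have hc0 : c ≠ 0 := by
    rintro rfl
    rw [zero_smul] at hc
    exact Units.ne_zero _ hc
  have hcard : c ^ Nat.card G = 1 := by
    have h1 : (ρ (g ^ 2) : Matrix (Fin 3) (Fin 3) k) ^ Nat.card G = 1 := by
      rw [← Units.val_pow_eq_pow_val, ← map_pow, pow_card_eq_one', map_one, Units.val_one]
    rw [hc, smul_pow, one_pow] at h1
    simpa using congrFun (congrFun h1 0) 0
  obtain ⟨e, he⟩ := IsAlgClosed.exists_pow_nat_eq c⁻¹ (n := 2) (by norm_num)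
  have he0 : e ≠ 0 := by
    rintro rfl
    rw [zero_pow two_ne_zero] at he
    exact inv_ne_zero hc0 he.symm
  have hed : e ^ (2 * Nat.card G) = 1 := by rw [pow_mul, he, inv_pow, hcard, inv_one]
  have hA : (e • (ρ g : Matrix (Fin 3) (Fin 3) k)) * (e • (ρ g : Matrix (Fin 3) (Fin 3) k)) = 1 := by
    rw [smul_mul_smul_comm, ← sq, ← sq, ← Units.val_pow_eq_pow_val, ← map_pow, hc, he, smul_smul,
      inv_mul_cancel₀ hc0, one_smul]
  have key : ∀ e : k, e ≠ 0 → e ^ (2 * Nat.card G) = 1 →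
      (∃ α β, e • (ρ g : Matrix (Fin 3) (Fin 3) k) = 1 + vecMulVec α β) →
      ∃ r, ActsAsReflection (withScalars ρ (2 * Nat.card G)) r ∧
        r ∉ scalarSubgroup (withScalars ρ (2 * Nat.card G)) := by
    rintro e he0 hed ⟨α, β, h⟩
    let c : rootsOfUnity (2 * Nat.card G) k := ⟨Units.mk0 e he0, by
      rw [mem_rootsOfUnity]
      ext
      exact hed⟩
    refine ⟨(g, c)⁻¹, ⟨α, β, ?_⟩, ?_⟩
    · rw [inv_inv, withScalars_apply]
      exact h
    · rw [inv_mem_iff, mem_scalarSubgroup]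
      rintro ⟨b, hb⟩
      rw [withScalars_apply] at hb
      refine hg (mem_scalarSubgroup.2 ⟨e⁻¹ * b, ?_⟩)
      rw [mul_smul, ← hb]
      exact (inv_smul_smul₀ he0 _).symm
  rcases exists_reflection hA with h | h
  · exact key e he0 hed h
  · refine key (-e) (neg_ne_zero.2 he0) ?_ ?_
    · rw [Even.neg_pow (even_two_mul _), hed]
    · rwa [neg_smul]

theorem inPure_of_even [IsAlgClosed k] [CharZero k] [Finite G]
    (ρ : G →* GeneralLinearGroup (Fin 3) k) (he : Even (scalarSubgroup ρ).index)
    (ih : ∀ (G' : Type) [Group G'] [Finite G'] (ρ' : G' →* GeneralLinearGroup (Fin 3) k),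
      (scalarSubgroup ρ').index < (scalarSubgroup ρ).index →
        InPure (inv (ratAct ρ') (adjoin k (Set.range (ratX k 3))))) :
    InPure (inv (ratAct ρ) (adjoin k (Set.range (ratX k 3)))) := by
  obtain ⟨r, hr, hrs⟩ := exists_reflection_withScalars ρ he
  have : NeZero (2 * Nat.card G) := ⟨mul_ne_zero two_ne_zero Nat.card_pos.ne'⟩
  apply inPure_of_withScalars ρ (2 * Nat.card G)
  rw [← index_scalarSubgroup_withScalars ρ (2 * Nat.card G)] at ih
  have : Finite (rootsOfUnity (2 * Nat.card G) k) := inferInstance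
  generalize withScalars ρ (2 * Nat.card G) = σ at *
  let N : Subgroup (G × rootsOfUnity (2 * Nat.card G) k) :=
    Subgroup.closure {s | ActsAsReflection σ s}
  have hN : N.Normal := Subgroup.normalizer_eq_top_iff.1 (top_le_iff.1
    (Subgroup.le_normalizer_closure_iff.2 fun g _ s hs => Subgroup.subset_closure (hs.conj g)))
  obtain ⟨x, σ', hx, hσ', hinv⟩ := exists_linAct_of_reflections σ N
    Subgroup.closure_closure_coe_preimage
  rw [← hinv]
  by_cases hz : scalarSubgroup σ ≤ scalarSubgroup σ'
  · refine (linAct_ratAct σ').inPure_of_inPure hx (ih _ σ' ?_)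
    refine Subgroup.index_strictAnti (lt_of_le_of_ne hz ?_)
    intro h
    apply hrs
    rw [h, mem_scalarSubgroup]
    exact ⟨1, by rw [hσ' r (Subgroup.subset_closure hr), one_smul, Units.val_one]⟩
  · obtain ⟨z, hz, hz'⟩ := SetLike.not_le_iff_exists.1 hz
    rw [mem_scalarSubgroup, not_exists] at hz'
    refine hx.inPure_of_commute hz' fun g => ?_
    have h1 : σ (g * z * g⁻¹ * z⁻¹) = 1 := by
      have h2 : σ g * σ z = σ z * σ g := Subgroup.mem_center_iff.1 hz (σ g)
      rw [map_mul, map_mul, map_mul, h2, map_inv, map_inv]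
      group
    have h3 : σ' (g * z * g⁻¹ * z⁻¹) = 1 := hx.eq_one fun i => by
      rw [ratAct_eq_one h1]
      rfl
    have h4 : σ' g * σ' z = σ' z * σ' g := by
      rw [← map_mul, ← map_mul, ← mul_inv_eq_one, ← map_inv, ← map_mul, ← h3]
      congr 1
      group
    exact congrArg Units.val h4
end

open Module in
section
variable {k : Type*} [Field k] [IsAlgClosed k] [CharZero k] {G V : Type*} [Group G]
  [AddCommGroup V] [Module k V] [FiniteDimensional k V]

omit [CharZero k] in
theorem isIntegral_character [Finite G] (σ : Representation k G V) (g : G) :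
    IsIntegral ℤ (σ.character g) := by
  rw [Representation.character,
    Module.End.trace_eq_sum_roots_charpoly_of_splits (IsAlgClosed.splits _)]
  refine IsIntegral.multiset_sum fun μ hμ => ?_
  have h1 := (Module.End.hasEigenvalue_iff_isRoot_charpoly (σ g) μ).2 (Polynomial.isRoot_of_mem_roots hμ)
  obtain ⟨v, hv⟩ := (h1.pow (Nat.card G)).exists_hasEigenvector
  have h2 := hv.apply_eq_smul
  rw [← map_pow, pow_card_eq_one', map_one, Module.End.one_apply] at h2
  have h3 : μ ^ Nat.card G = 1 := by
    by_contra hne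
    refine hv.2 ((smul_eq_zero.1 (?_ : (μ ^ Nat.card G - 1) • v = 0)).resolve_left
      (sub_ne_zero.2 hne))
    rw [sub_smul, one_smul, ← h2, sub_self]
  refine IsIntegral.of_pow (n := Nat.card G) Nat.card_pos ?_
  rw [h3]
  exact isIntegral_one

theorem finrank_modEq_finrank_invariants [Finite G] (hG : Odd (Nat.card G))
    (σ : Representation k G V) (hσ : ∀ g, σ.character g⁻¹ = σ.character g) :
    finrank k V ≡ finrank k σ.invariants [MOD 2] := by
  classical
  have := Fintype.ofFinite G
  have hne : (Nat.card G : k) ≠ 0 := Nat.cast_ne_zero.2 Nat.card_pos.ne'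
  let : Invertible (Nat.card G : k) := invertibleOfNonzero hne
  have h1 := Representation.card_inv_mul_sum_char_eq_finrank σ
  rw [inv_mul_eq_iff_eq_mul₀ hne] at h1
  let O := integralClosure ℤ k
  let T : G → O := fun g => ⟨σ.character g, isIntegral_character σ g⟩
  let π := Ideal.Quotient.mk (Ideal.span {(2 : O)})
  have h2 : ∑ g ∈ Finset.univ.erase 1, π (T g) = 0 := by
    refine Finset.sum_involution (fun g _ => g⁻¹) ?_ ?_ ?_ ?_
    · intro g _
      have : T g⁻¹ = T g := Subtype.ext (hσ g)
      rw [this, ← map_add, ← two_mul]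
      exact Ideal.Quotient.eq_zero_iff_mem.2 (Ideal.mul_mem_right _ _ (Ideal.mem_span_singleton_self _))
    · intro g hg _ h
      have h3 : g ^ 2 = 1 := by rw [sq, mul_eq_one_iff_eq_inv, h]
      have h4 := Nat.eq_one_of_dvd_coprimes (Nat.coprime_two_left.2 hG)
        (orderOf_dvd_of_pow_eq_one h3) (orderOf_dvd_natCard g)
      exact (Finset.mem_erase.1 hg).1 (orderOf_eq_one_iff.1 h4)
    · intro g hg
      simpa using hg
    · intro g _
      exact inv_inv g
  rw [← map_sum] at h2
  obtain ⟨y, hy⟩ := Ideal.mem_span_singleton.1 (Ideal.Quotient.eq_zero_iff_mem.1 h2)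
  have h5 : ((Nat.card G : k) * (finrank k σ.invariants : k)) - finrank k V = 2 * (y : k) := by
    rw [← h1, ← Finset.add_sum_erase _ _ (Finset.mem_univ (1 : G)), Representation.char_one,
      add_sub_cancel_left]
    have := congrArg (algebraMap O k) hy
    rw [map_sum, map_mul, map_ofNat] at this
    exact this
  have h6 : IsIntegral ℤ ((((Nat.card G * finrank k σ.invariants - finrank k V : ℤ) : ℚ) / 2)) := by
    rw [← isIntegral_algebraMap_iff (algebraMap ℚ k).injective]
    have : algebraMap ℚ k ((Nat.card G * finrank k σ.invariants - finrank k V : ℤ) / 2) = y := by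
      rw [map_div₀, map_ofNat, map_intCast]
      push_cast
      rw [h5, mul_div_cancel_left₀ _ two_ne_zero]
    rw [this]
    exact y.2
  obtain ⟨z, hz⟩ := IsIntegrallyClosed.isIntegral_iff.1 h6
  have h7 : (Nat.card G * finrank k σ.invariants - finrank k V : ℤ) = 2 * z := by
    rw [eq_div_iff two_ne_zero, eq_intCast] at hz
    rw [mul_comm 2]
    exact Int.cast_injective (α := ℚ) (by rw [← hz, Int.cast_mul, Int.cast_ofNat])
  obtain ⟨m, hm⟩ := hG
  rw [hm] at h7
  rw [← Int.natCast_modEq_iff]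
  refine Int.modEq_iff_dvd.2 ⟨z - m * finrank k σ.invariants, ?_⟩
  push_cast at h7 ⊢
  linear_combination h7

theorem odd_finrank_of_isIrreducible [Finite G] (hG : Odd (Nat.card G))
    (σ : Representation k G V) [σ.IsIrreducible] : Odd (finrank k V) := by
  have h := finrank_modEq_finrank_invariants hG (Representation.linHom σ σ) fun g => by
    rw [Representation.char_linHom, Representation.char_linHom, inv_inv, mul_comm]
  rw [(Representation.invariantsEquivIntertwiningMap σ σ).finrank_eq,
    Representation.IsIrreducible.finrank_intertwiningMap_self, finrank_linearMap] at h
  exact (Nat.odd_mul.1 (Nat.odd_iff.2 h)).1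

omit [IsAlgClosed k] [CharZero k] in
theorem character_inv_of_form (σ : Representation k G V) {B : LinearMap.BilinForm k V}
    (hB : B.Nondegenerate) (hσ : ∀ g v w, B (σ g v) (σ g w) = B v w) (g : G) :
    σ.character g⁻¹ = σ.character g := by
  rw [← Representation.char_dual]
  have h : σ.dual g = (B.toDual hB).conj (σ g) := by
    ext f v
    obtain ⟨w, rfl⟩ := (B.toDual hB).surjective f
    rw [LinearEquiv.conj_apply_apply, LinearEquiv.symm_apply_apply, LinearMap.BilinForm.toDual_def,
      ← Representation.self_inv_apply σ g v, hσ, Representation.self_inv_apply]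
    rfl
  rw [Representation.character, h, LinearMap.trace_conj']
  rfl
end

open Module in
section
variable {k : Type*} [Field k] {G V : Type*} [Group G] [AddCommGroup V] [Module k V]

theorem exists_isIrreducible_subrepresentation [FiniteDimensional k V] [Nontrivial V]
    (σ : Representation k G V) : ∃ A : Subrepresentation σ, A.toSubmodule ≠ ⊥ ∧
      A.toRepresentation.IsIrreducible ∧ ∀ B : Subrepresentation σ, B.toSubmodule ≠ ⊥ →
        finrank k A.toSubmodule ≤ finrank k B.toSubmodule := by
  obtain ⟨A, hA, hmin⟩ := (measure fun A : Subrepresentation σ => finrank k A.toSubmodule).wf.has_min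
    {A | A.toSubmodule ≠ ⊥} ⟨⊤, top_ne_bot⟩
  have hmin' : ∀ B : Subrepresentation σ, B.toSubmodule ≠ ⊥ →
      finrank k A.toSubmodule ≤ finrank k B.toSubmodule := fun B hB => not_lt.1 (hmin B hB)
  refine ⟨A, hA, ?_, hmin'⟩
  have hnt : Nontrivial (Subrepresentation A.toRepresentation) := by
    refine ⟨⊥, ⊤, fun h => hA ?_⟩
    have h1 : (⊥ : Submodule k A.toSubmodule) = ⊤ := congrArg Subrepresentation.toSubmodule h
    rw [← Submodule.map_subtype_top A.toSubmodule, ← h1, Submodule.map_bot]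
  refine ⟨fun B => ?_⟩
  let B' : Subrepresentation σ := ⟨B.toSubmodule.map A.toSubmodule.subtype, by
    rintro g _ ⟨v, hv, rfl⟩
    exact ⟨A.toRepresentation g v, B.apply_mem_toSubmodule g hv, rfl⟩⟩
  by_cases hB : B.toSubmodule = ⊥
  · exact Or.inl (Subrepresentation.toSubmodule_injective hB)
  · right
    apply Subrepresentation.toSubmodule_injective
    have h1 := hmin' B' (fun h => hB (Submodule.map_injective_of_injective
      A.toSubmodule.injective_subtype (h.trans (Submodule.map_bot _).symm)))
    have h2 : finrank k B'.toSubmodule = finrank k B.toSubmodule :=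
      Submodule.finrank_map_subtype_eq _ _
    exact Submodule.eq_top_of_finrank_eq (le_antisymm (Submodule.finrank_le _) (h2 ▸ h1))

theorem exists_stable_line [IsAlgClosed k] [CharZero k] [Finite G] (hG : Odd (Nat.card G))
    (σ : Representation k G V) (hV : finrank k V = 8) (hinv : σ.invariants = ⊥)
    {B : LinearMap.BilinForm k V} (hB : B.Nondegenerate) (hr : B.IsRefl)
    (hσ : ∀ g v w, B (σ g v) (σ g w) = B v w) : ∃ v ≠ 0, ∀ g, ∃ c : k, σ g v = c • v := by
  have : FiniteDimensional k V := FiniteDimensional.of_finrank_pos (by omega)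
  have : Nontrivial V := Module.nontrivial_of_finrank_pos (R := k) (by omega)
  obtain ⟨A, hA, hirr, hmin⟩ := exists_isIrreducible_subrepresentation σ
  have hodd := odd_finrank_of_isIrreducible hG A.toRepresentation
  let A' : Subrepresentation σ := ⟨B.orthogonal A.toSubmodule, fun g v hv w hw => by
    rw [← Representation.self_inv_apply σ g w, hσ]
    exact hv _ (A.apply_mem_toSubmodule g⁻¹ hw)⟩
  have hAA' : finrank k A'.toSubmodule = 8 - finrank k A.toSubmodule := by
    rw [← hV]
    exact LinearMap.BilinForm.finrank_orthogonal hB A.toSubmodule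
  by_cases hd : Disjoint A.toSubmodule (B.orthogonal A.toSubmodule)
  · exfalso
    have h1 := B.nondegenerate_restrict_of_disjoint_orthogonal hr hd
    have h2 := finrank_modEq_finrank_invariants hG A.toRepresentation
      (character_inv_of_form A.toRepresentation h1 fun g v w => hσ g v w)
    have h3 : A.toRepresentation.invariants = ⊥ := by
      rw [eq_bot_iff]
      intro v hv
      have h4 : (v : V) ∈ σ.invariants := fun g => congrArg Subtype.val (hv g)
      rw [hinv, Submodule.mem_bot] at h4
      exact (Submodule.mem_bot k).2 (Subtype.ext h4)
    rw [h3, finrank_bot, Nat.ModEq, Nat.zero_mod] at h2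
    have := Nat.odd_iff.1 hodd
    omega
  · have hle : A.toSubmodule ≤ A'.toSubmodule := by
      have h1 := hmin (A ⊓ A') (fun h => hd (disjoint_iff.2 h))
      have h2 := Submodule.eq_of_le_of_finrank_le
        (inf_le_left : A.toSubmodule ⊓ A'.toSubmodule ≤ A.toSubmodule) h1
      exact inf_eq_left.1 h2
    have hle' := Submodule.finrank_mono hle
    by_cases h1 : finrank k A.toSubmodule = 1
    · obtain ⟨v, hv, h⟩ := finrank_eq_one_iff'.1 h1
      refine ⟨v, fun h => hv (Subtype.ext h), fun g => ?_⟩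
      obtain ⟨c, hc⟩ := h (A.toRepresentation g v)
      exact ⟨c, (congrArg Subtype.val hc).symm⟩
    · exfalso
      have h3 : finrank k A.toSubmodule = 3 := by
        obtain ⟨m, hm⟩ := hodd
        omega
      have := Fintype.ofFinite G
      have : NeZero (Nat.card G : k) := ⟨Nat.cast_ne_zero.2 Nat.card_pos.ne'⟩
      have hss : Representation.IsSemisimpleRepresentation σ := inferInstance
      obtain ⟨C, hC⟩ := hss.exists_isCompl A
      have h4 : A.toSubmodule ⊓ (C.toSubmodule ⊓ A'.toSubmodule) = ⊥ := by
        rw [← inf_assoc]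
        have : A.toSubmodule ⊓ C.toSubmodule = ⊥ :=
          congrArg Subrepresentation.toSubmodule (disjoint_iff.1 hC.1)
        rw [this, bot_inf_eq]
      have h5 : A.toSubmodule ⊔ (C.toSubmodule ⊓ A'.toSubmodule) = A'.toSubmodule := by
        rw [← sup_inf_assoc_of_le _ hle]
        have : A.toSubmodule ⊔ C.toSubmodule = ⊤ :=
          congrArg Subrepresentation.toSubmodule (codisjoint_iff.1 hC.2)
        rw [this, top_inf_eq]
      have h6 := Submodule.finrank_sup_add_finrank_inf_eq A.toSubmodule
        (C.toSubmodule ⊓ A'.toSubmodule)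
      rw [h4, h5, finrank_bot, hAA', h3] at h6
      have h7 := hmin (C ⊓ A') (fun h => by
        rw [Subrepresentation.toSubmodule_inf] at h
        rw [h, finrank_bot] at h6
        omega)
      rw [Subrepresentation.toSubmodule_inf] at h7
      omega
end

open Matrix in
section
variable {k : Type*} [Field k] {G : Type*} [Group G]

/-- The conjugation action on traceless matrices. -/
noncomputable def conjRep {n : ℕ} (ρ : G →* GeneralLinearGroup (Fin n) k) :
    Representation k G (LinearMap.ker (traceLinearMap (Fin n) k k)) where
  toFun g :=
    { toFun := fun X => ⟨(ρ g : Matrix (Fin n) (Fin n) k) * X * (ρ g⁻¹ : Matrix (Fin n) (Fin n) k), by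
        rw [LinearMap.mem_ker, traceLinearMap_apply, trace_mul_comm, ← mul_assoc, ← Units.val_mul,
          ← map_mul, inv_mul_cancel, map_one, Units.val_one, one_mul]
        exact X.2⟩
      map_add' := fun X Y => Subtype.ext (by simp [mul_add, add_mul])
      map_smul' := fun c X => Subtype.ext (by simp) }
  map_one' := by ext X : 2; simp
  map_mul' g h := by ext X : 2; simp [mul_assoc]

theorem conjRep_apply {n : ℕ} (ρ : G →* GeneralLinearGroup (Fin n) k) (g : G)
    (X : LinearMap.ker (traceLinearMap (Fin n) k k)) : (conjRep ρ g X : Matrix (Fin n) (Fin n) k) =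
      (ρ g : Matrix (Fin n) (Fin n) k) * X * (ρ g⁻¹ : Matrix (Fin n) (Fin n) k) := rfl

theorem conjRep_apply_mul {n : ℕ} (ρ : G →* GeneralLinearGroup (Fin n) k) (g : G)
    (X : LinearMap.ker (traceLinearMap (Fin n) k k)) :
    (conjRep ρ g X : Matrix (Fin n) (Fin n) k) * (ρ g : Matrix (Fin n) (Fin n) k) =
      (ρ g : Matrix (Fin n) (Fin n) k) * X := by
  rw [conjRep_apply, mul_assoc, ← Units.val_mul, ← map_mul, inv_mul_cancel, map_one, Units.val_one,
    mul_one]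

theorem conjRep_eq_one {n : ℕ} {ρ : G →* GeneralLinearGroup (Fin n) k} {g : G}
    (hg : g ∈ scalarSubgroup ρ) : conjRep ρ g = 1 := by
  obtain ⟨c, hc⟩ := mem_scalarSubgroup.1 hg
  ext X : 2
  have h1 : (ρ g : Matrix (Fin n) (Fin n) k) * X = X * (ρ g : Matrix (Fin n) (Fin n) k) := by
    rw [hc, smul_mul_assoc, one_mul, mul_smul_comm, mul_one]
  rw [conjRep_apply, h1, mul_assoc, ← Units.val_mul, ← map_mul, mul_inv_cancel, map_one,
    Units.val_one, mul_one]
  rfl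

theorem exists_semiinvariant_matrix [IsAlgClosed k] [CharZero k] [Finite G]
    (ρ : G →* GeneralLinearGroup (Fin 3) k) (hodd : Odd (scalarSubgroup ρ).index)
    (hcomm : ∀ M : Matrix (Fin 3) (Fin 3) k,
      (∀ g, Commute (ρ g : Matrix (Fin 3) (Fin 3) k) M) → ∃ c : k, M = c • 1) :
    ∃ M : Matrix (Fin 3) (Fin 3) k, M ≠ 0 ∧ M.trace = 0 ∧ ∀ g, ∃ c : k,
      (ρ g : Matrix (Fin 3) (Fin 3) k) * M = c • (M * (ρ g : Matrix (Fin 3) (Fin 3) k)) := by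
  let S := LinearMap.ker (traceLinearMap (Fin 3) k k)
  have htr : (traceLinearMap (Fin 3) k k) 1 = 3 := by simp
  have hsub : ∀ X : Matrix (Fin 3) (Fin 3) k, X - (X.trace / 3) • 1 ∈ S := by
    intro X
    rw [LinearMap.mem_ker, map_sub, map_smul, htr, smul_eq_mul, div_mul_cancel₀ _ three_ne_zero,
      traceLinearMap_apply, sub_self]
  have hS : Module.finrank k S = 8 := by
    have h1 := LinearMap.finrank_range_add_finrank_ker (traceLinearMap (Fin 3) k k)
    rw [LinearMap.range_eq_top.2 (fun c => ⟨(c / 3) • 1, by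
      rw [map_smul, htr, smul_eq_mul, div_mul_cancel₀ _ three_ne_zero]⟩), finrank_top,
      Module.finrank_self, Module.finrank_matrix, Fintype.card_fin, Module.finrank_self] at h1
    change 1 + Module.finrank k S = _ at h1
    omega
  let σ : Representation k (G ⧸ scalarSubgroup ρ) S :=
    QuotientGroup.lift (scalarSubgroup ρ) (conjRep ρ) fun g hg => conjRep_eq_one hg
  have hσ : ∀ g : G, σ g = conjRep ρ g := fun g => QuotientGroup.lift_mk _ _ g
  let B : LinearMap.BilinForm k S := LinearMap.mk₂ k
    (fun X Y => ((X : Matrix (Fin 3) (Fin 3) k) * (Y : Matrix (Fin 3) (Fin 3) k)).trace)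
    (fun X Y Z => by simp [add_mul]) (fun c X Y => by simp) (fun X Y Z => by simp [mul_add])
    (fun c X Y => by simp)
  have hBs : B.IsSymm := ⟨fun X Y => by
    exact trace_mul_comm (X : Matrix (Fin 3) (Fin 3) k) (Y : Matrix (Fin 3) (Fin 3) k)⟩
  suffices h : ∃ v : S, v ≠ 0 ∧ ∀ q, ∃ c : k, σ q v = c • v by
    obtain ⟨M, hM, h⟩ := h
    refine ⟨M, fun h => hM (Subtype.ext h), M.2, fun g => ?_⟩
    obtain ⟨c, hc⟩ := h g
    refine ⟨c, ?_⟩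
    rw [← conjRep_apply_mul, ← hσ, hc, Submodule.coe_smul, smul_mul_assoc]
  refine exists_stable_line (k := k) (G := G ⧸ scalarSubgroup ρ) hodd σ hS ?_ (B := B) ?_ ?_ ?_
  · rw [eq_bot_iff]
    intro X hX
    obtain ⟨c, hc⟩ := hcomm X fun g => by
      have h1 : σ g X = X := hX g
      rw [hσ] at h1
      have h2 := conjRep_apply_mul ρ g X
      rw [h1] at h2
      exact h2.symm
    have h3 : (X : Matrix (Fin 3) (Fin 3) k).trace = 0 := X.2
    rw [hc, trace_smul, trace_one, Fintype.card_fin, smul_eq_mul, Nat.cast_ofNat,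
      mul_eq_zero, or_iff_left three_ne_zero] at h3
    rw [Submodule.mem_bot]
    ext1
    rw [hc, h3, zero_smul]
    rfl
  · refine hBs.isRefl.nondegenerate_iff_separatingLeft.2 ?_
    intro X hX
    ext1
    refine ext_iff_trace_mul_right.2 fun Y => ?_
    have h1 := hX ⟨_, hsub Y⟩
    have h3 : (X : Matrix (Fin 3) (Fin 3) k).trace = 0 := X.2
    change (_ * (Y - (Y.trace / 3) • 1)).trace = 0 at h1
    rw [mul_sub, mul_smul_comm, mul_one, trace_sub, trace_smul, h3, smul_zero, sub_zero] at h1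
    rw [h1, Submodule.coe_zero, zero_mul, trace_zero]
  · exact hBs.isRefl
  · intro q X Y
    obtain ⟨g, rfl⟩ := QuotientGroup.mk_surjective q
    change ((σ g X : Matrix (Fin 3) (Fin 3) k) * (σ g Y : Matrix (Fin 3) (Fin 3) k)).trace =
      ((X : Matrix (Fin 3) (Fin 3) k) * (Y : Matrix (Fin 3) (Fin 3) k)).trace
    rw [hσ, conjRep_apply ρ g Y, ← mul_assoc, ← mul_assoc, conjRep_apply_mul, trace_mul_comm,
      mul_assoc, ← mul_assoc, ← Units.val_mul, ← map_mul, inv_mul_cancel, map_one,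
      Units.val_one, one_mul]
end

section

/-- A nonzero subgroup of the Eisenstein integers stable under multiplication by a cube root of unity
is principal. -/
theorem exists_generator_of_rotation_stable (Λ : AddSubgroup (ℤ × ℤ)) (hΛ : Λ ≠ ⊥)
    (hT : ∀ v ∈ Λ, (-v.2, v.1 - v.2) ∈ Λ) :
    ∃ v ∈ Λ, ∀ w ∈ Λ, ∃ r s : ℤ, w = r • v + s • (-v.2, v.1 - v.2) := by
  let N : ℤ × ℤ → ℤ := fun v => v.1 ^ 2 - v.1 * v.2 + v.2 ^ 2
  have hN : ∀ v, v ≠ 0 → 0 < N v := by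
    rintro ⟨a, b⟩ hv
    by_contra! h
    apply hv
    simp only [N] at h
    have hb : b = 0 := by
      by_contra hb
      have : 0 < b ^ 2 := by positivity
      nlinarith [sq_nonneg (2 * a - b)]
    subst hb
    have ha : a = 0 := by
      by_contra ha
      have : 0 < a ^ 2 := by positivity
      nlinarith
    rw [ha]
    rfl
  obtain ⟨w, hw, hw0⟩ := (Submodule.ne_bot_iff (AddSubgroup.toIntSubmodule Λ)).1 (by
    simpa using hΛ)
  obtain ⟨v, ⟨hv, hv0⟩, hmin⟩ := (measure fun v : ℤ × ℤ => (N v).toNat).wf.has_min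
    {v | v ∈ Λ ∧ v ≠ 0} ⟨w, hw, hw0⟩
  have hround : ∀ x : ℤ, ∃ r, |2 * (x - r * N v)| ≤ N v := by
    intro x
    have := hN v hv0
    refine ⟨(2 * x + N v) / (2 * N v), ?_⟩
    have h1 := Int.emod_add_mul_ediv (2 * x + N v) (2 * N v)
    have h2 := Int.emod_nonneg (2 * x + N v) (b := 2 * N v) (by omega)
    have h3 := Int.emod_lt_of_pos (2 * x + N v) (b := 2 * N v) (by omega)
    rw [abs_le]
    constructor <;> nlinarith
  refine ⟨v, hv, fun w hw => ?_⟩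
  obtain ⟨r, hr⟩ := hround (w.1 * v.1 - w.1 * v.2 + w.2 * v.2)
  obtain ⟨s, hs⟩ := hround (w.2 * v.1 - w.1 * v.2)
  refine ⟨r, s, sub_eq_zero.1 ?_⟩
  by_contra hne
  have hmem : w - (r • v + s • (-v.2, v.1 - v.2)) ∈ Λ :=
    sub_mem hw (add_mem (zsmul_mem hv r) (zsmul_mem (hT v hv) s))
  refine hmin _ ⟨hmem, hne⟩ ?_
  change (N _).toNat < (N v).toNat
  rw [Int.toNat_lt_toNat (hN v hv0)]
  set X := w.1 * v.1 - w.1 * v.2 + w.2 * v.2 - r * N v with hX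
  set Y := w.2 * v.1 - w.1 * v.2 - s * N v with hY
  have hmul : N (w - (r • v + s • (-v.2, v.1 - v.2))) * N v = X ^ 2 - X * Y + Y ^ 2 := by
    rw [hX, hY]
    simp only [N, Prod.fst_sub, Prod.fst_add, Prod.smul_fst, Prod.snd_sub, Prod.snd_add,
      Prod.smul_snd, smul_eq_mul]
    ring
  have hpos := hN v hv0
  rw [abs_le] at hr hs
  have h1 : 4 * (X ^ 2 - X * Y + Y ^ 2) ≤ 3 * N v ^ 2 := by
    nlinarith [mul_nonneg (sub_nonneg.2 hr.2) (neg_le_iff_add_nonneg.1 hr.1),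
      mul_nonneg (sub_nonneg.2 hs.2) (neg_le_iff_add_nonneg.1 hs.1),
      mul_nonneg (sub_nonneg.2 hr.2) (sub_nonneg.2 hs.2),
      mul_nonneg (neg_le_iff_add_nonneg.1 hr.1) (neg_le_iff_add_nonneg.1 hs.1)]
  nlinarith
end

section
variable {k F G : Type*} [Field k] [Field F] [Algebra k F] [Group G] {a : G →* (F ≃ₐ[k] F)}

open IntermediateField

theorem mem_of_sum_mem [Fintype G] [CharZero k] {K : IntermediateField k F}
    (hK : ∀ y ∈ K, ∀ g, a g y = y) {S : Set F} (hS : ∀ s ∈ S, IsAlgebraic K s)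
    (hsum : ∀ z ∈ Submonoid.closure S, ∑ g, a g z ∈ K) {y : F} (hy : y ∈ adjoin K S)
    (hyG : ∀ g, a g y = y) : y ∈ K := by
  rw [← IntermediateField.mem_toSubalgebra, adjoin_toSubalgebra_of_isAlgebraic hS,
    ← Subalgebra.mem_toSubmodule, Algebra.adjoin_eq_span] at hy
  have h2 : ∀ z ∈ Submodule.span K (Submonoid.closure S : Set F), ∑ g, a g z ∈ K := by
    intro z hz
    induction hz using Submodule.span_induction with
    | mem z hz => exact hsum z hz
    | zero => simp
    | add x y _ _ hx hy =>
      simp only [map_add, Finset.sum_add_distrib]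
      exact add_mem hx hy
    | smul r x _ hx =>
      have : ∀ g, a g (r • x) = r * a g x := fun g => by
        rw [Algebra.smul_def, map_mul]
        congr 1
        exact hK _ r.2 g
      simp only [this, ← Finset.mul_sum]
      exact mul_mem r.2 hx
  have h3 := h2 y hy
  simp only [hyG, Finset.sum_const, Finset.card_univ] at h3
  have h4 : (Fintype.card G : k) ≠ 0 := by simp
  rw [← Nat.cast_smul_eq_nsmul k] at h3
  simpa [smul_smul, h4] using K.smul_mem (x := (Fintype.card G : k)⁻¹) h3

theorem apply_sum_apply [Fintype G] (y : F) (g : G) : a g (∑ h, a h y) = ∑ h, a h y := by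
  rw [map_sum]
  refine Fintype.sum_equiv (Equiv.mulLeft g) _ _ fun h => ?_
  rw [Equiv.coe_mulLeft, map_mul a, AlgEquiv.mul_apply]

theorem inv_adjoin_pair_le [Finite G] [CharZero k] {u v : F}
    (hu : ∀ g, ∃ c : k, a g u = c • u) (hv : ∀ g, ∃ c : k, a g v = c • v)
    {K : IntermediateField k F} (hK : ∀ y ∈ K, ∀ g, a g y = y)
    (hm : ∀ i j : ℕ, (∀ g, a g (u ^ i * v ^ j) = u ^ i * v ^ j) → u ^ i * v ^ j ∈ K)
    (hua : IsAlgebraic K u) (hva : IsAlgebraic K v) : inv a (adjoin k {u, v}) ≤ K := by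
  have := Fintype.ofFinite G
  intro y hy
  obtain ⟨hy, hyG⟩ := mem_inv.1 hy
  have h1 : y ∈ adjoin K {u, v} := by
    have : adjoin k {u, v} ≤ (adjoin K {u, v}).restrictScalars k :=
      adjoin_le_iff.2 (subset_adjoin K _)
    exact this hy
  refine mem_of_sum_mem hK (by rintro z (rfl | rfl) <;> assumption) (fun z hz => ?_) h1 hyG
  obtain ⟨i, j, rfl⟩ := (Submonoid.mem_closure_pair _ _ _).1 hz
  choose c hc using hu
  choose d hd using hv
  have hs : ∑ g, a g (u ^ i * v ^ j) = (∑ g, c g ^ i * d g ^ j) • (u ^ i * v ^ j) := by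
    rw [Finset.sum_smul]
    refine Finset.sum_congr rfl fun g _ => ?_
    rw [map_mul, map_pow, map_pow, hc, hd, smul_pow, smul_pow, smul_mul_smul_comm]
  by_cases h0 : ∑ g, c g ^ i * d g ^ j = 0
  · rw [hs, h0, zero_smul]
    exact zero_mem _
  · rw [hs]
    refine K.smul_mem (hm i j fun g => ?_)
    have h3 := apply_sum_apply (a := a) (u ^ i * v ^ j) g
    rw [hs, map_smul] at h3
    exact smul_right_injective F h0 h3

theorem inPure_of_rotation [Finite G] [CharZero k] {s t : F} (hi : AlgebraicIndependent k ![s, t])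
    (h : G) (hs : a h s = t) (ht : a h t = (s * t)⁻¹)
    (hG : ∀ g, ∃ j : ℕ, ∀ y ∈ adjoin k {s, t}, a g y = a (h ^ j) y)
    {ω : k} (hω : IsPrimitiveRoot ω 3) : InPure (inv a (adjoin k {s, t})) := by
  have hw : algebraMap k F ω ^ 2 = -1 - algebraMap k F ω := by
    have := hω.geom_sum_eq_zero (by norm_num)
    simp [Finset.sum_range_succ] at this
    rw [← map_pow, eq_sub_iff_add_eq, ← map_add, eq_neg_iff_add_eq_zero, ← map_one (algebraMap k F),
      ← map_add]
    convert map_zero (algebraMap k F) using 2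
    linear_combination this
  have hs0 : s ≠ 0 := by simpa using hi.ne_zero 0
  have ht0 : t ≠ 0 := by simpa using hi.ne_zero 1
  have h30 : (3 : F) ≠ 0 := by
    have : ((3 : k)) ≠ 0 := by norm_num
    rw [← map_ofNat (algebraMap k F) 3]
    exact (map_ne_zero (algebraMap k F)).2 this
  set w := algebraMap k F ω with hwdef
  have haw : ∀ g, a g w = w := fun g => (a g).commutes ω
  have hwm : ∀ L : IntermediateField k F, w ∈ L := fun L => L.algebraMap_mem ω
  set l := 1 + s + s * t with hl
  have hl0 : l ≠ 0 := by
    intro h0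
    have := hi.eq_zero_of_aeval_eq_zero (1 + MvPolynomial.X 0 + MvPolynomial.X 0 * MvPolynomial.X 1)
      (by simpa using h0)
    have := congrArg (MvPolynomial.eval 0) this
    simp at this
  set p := (1 + w * s + w ^ 2 * (s * t)) / l with hp
  set q := (1 + w ^ 2 * s + w * (s * t)) / l with hq
  have hlh : a h l = l / s := by
    simp only [hl, map_add, map_mul, hs, ht, map_one]
    field_simp
    ring
  have hph : a h p = w ^ 2 * p := by
    rw [hp, map_div₀, hlh]
    simp only [map_add, map_mul, map_pow, hs, ht, map_one, haw]
    field_simp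
    grind
  have hqh : a h q = w * q := by
    rw [hq, map_div₀, hlh]
    simp only [map_add, map_mul, map_pow, hs, ht, map_one, haw]
    field_simp
    grind
  have hd : 1 + p + q ≠ 0 := by
    have : 1 + p + q = 3 / l := by
      rw [hp, hq]
      field_simp
      grind
    rw [this]
    exact div_ne_zero h30 hl0
  have hse : s = (1 + w ^ 2 * p + w * q) / (1 + p + q) := by
    rw [eq_div_iff hd, hp, hq]
    field_simp
    grind
  have hte : t = (1 + w * p + w ^ 2 * q) / (1 + p + q) / s := by
    rw [eq_div_iff hs0, eq_div_iff hd, hp, hq]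
    field_simp
    grind
  have hadj : adjoin k {s, t} = adjoin k {q, p} := by
    apply le_antisymm <;> rw [adjoin_le_iff]
    · have hpm : p ∈ adjoin k {q, p} := subset_adjoin _ _ (by simp)
      have hqm : q ∈ adjoin k {q, p} := subset_adjoin _ _ (by simp)
      have hsm : s ∈ adjoin k {q, p} := by
        rw [hse]
        exact div_mem (add_mem (add_mem (one_mem _) (mul_mem (pow_mem (hwm _) 2) hpm))
          (mul_mem (hwm _) hqm)) (add_mem (add_mem (one_mem _) hpm) hqm)
      rintro y (rfl | rfl)
      · exact hsm
      · rw [hte]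
        exact div_mem (div_mem (add_mem (add_mem (one_mem _) (mul_mem (hwm _) hpm))
          (mul_mem (pow_mem (hwm _) 2) hqm)) (add_mem (add_mem (one_mem _) hpm) hqm)) hsm
    · have hsm : s ∈ adjoin k {s, t} := subset_adjoin _ _ (by simp)
      have htm : t ∈ adjoin k {s, t} := subset_adjoin _ _ (by simp)
      have hlm : l ∈ adjoin k {s, t} := add_mem (add_mem (one_mem _) hsm) (mul_mem hsm htm)
      rintro y (rfl | rfl)
      · exact div_mem (add_mem (add_mem (one_mem _) (mul_mem (pow_mem (hwm _) 2) hsm))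
          (mul_mem (hwm _) (mul_mem hsm htm))) hlm
      · exact div_mem (add_mem (add_mem (one_mem _) (mul_mem (hwm _) hsm))
          (mul_mem (pow_mem (hwm _) 2) (mul_mem hsm htm))) hlm
  have hpq : AlgebraicIndependent k ![p, q] := by
    refine algebraicIndependent_of_mem_adjoin hi (fun i => ?_) le_rfl
    have : (Set.range ![p, q]) = {q, p} := by simp [Set.pair_comm]
    rw [this, ← hadj]
    fin_cases i
    · exact subset_adjoin _ _ (by simp)
    · exact subset_adjoin _ _ (by simp)
  have hpj : ∀ j : ℕ, a (h ^ j) p = w ^ (2 * j) * p := by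
    intro j
    induction j with
    | zero => simp
    | succ j ih =>
      rw [pow_succ', map_mul, AlgEquiv.mul_apply, ih, map_mul, map_pow, haw, hph]
      ring
  have hqj : ∀ j : ℕ, a (h ^ j) q = w ^ j * q := by
    intro j
    induction j with
    | zero => simp
    | succ j ih =>
      rw [pow_succ', map_mul, AlgEquiv.mul_apply, ih, map_mul, map_pow, haw, hqh]
      ring
  rw [hadj] at hG ⊢
  refine inPure_inv_pair hpq (fun g => ?_) fun g => ?_ <;> obtain ⟨j, hj⟩ := hG g
  · rw [hj p (subset_adjoin _ _ (by simp)), hpj]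
    exact mul_mem (pow_mem (hwm _) _) (subset_adjoin _ _ (by simp))
  · refine ⟨w ^ j, pow_mem (hwm _) _, 0, zero_mem _, ?_⟩
    rw [hj q (subset_adjoin _ _ (by simp)), hqj, add_zero]

theorem inPure_of_monomial [Finite G] [CharZero k] {u v : F} (hi : AlgebraicIndependent k ![u, v])
    (A : Subgroup G) [A.Normal] (hu : ∀ g ∈ A, ∃ c : k, a g u = c • u)
    (hv : ∀ g ∈ A, ∃ c : k, a g v = c • v) (h : G) (hhu : a h u = v) (hhv : a h v = (u * v)⁻¹)
    (hG : ∀ g, ∃ j : ℕ, ∃ g' ∈ A, g = h ^ j * g')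
    {ω : k} (hω : IsPrimitiveRoot ω 3) : InPure (inv a (adjoin k {u, v})) := by
  have hu0 : u ≠ 0 := by simpa using hi.ne_zero 0
  have hv0 : v ≠ 0 := by simpa using hi.ne_zero 1
  let mon : ℤ × ℤ → F := fun x => u ^ x.1 * v ^ x.2
  have hmon0 : ∀ x, mon x ≠ 0 := fun x => mul_ne_zero (zpow_ne_zero _ hu0) (zpow_ne_zero _ hv0)
  have hadd : ∀ x y, mon (x + y) = mon x * mon y := by
    intro x y
    simp only [mon, Prod.fst_add, Prod.snd_add, zpow_add₀ hu0, zpow_add₀ hv0]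
    ring
  have hneg : ∀ x, mon (-x) = (mon x)⁻¹ := by
    intro x
    simp only [mon, Prod.fst_neg, Prod.snd_neg, zpow_neg, mul_inv]
  have hsmul : ∀ (r : ℤ) x, mon (r • x) = mon x ^ r := by
    intro r x
    simp only [mon, Prod.smul_fst, Prod.smul_snd, smul_eq_mul, mul_zpow, ← zpow_mul, mul_comm r]
  have hrot : ∀ x, a h (mon x) = mon (-x.2, x.1 - x.2) := by
    intro x
    simp only [mon, map_mul, map_zpow₀, hhu, hhv, inv_zpow', mul_zpow, zpow_sub₀ hv0, zpow_neg]
    field_simp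
  let Λ : AddSubgroup (ℤ × ℤ) :=
    { carrier := {x | ∀ g ∈ A, a g (mon x) = mon x}
      add_mem' := fun {x y} hx hy g hg => by rw [hadd, map_mul, hx g hg, hy g hg]
      zero_mem' := fun g _ => by simp [mon]
      neg_mem' := fun {x} hx g hg => by rw [hneg, map_inv₀, hx g hg] }
  have hΛ : ∀ x, x ∈ Λ ↔ ∀ g ∈ A, a g (mon x) = mon x := fun x => Iff.rfl
  have hT : ∀ x ∈ Λ, (-x.2, x.1 - x.2) ∈ Λ := by
    intro x hx g hg
    have h1 : h⁻¹ * g * h ∈ A := by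
      simpa using ‹A.Normal›.conj_mem g hg h⁻¹
    have h2 := hx _ h1
    rw [← hrot, ← AlgEquiv.mul_apply, ← map_mul]
    have h3 : g * h = h * (h⁻¹ * g * h) := by group
    rw [h3, map_mul a, AlgEquiv.mul_apply, h2]
  have hfin : ∀ {y : F}, (∀ g ∈ A, ∃ c : k, a g y = c • y) → y ≠ 0 →
      ∀ g ∈ A, a g (y ^ Nat.card G) = y ^ Nat.card G := by
    intro y hy hy0 g hg
    obtain ⟨c, hc⟩ := hy g hg
    have h1 : ∀ j : ℕ, a (g ^ j) y = c ^ j • y := by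
      intro j
      induction j with
      | zero => simp
      | succ j ih =>
        rw [pow_succ', map_mul, AlgEquiv.mul_apply, ih, map_smul, hc, smul_smul, pow_succ]
    have h2 := h1 (Nat.card G)
    rw [pow_card_eq_one', map_one, AlgEquiv.one_apply] at h2
    rw [map_pow, hc, smul_pow]
    have h3 : c ^ Nat.card G = 1 := by
      have : (1 : k) • y = c ^ Nat.card G • y := by rw [one_smul]; exact h2
      exact (smul_left_injective k hy0 this).symm
    rw [h3, one_smul]
  have hN : Nat.card G ≠ 0 := Nat.card_pos.ne'
  have hun : ((Nat.card G : ℤ), (0 : ℤ)) ∈ Λ := by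
    intro g hg
    simpa [mon] using hfin hu hu0 g hg
  have hvn : ((0 : ℤ), (Nat.card G : ℤ)) ∈ Λ := by
    intro g hg
    simpa [mon] using hfin hv hv0 g hg
  have hΛ0 : Λ ≠ ⊥ := by
    intro h0
    rw [h0, AddSubgroup.mem_bot] at hun
    exact hN (by simpa using hun)
  obtain ⟨x0, hx0, hgen⟩ := exists_generator_of_rotation_stable Λ hΛ0 hT
  set x1 : ℤ × ℤ := (-x0.2, x0.1 - x0.2) with hx1
  set K := adjoin k {mon x0, mon x1} with hKdef
  have hm0 : mon x0 ∈ K := subset_adjoin _ _ (by simp)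
  have hm1 : mon x1 ∈ K := subset_adjoin _ _ (by simp)
  have hmem : ∀ x ∈ Λ, mon x ∈ K := by
    intro x hx
    obtain ⟨r, s, rfl⟩ := hgen x hx
    rw [hadd, hsmul, hsmul]
    exact mul_mem (zpow_mem hm0 r) (zpow_mem hm1 s)
  have hKfix : ∀ g ∈ A, ∀ y ∈ K, a g y = y := by
    intro g hg y hy
    induction hy using adjoin_induction with
    | mem y hy =>
      rcases hy with rfl | rfl
      · exact hx0 g hg
      · exact hT _ hx0 g hg
    | algebraMap r => exact (a g).commutes r
    | add _ _ _ _ h1 h2 => rw [map_add, h1, h2]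
    | inv _ _ h1 => rw [map_inv₀, h1]
    | mul _ _ _ _ h1 h2 => rw [map_mul, h1, h2]
  have hua : IsAlgebraic K u := by
    refine IsAlgebraic.of_pow (Nat.pos_of_ne_zero hN) ?_
    have := hmem _ hun
    simp only [mon, zpow_natCast, zpow_zero, mul_one] at this
    exact isAlgebraic_algebraMap (⟨_, this⟩ : K)
  have hva : IsAlgebraic K v := by
    refine IsAlgebraic.of_pow (Nat.pos_of_ne_zero hN) ?_
    have := hmem _ hvn
    simp only [mon, zpow_natCast, zpow_zero, one_mul] at this
    exact isAlgebraic_algebraMap (⟨_, this⟩ : K)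
  have hrange : Set.range ![mon x0, mon x1] = {mon x0, mon x1} := by simp [Set.pair_comm]
  have hi' : AlgebraicIndependent k ![mon x0, mon x1] := by
    refine algebraicIndependent_of_isAlgebraic hi (fun i => ?_) le_rfl
    rw [hrange]
    fin_cases i
    · exact hua
    · exact hva
  have hmonm : ∀ x, mon x ∈ adjoin k {u, v} := fun x =>
    mul_mem (zpow_mem (subset_adjoin _ _ (by simp)) _) (zpow_mem (subset_adjoin _ _ (by simp)) _)
  have hle : K ≤ adjoin k {u, v} := by
    rw [adjoin_le_iff]
    rintro y (rfl | rfl)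
    · exact hmonm _
    · exact hmonm _
  have key : inv a (adjoin k {u, v}) = inv a K := by
    apply le_antisymm
    · have h1 : inv (a.comp A.subtype) (adjoin k {u, v}) ≤ K :=
        inv_adjoin_pair_le (G := A) (fun g => hu g g.2) (fun g => hv g g.2) (fun y hy g => hKfix g g.2 y hy)
          (fun i j hij => by
            have := hmem ((i : ℤ), (j : ℤ)) fun g hg => by simpa [mon] using hij ⟨g, hg⟩
            simpa [mon] using this) hua hva
      intro y hy
      obtain ⟨hy1, hy2⟩ := mem_inv.1 hy
      exact mem_inv.2 ⟨h1 (mem_inv.2 ⟨hy1, fun g => hy2 g⟩), hy2⟩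
    · exact inf_le_inf_right _ hle
  rw [key]
  refine inPure_of_rotation hi' h (hrot x0) ?_ (fun g => ?_) hω
  · rw [hrot, ← hadd, ← hneg]
    congr 1
    ext <;> simp [hx1] <;> ring
  · obtain ⟨j, g', hg', rfl⟩ := hG g
    refine ⟨j, fun y hy => ?_⟩
    rw [map_mul, AlgEquiv.mul_apply, hKfix g' hg' y hy]

end

section
open Matrix

theorem exists_smul_of_eigenrow {k : Type*} [Field k] {n : ℕ} {M : Matrix (Fin n) (Fin n) k}
    {w : Fin n → (Fin n → k)} (hw : LinearIndependent k w) {μ : Fin n → k}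
    (hμ : Function.Injective μ) (hwM : ∀ i, w i ᵥ* M = μ i • w i) {v : Fin n → k} {i : Fin n}
    (hv : v ᵥ* M = μ i • v) : ∃ s : k, v = s • w i := by
  have hspan : v ∈ Submodule.span k (Set.range w) := by
    rw [hw.span_eq_top_of_card_eq_finrank' (by simp)]
    exact Submodule.mem_top
  obtain ⟨c, rfl⟩ := (Submodule.mem_span_range_iff_exists_fun k).1 hspan
  have h1 : ∑ j, (c j * (μ j - μ i)) • w j = 0 := by
    have : (∑ j, c j • w j) ᵥ* M = ∑ j, (c j * μ j) • w j := by
      rw [Matrix.sum_vecMul]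
      refine Finset.sum_congr rfl fun j _ => ?_
      rw [Matrix.smul_vecMul, hwM, smul_smul]
    rw [this, Finset.smul_sum, ← sub_eq_zero, ← Finset.sum_sub_distrib] at hv
    rw [← hv]
    refine Finset.sum_congr rfl fun j _ => ?_
    rw [smul_smul, ← sub_smul]
    ring_nf
  refine ⟨c i, Finset.sum_eq_single_of_mem i (Finset.mem_univ _) fun j _ hj => ?_⟩
  have h2 := Fintype.linearIndependent_iff.1 hw _ h1 j
  rcases mul_eq_zero.1 h2 with h | h
  · rw [h, zero_smul]
  · exact absurd (hμ (sub_eq_zero.1 h)) hj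

theorem exists_eigenrows {k : Type*} [Field k] [IsAlgClosed k] {M : Matrix (Fin 3) (Fin 3) k}
    (hM : M.det ≠ 0) (R : Matrix.GeneralLinearGroup (Fin 3) k) {ω : k} (hω : IsPrimitiveRoot ω 3)
    (hR : (R : Matrix (Fin 3) (Fin 3) k) * M = ω • (M * (R : Matrix (Fin 3) (Fin 3) k))) :
    ∃ (μ : Fin 3 → k) (w : Fin 3 → (Fin 3 → k)), Function.Injective μ ∧ LinearIndependent k w ∧
      (∀ i, w i ᵥ* M = μ i • w i) ∧ ∃ d : k, d ≠ 0 ∧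
      ∀ i, w i ᵥ* (R : Matrix (Fin 3) (Fin 3) k) = d • w (i + 1) := by
  obtain ⟨l, hl⟩ := Module.End.exists_eigenvalue (M.vecMulLinear : Module.End k (Fin 3 → k))
  obtain ⟨v, hv, hv0⟩ := hl.exists_hasEigenvector
  have hv : v ᵥ* M = l • v := Module.End.mem_eigenspace_iff.1 hv
  have hl0 : l ≠ 0 := by
    rintro rfl
    rw [zero_smul] at hv
    exact hM (Matrix.exists_vecMul_eq_zero_iff.1 ⟨v, hv0, hv⟩)
  have hstep : ∀ {y : Fin 3 → k} {m : k}, y ᵥ* M = m • y →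
      (y ᵥ* (R : Matrix (Fin 3) (Fin 3) k)) ᵥ* M =
        (ω * m) • (y ᵥ* (R : Matrix (Fin 3) (Fin 3) k)) := by
    intro y m hy
    rw [Matrix.vecMul_vecMul, hR, Matrix.vecMul_smul, ← Matrix.vecMul_vecMul, hy,
      Matrix.smul_vecMul, smul_smul]
  have hne : ∀ {y : Fin 3 → k}, y ≠ 0 → y ᵥ* (R : Matrix (Fin 3) (Fin 3) k) ≠ 0 := by
    intro y hy h0
    apply hy
    have := congrArg (fun z => z ᵥ* (R⁻¹).val) h0
    simpa only [Matrix.vecMul_vecMul, ← Units.val_mul, mul_inv_cancel, Units.val_one,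
      Matrix.vecMul_one, Matrix.zero_vecMul] using this
  set v1 := v ᵥ* (R : Matrix (Fin 3) (Fin 3) k) with hv1
  set v2 := v1 ᵥ* (R : Matrix (Fin 3) (Fin 3) k) with hv2
  have e1 : v1 ᵥ* M = (ω * l) • v1 := hstep hv
  have e2 : v2 ᵥ* M = (ω * (ω * l)) • v2 := hstep e1
  have e3 : (v2 ᵥ* (R : Matrix (Fin 3) (Fin 3) k)) ᵥ* M =
      (ω * (ω * (ω * l))) • (v2 ᵥ* (R : Matrix (Fin 3) (Fin 3) k)) := hstep e2
  have h3 : ω * (ω * (ω * l)) = l := by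
    linear_combination l * hω.pow_eq_one
  rw [h3] at e3
  have hμ : Function.Injective (fun i : Fin 3 => ω ^ (i : ℕ) * l) := by
    intro i j hij
    exact Fin.ext (hω.pow_inj i.2 j.2 (mul_right_cancel₀ hl0 hij))
  have key : ∀ d1 d2 : k, d1 ≠ 0 → d2 ≠ 0 →
      (∀ i, (![v, d1 • v1, d2 • v2] : Fin 3 → (Fin 3 → k)) i ᵥ* M =
        (ω ^ (i : ℕ) * l) • (![v, d1 • v1, d2 • v2] : Fin 3 → (Fin 3 → k)) i) ∧
      LinearIndependent k (![v, d1 • v1, d2 • v2] : Fin 3 → (Fin 3 → k)) := by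
    intro d1 d2 h1 h2
    have ha : ∀ i, (![v, d1 • v1, d2 • v2] : Fin 3 → (Fin 3 → k)) i ᵥ* M =
        (ω ^ (i : ℕ) * l) • (![v, d1 • v1, d2 • v2] : Fin 3 → (Fin 3 → k)) i := by
      intro i
      fin_cases i
      · simpa using hv
      · simp [Matrix.smul_vecMul, e1, smul_comm d1]
      · simp [Matrix.smul_vecMul, e2, smul_comm d2, pow_two, mul_assoc]
    refine ⟨ha, Module.End.eigenvectors_linearIndependent' (M.vecMulLinear : Module.End k (Fin 3 → k))
      _ hμ _ fun i => ⟨Module.End.mem_eigenspace_iff.2 (ha i), ?_⟩⟩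
    fin_cases i
    · exact hv0
    · exact smul_ne_zero h1 (hne hv0)
    · exact smul_ne_zero h2 (hne (hne hv0))
  obtain ⟨k1, k2⟩ := key 1 1 one_ne_zero one_ne_zero
  obtain ⟨c, hc⟩ := exists_smul_of_eigenrow k2 hμ k1 (i := 0)
    (v := v2 ᵥ* (R : Matrix (Fin 3) (Fin 3) k)) (e3.trans (by simp))
  have hc0 : c ≠ 0 := by
    rintro rfl
    rw [zero_smul] at hc
    exact hne (hne (hne hv0)) hc
  obtain ⟨d, hd⟩ := IsAlgClosed.exists_pow_nat_eq c (n := 3) (by norm_num)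
  have hd0 : d ≠ 0 := by
    rintro rfl
    exact hc0 (by rw [← hd]; simp)
  obtain ⟨k1, k2⟩ := key d⁻¹ (d⁻¹ * d⁻¹) (inv_ne_zero hd0) (mul_ne_zero (inv_ne_zero hd0) (inv_ne_zero hd0))
  refine ⟨_, _, hμ, k2, k1, d, hd0, fun i => ?_⟩
  fin_cases i
  · simp [smul_smul, hd0, hv1]
  · simp [smul_smul, hd0, hv2, Matrix.smul_vecMul]
  · have : d⁻¹ * d⁻¹ * c = d := by
      rw [← hd]; field_simp
    simp [Matrix.smul_vecMul, hc, smul_smul, this]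

end

section
variable {k F G : Type*} [Field k] [Field F] [Algebra k F] [Group G] {a : G →* (F ≃ₐ[k] F)}

open IntermediateField

theorem adjoin_successive_ratios {y : Fin 3 → F} (h : ∀ i, y i ≠ 0) :
    adjoin k {y 1 / y 0, y 2 / y 1} = adjoin k {y 0 / y 2, y 1 / y 2} := by
  have h0 := h 0
  have h1 := h 1
  have h2 := h 2
  apply le_antisymm <;> rw [adjoin_le_iff] <;> rintro z (rfl | rfl)
  · have : y 1 / y 0 = (y 1 / y 2) / (y 0 / y 2) := by field_simp
    rw [this]
    exact div_mem (subset_adjoin _ _ (by simp)) (subset_adjoin _ _ (by simp))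
  · have : y 2 / y 1 = (y 1 / y 2)⁻¹ := by field_simp
    rw [this]
    exact inv_mem (subset_adjoin _ _ (by simp))
  · have : y 0 / y 2 = ((y 1 / y 0) * (y 2 / y 1))⁻¹ := by field_simp
    rw [this]
    exact inv_mem (mul_mem (subset_adjoin _ _ (by simp)) (subset_adjoin _ _ (by simp)))
  · have : y 1 / y 2 = (y 2 / y 1)⁻¹ := by field_simp
    rw [this]
    exact inv_mem (subset_adjoin _ _ (by simp))

theorem LinAct.inPure_of_cyclic [Finite G] [CharZero k] {y : Fin 3 → F}
    {ρ : G →* Matrix.GeneralLinearGroup (Fin 3) k} (H : LinAct a y ρ)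
    (A : Subgroup G) [A.Normal] (hA : ∀ g ∈ A, ∀ i, ∃ c : k, a g (y i) = c • y i)
    (h : G) {d : k} (hd : d ≠ 0) (hy : ∀ i, a h (y i) = d • y (i + 1))
    (hG : ∀ g, ∃ j : ℕ, ∃ g' ∈ A, g = h ^ j * g') {ω : k} (hω : IsPrimitiveRoot ω 3) :
    InPure (inv a (adjoin k (Set.range y))) := by
  refine InPure.of_pureOver ?_ H.cone
  rw [← adjoin_successive_ratios H.ne_zero]
  have h0 := H.ne_zero 0
  have h1 := H.ne_zero 1
  have h2 := H.ne_zero 2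
  have hdF : algebraMap k F d ≠ 0 := (map_ne_zero _).2 hd
  have hdiv : ∀ g ∈ A, ∀ i j, ∃ c : k, a g (y i / y j) = c • (y i / y j) := by
    intro g hg i j
    obtain ⟨c, hc⟩ := hA g hg i
    obtain ⟨c', hc'⟩ := hA g hg j
    refine ⟨c / c', ?_⟩
    rw [map_div₀, hc, hc', Algebra.smul_def, Algebra.smul_def, Algebra.smul_def, map_div₀]
    rw [mul_div_mul_comm]
  have hr := algebraicIndependent_ratios H.indep
  have hr' : AlgebraicIndependent k ![y 0 / y 2, y 1 / y 2] := by
    have := hr.comp ![1, 2] (by decide)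
    convert this using 1
    ext i; fin_cases i <;> rfl
  have hi : AlgebraicIndependent k ![y 1 / y 0, y 2 / y 1] := by
    refine algebraicIndependent_of_mem_adjoin hr' (fun i => ?_) le_rfl
    have : Set.range ![y 1 / y 0, y 2 / y 1] = {y 1 / y 0, y 2 / y 1} := by simp [Set.pair_comm]
    rw [this, adjoin_successive_ratios H.ne_zero]
    fin_cases i <;> exact subset_adjoin _ _ (by simp)
  have e0 : a h (y 0) = d • y 1 := hy 0
  have e1 : a h (y 1) = d • y 2 := hy 1
  have e2 : a h (y 2) = d • y 0 := hy 2
  refine inPure_of_monomial hi A (fun g hg => hdiv g hg _ _) (fun g hg => hdiv g hg _ _) h ?_ ?_ hG hω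
  · rw [map_div₀, e0, e1, Algebra.smul_def, Algebra.smul_def, mul_div_mul_left _ _ hdF]
  · rw [map_div₀, e1, e2, Algebra.smul_def, Algebra.smul_def, mul_div_mul_left _ _ hdF]
    field_simp

theorem LinAct.inPure_of_semiinvariant [Finite G] [IsAlgClosed k] [CharZero k] {x : Fin 3 → F}
    {ρ : G →* Matrix.GeneralLinearGroup (Fin 3) k} (H : LinAct a x ρ)
    {M : Matrix (Fin 3) (Fin 3) k} (hM : M.det ≠ 0)
    (hc : ∀ g, ∃ c : k, (ρ g : Matrix (Fin 3) (Fin 3) k) * M =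
      c • (M * (ρ g : Matrix (Fin 3) (Fin 3) k)))
    (hn : ∃ g, ¬ Commute (ρ g : Matrix (Fin 3) (Fin 3) k) M) :
    InPure (inv a (adjoin k (Set.range x))) := by
  choose c hc using hc
  have hinj : ∀ g, ∀ s t : k, s • (M * (ρ g : Matrix (Fin 3) (Fin 3) k)) =
      t • (M * (ρ g : Matrix (Fin 3) (Fin 3) k)) → s = t := by
    intro g s t hst
    refine smul_left_injective k (fun h0 => ?_) hst
    have := congrArg Matrix.det h0
    rw [Matrix.det_mul, Matrix.det_zero] at this
    exact mul_ne_zero hM ((Matrix.isUnit_iff_isUnit_det _).1 (ρ g).isUnit).ne_zero this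
  let χ : G →* k :=
    { toFun := c
      map_one' := hinj 1 _ _ (by rw [← hc]; simp)
      map_mul' := fun g g' => hinj (g * g') _ _ (by
        rw [← hc, map_mul, Units.val_mul, mul_assoc, hc g', mul_smul_comm, ← mul_assoc, hc g,
          smul_mul_assoc, smul_smul, mul_assoc, mul_comm (c g)]) }
  have hχ : ∀ g, (ρ g : Matrix (Fin 3) (Fin 3) k) * M =
      χ g • (M * (ρ g : Matrix (Fin 3) (Fin 3) k)) := hc
  have hχ3 : ∀ g, χ g ^ 3 = 1 := by
    intro g
    have := congrArg Matrix.det (hχ g)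
    rw [Matrix.det_smul, Matrix.det_mul, Matrix.det_mul, mul_comm M.det, Fintype.card_fin] at this
    have h0 : (ρ g : Matrix (Fin 3) (Fin 3) k).det * M.det ≠ 0 :=
      mul_ne_zero ((Matrix.isUnit_iff_isUnit_det _).1 (ρ g).isUnit).ne_zero hM
    exact mul_right_cancel₀ h0 (by rw [one_mul]; exact this.symm)
  obtain ⟨g0, hg0⟩ := hn
  have hω : IsPrimitiveRoot (χ g0) 3 := by
    have h1 : χ g0 ≠ 1 := by
      intro h1
      apply hg0
      have := hχ g0
      rwa [h1, one_smul] at this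
    exact IsPrimitiveRoot.iff_orderOf.2 (orderOf_eq_prime (hχ3 g0) h1)
  obtain ⟨μ, w, hμ, hw, hwM, d, hd, hwR⟩ := exists_eigenrows hM (ρ g0) hω (hχ g0)
  obtain ⟨Q, hQ⟩ : IsUnit (Matrix.of w) := Matrix.linearIndependent_rows_iff_isUnit.1 hw
  have hQr : ∀ i, (Q : Matrix (Fin 3) (Fin 3) k) i = w i := fun i => by rw [hQ]; rfl
  have hact : ∀ g i, a g (changeVar (Q : Matrix (Fin 3) (Fin 3) k) x i) =
      ∑ j, Matrix.vecMul (w i) (ρ g⁻¹ : Matrix (Fin 3) (Fin 3) k) j • x j := by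
    intro g i
    rw [H.act_changeVar]
    simp only [changeVar]
    refine Finset.sum_congr rfl fun j _ => ?_
    rw [Matrix.mul_apply_eq_vecMul, hQr]
  have hvar : ∀ i, changeVar (Q : Matrix (Fin 3) (Fin 3) k) x i = ∑ j, w i j • x j := by
    intro i
    simp only [changeVar, hQr]
  rw [← adjoin_changeVar Q]
  refine (H.change Q).inPure_of_cyclic χ.ker (fun g hg i => ?_) g0⁻¹ hd (fun i => ?_) (fun g => ?_) hω
  · have h1 : χ g⁻¹ = 1 := χ.ker.inv_mem hg
    obtain ⟨s, hs⟩ := exists_smul_of_eigenrow hw hμ hwM (i := i)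
      (v := Matrix.vecMul (w i) (ρ g⁻¹ : Matrix (Fin 3) (Fin 3) k)) (by
        rw [Matrix.vecMul_vecMul, hχ, h1, one_smul, ← Matrix.vecMul_vecMul, hwM, Matrix.smul_vecMul])
    refine ⟨s, ?_⟩
    rw [hact, hs, hvar, Finset.smul_sum]
    exact Finset.sum_congr rfl fun j _ => by rw [Pi.smul_apply, smul_eq_mul, mul_smul]
  · rw [hact, inv_inv, hwR, hvar, Finset.smul_sum]
    exact Finset.sum_congr rfl fun j _ => by rw [Pi.smul_apply, smul_eq_mul, mul_smul]
  · obtain ⟨j, -, hj⟩ := hω.eq_pow_of_pow_eq_one (hχ3 g⁻¹)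
    refine ⟨j, (g0⁻¹ ^ j)⁻¹ * g, ?_, by group⟩
    rw [MonoidHom.mem_ker, map_mul, inv_pow, inv_inv, map_pow, hj, ← map_mul, inv_mul_cancel,
      map_one]

theorem LinAct.inPure_of_odd [Finite G] [IsAlgClosed k] [CharZero k] {x : Fin 3 → F}
    {ρ : G →* Matrix.GeneralLinearGroup (Fin 3) k} (H : LinAct a x ρ)
    (ho : Odd (scalarSubgroup ρ).index) : InPure (inv a (adjoin k (Set.range x))) := by
  by_cases hcomm : ∀ M : Matrix (Fin 3) (Fin 3) k,
      (∀ g, Commute (ρ g : Matrix (Fin 3) (Fin 3) k) M) → ∃ c : k, M = c • 1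
  · obtain ⟨M, hM0, hMt, hM⟩ := exists_semiinvariant_matrix ρ ho hcomm
    by_cases hdet : M.det = 0
    · exact H.inPure_of_det_eq_zero hM0 hdet hM
    · refine H.inPure_of_semiinvariant hdet hM ?_
      by_contra! hall
      obtain ⟨c, rfl⟩ := hcomm M hall
      rw [Matrix.trace_smul, Matrix.trace_one, smul_eq_mul, Fintype.card_fin] at hMt
      rcases mul_eq_zero.1 hMt with h | h
      · exact hM0 (by rw [h, zero_smul])
      · norm_num at h
  · push Not at hcomm
    obtain ⟨M, hM, hMc⟩ := hcomm
    exact H.inPure_of_commute hMc hM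

end

section
open IntermediateField

theorem inPure_ratAct {k : Type} [Field k] [IsAlgClosed k] [CharZero k] (N : ℕ) :
    ∀ (G : Type) [Group G] [Finite G] (ρ : G →* Matrix.GeneralLinearGroup (Fin 3) k),
      (scalarSubgroup ρ).index = N → InPure (inv (ratAct ρ) (adjoin k (Set.range (ratX k 3)))) := by
  induction N using Nat.strong_induction_on with
  | _ N ih =>
    intro G _ _ ρ hN
    rcases Nat.even_or_odd (scalarSubgroup ρ).index with he | ho
    · exact inPure_of_even ρ he fun G' _ _ ρ' h => ih _ (hN ▸ h) G' ρ' rfl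
    · exact (linAct_ratAct ρ).inPure_of_odd ho

end

section
variable {k F G : Type*} [Field k] [Field F] [Algebra k F] [Group G] {a : G →* (F ≃ₐ[k] F)}
  {L : IntermediateField k F}

open IntermediateField

/-- Speiser's lemma: the traces of the multiples of an element span a subspace containing it. -/
theorem mem_span_traces [Fintype G] (hL : ∀ g, ∀ y ∈ L, a g y ∈ L)
    (hfaith : ∀ g, (∀ y ∈ L, a g y = y) → g = 1) (w : F) :
    w ∈ Submodule.span L (Set.range fun c : L => ∑ g, a g (c * w)) := by
  by_contra hw
  obtain ⟨f, hfw, hf⟩ := Submodule.exists_le_ker_of_notMem hw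
  let χ : G → (L →* L) := fun g => (restrictHom (a g) L (hL g) : L →* L)
  have hχ : Function.Injective χ := by
    intro g h hgh
    have : ∀ y ∈ L, a (h⁻¹ * g) y = y := by
      intro y hy
      have h1 : a g y = a h y := congrArg Subtype.val (DFunLike.congr_fun hgh (⟨y, hy⟩ : L))
      rw [map_mul, AlgEquiv.mul_apply, h1, ← AlgEquiv.mul_apply, ← map_mul, inv_mul_cancel, map_one,
        AlgEquiv.one_apply]
    exact (inv_mul_eq_one.1 (hfaith _ this)).symm
  have hind := (linearIndependent_monoidHom L L).comp χ hχ
  have h1 := Fintype.linearIndependent_iff.1 hind (fun g => f (a g w)) (by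
    funext c
    have h2 : f (∑ g, a g (c * w)) = 0 := hf (Submodule.subset_span ⟨c, rfl⟩)
    rw [map_sum] at h2
    rw [Finset.sum_apply, Pi.zero_apply, ← h2]
    refine Finset.sum_congr rfl fun g _ => ?_
    have : a g (c * w) = χ g c • a g w := by
      rw [map_mul, Algebra.smul_def]
      rfl
    rw [this, map_smul, Pi.smul_apply, smul_eq_mul, smul_eq_mul, mul_comm]
    rfl) 1
  rw [map_one, AlgEquiv.one_apply] at h1
  exact hfw h1

/-- The no-name lemma: a semilinear action over a faithful base becomes trivial after a linear change
of variables. -/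
theorem pureOver_inv_of_semilinear [Finite G] [CharZero k] (hL : ∀ g, ∀ y ∈ L, a g y ∈ L)
    (hfaith : ∀ g, (∀ y ∈ L, a g y = y) → g = 1) {n : ℕ} {w : Fin n → F}
    (hw : AlgebraicIndependent L w) (hact : ∀ g i, a g (w i) ∈ Submodule.span L (Set.range w)) :
    PureOver (Fin n) (inv a L) (inv a ((adjoin L (Set.range w)).restrictScalars k)) := by
  have := Fintype.ofFinite G
  set W := Submodule.span L (Set.range w) with hWdef
  have hW : ∀ g, ∀ y ∈ W, a g y ∈ W := by
    intro g y hy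
    induction hy using Submodule.span_induction with
    | mem y hy =>
      obtain ⟨i, rfl⟩ := hy
      exact hact g i
    | zero => simp
    | add x y _ _ hx hy => rw [map_add]; exact add_mem hx hy
    | smul r x _ hx =>
      have : a g (r • x) = (⟨a g r, hL g r r.2⟩ : L) • a g x := by
        rw [Algebra.smul_def, Algebra.smul_def, map_mul]
        rfl
      rw [this]
      exact W.smul_mem _ hx
  let T : Set F := {y | y ∈ W ∧ ∀ g, a g y = y}
  have hT : Submodule.span L T = W := by
    apply le_antisymm
    · exact Submodule.span_le.2 fun y hy => hy.1
    · refine Submodule.span_le.2 ?_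
      rintro _ ⟨i, rfl⟩
      refine Submodule.span_mono ?_ (mem_span_traces hL hfaith (w i))
      rintro _ ⟨c, rfl⟩
      refine ⟨sum_mem fun g _ => hW g _ ?_, fun g => apply_sum_apply _ g⟩
      rw [← smul_eq_mul, ← IntermediateField.smul_def]
      exact W.smul_mem _ (Submodule.subset_span ⟨i, rfl⟩)
  have hfr : Module.finrank L (Submodule.span L T) = n := by
    rw [hT, finrank_span_eq_card hw.linearIndependent, Fintype.card_fin]
  have hfin : Module.Finite L (Submodule.span L T) := by
    rw [hT]
    exact Module.Finite.span_of_finite L (Set.finite_range w)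
  obtain ⟨z, hzT, hzspan⟩ : ∃ z : Fin n → F, (∀ i, z i ∈ T) ∧ Submodule.span L (Set.range z) = W := by
    obtain ⟨z, hzT, hzspan, -⟩ := Submodule.exists_fun_fin_finrank_span_eq L T
    refine ⟨z ∘ finCongr hfr.symm, fun i => hzT _, ?_⟩
    rw [EquivLike.range_comp, hzspan, hT]
  have hadj : adjoin L (Set.range w) = adjoin L (Set.range z) := by
    have key : ∀ s : Set F, ∀ y ∈ Submodule.span L s, y ∈ adjoin L s := fun s y hy =>
      Submodule.span_le (p := Subalgebra.toSubmodule (adjoin L s).toSubalgebra).2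
        (subset_adjoin L s) hy
    apply le_antisymm <;> rw [adjoin_le_iff]
    · rintro _ ⟨i, rfl⟩
      refine key _ _ ?_
      rw [hzspan]
      exact Submodule.subset_span ⟨i, rfl⟩
    · rintro _ ⟨i, rfl⟩
      exact key _ _ (hzT i).1
  have hz : AlgebraicIndependent L z := by
    refine algebraicIndependent_of_mem_adjoin hw (fun i => ?_) le_rfl
    rw [← hadj]
    exact subset_adjoin _ _ ⟨i, rfl⟩
  refine ⟨z, algebraicIndependent_inv hz, ?_⟩
  set K := (adjoin (inv a L) (Set.range z)).restrictScalars k with hK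
  have hLK : inv a L ≤ K := fun y hy => (adjoin (inv a L) (Set.range z)).algebraMap_mem ⟨y, hy⟩
  have hzK : ∀ i, z i ∈ K := fun i => subset_adjoin (inv a L) (Set.range z) ⟨i, rfl⟩
  have hKle : ∀ M : IntermediateField k F, inv a L ≤ M → (∀ i, z i ∈ M) → K ≤ M := by
    intro M h1 h2
    let M' : IntermediateField (inv a L) F := extendScalars h1
    have : adjoin (inv a L) (Set.range z) ≤ M' := adjoin_le_iff.2 (by
      rintro _ ⟨i, rfl⟩
      exact h2 i)
    exact fun y hy => this hy
  have hKfix : ∀ y ∈ K, ∀ g, a g y = y := by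
    intro y hy g
    have : K ≤ fixedField a.range := hKle _ inf_le_right fun i => by
      rw [← inv_top]
      exact mem_inv.2 ⟨mem_top, (hzT i).2⟩
    rw [← inv_top] at this
    exact (mem_inv.1 (this hy)).2 g
  apply le_antisymm
  · intro y hy
    refine mem_inv.2 ⟨?_, hKfix y hy⟩
    refine hKle _ ?_ (fun i => ?_) hy
    · exact fun y hy => (adjoin L (Set.range w)).algebraMap_mem ⟨y, inv_le hy⟩
    · rw [hadj]
      exact subset_adjoin L (Set.range z) ⟨i, rfl⟩
  · intro y hy
    obtain ⟨hy, hyG⟩ := mem_inv.1 hy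
    rw [hadj] at hy
    refine mem_of_sum_mem hKfix (S := (L : Set F)) (fun s hs => ?_) (fun s hs => ?_) ?_ hyG
    · let : Algebra (inv a L) K := (IntermediateField.inclusion hLK).toAlgebra
      have : IsScalarTower (inv a L) K F := IsScalarTower.of_algebraMap_eq fun _ => rfl
      exact IsAlgebraic.extendScalars (algebraMap (inv a L) K).injective (isAlgebraic_inv a hL hs)
    · refine hLK (mem_inv.2 ⟨?_, fun g => apply_sum_apply s g⟩)
      have : s ∈ L := (Submonoid.closure_le (S := L.toSubalgebra.toSubmonoid)).2 (fun _ h => h) hs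
      exact sum_mem fun g _ => hL g s this
    · let M : IntermediateField L F := extendScalars (F := L)
        (E := (adjoin K (L : Set F)).restrictScalars k) fun y hy => subset_adjoin K _ hy
      have : adjoin L (Set.range z) ≤ M := adjoin_le_iff.2 (by
        rintro _ ⟨i, rfl⟩
        exact (adjoin K (L : Set F)).algebraMap_mem ⟨z i, hzK i⟩)
      exact this hy

end

section
variable {k F G : Type*} [Field k] [Field F] [Algebra k F] [Group G] {a : G →* (F ≃ₐ[k] F)}

open IntermediateField

theorem LinAct.pureOver_of_injective [Finite G] [CharZero k] {n m : ℕ} {x : Fin n → F}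
    {y : Fin m → F} {ρ : G →* Matrix.GeneralLinearGroup (Fin n) k}
    {σ : G →* Matrix.GeneralLinearGroup (Fin m) k} (hx : LinAct a x ρ) (hy : LinAct a y σ)
    (hρ : Function.Injective ρ) (hxy : AlgebraicIndependent k (Sum.elim y x)) :
    PureOver (Fin m) (inv a (adjoin k (Set.range x)))
      (inv a (adjoin k (Set.range x ∪ Set.range y))) := by
  rw [← adjoin_adjoin_left]
  refine pureOver_inv_of_semilinear hx.stable (fun g hg => ?_) ?_ fun g i => ?_
  · refine hρ ((hx.eq_one fun i => hg _ (subset_adjoin _ _ ⟨i, rfl⟩)).trans (map_one ρ).symm)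
  · have := (AlgebraicIndependent.sumElim_iff.1 hxy).2
    exact algebraicIndependent_adjoin_iff.2 this
  · rw [hy.act]
    refine sum_mem fun j _ => ?_
    rw [← algebraMap_smul (adjoin k (Set.range x)) _ (y j)]
    exact Submodule.smul_mem _ _ (Submodule.subset_span ⟨j, rfl⟩)

/-- The direct sum of two matrix representations. -/
noncomputable def directSum {n m : ℕ} (ρ : G →* Matrix.GeneralLinearGroup (Fin n) k)
    (σ : G →* Matrix.GeneralLinearGroup (Fin m) k) :
    G →* Matrix.GeneralLinearGroup (Fin (n + m)) k :=
  MonoidHom.toHomUnits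
    { toFun := fun g => Matrix.reindexAlgEquiv k k finSumFinEquiv
        (Matrix.fromBlocks (ρ g : Matrix (Fin n) (Fin n) k) 0 0 (σ g : Matrix (Fin m) (Fin m) k))
      map_one' := by simp [Matrix.fromBlocks_one]
      map_mul' := fun g h => by
        rw [← map_mul, Matrix.fromBlocks_multiply]
        simp }

theorem coe_directSum {n m : ℕ} (ρ : G →* Matrix.GeneralLinearGroup (Fin n) k)
    (σ : G →* Matrix.GeneralLinearGroup (Fin m) k) (g : G) :
    (directSum ρ σ g : Matrix (Fin (n + m)) (Fin (n + m)) k) =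
      Matrix.reindex finSumFinEquiv finSumFinEquiv
        (Matrix.fromBlocks (ρ g : Matrix (Fin n) (Fin n) k) 0 0
          (σ g : Matrix (Fin m) (Fin m) k)) :=
  rfl

theorem LinAct.left {n m : ℕ} {x : Fin (n + m) → F}
    {ρ : G →* Matrix.GeneralLinearGroup (Fin n) k} {σ : G →* Matrix.GeneralLinearGroup (Fin m) k}
    (h : LinAct a x (directSum ρ σ)) : LinAct a (x ∘ Fin.castAdd m) ρ where
  indep := h.indep.comp _ (Fin.castAdd_injective n m)
  act g i := by
    refine (h.act g _).trans ?_
    generalize g⁻¹ = g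
    simp [Fin.sum_univ_add, coe_directSum]

theorem LinAct.right {n m : ℕ} {x : Fin (n + m) → F}
    {ρ : G →* Matrix.GeneralLinearGroup (Fin n) k} {σ : G →* Matrix.GeneralLinearGroup (Fin m) k}
    (h : LinAct a x (directSum ρ σ)) : LinAct a (x ∘ Fin.natAdd n) σ where
  indep := h.indep.comp _ (Fin.natAdd_injective m n)
  act g i := by
    refine (h.act g _).trans ?_
    generalize g⁻¹ = g
    simp [Fin.sum_univ_add, coe_directSum]

theorem InPure.exists_algEquiv {K : IntermediateField k F} (h : InPure K) :
    ∃ t : ℕ, Nonempty (K ≃ₐ[k] FractionRing (MvPolynomial (Fin t) k)) := by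
  obtain ⟨ι, hι, y, hy, rfl⟩ := h
  obtain ⟨t, ⟨e⟩⟩ := Finite.exists_equiv_fin ι
  have hy' : AlgebraicIndependent k (y ∘ e.symm) := hy.comp _ e.symm.injective
  have hr : Set.range (y ∘ e.symm) = Set.range y := EquivLike.range_comp y e.symm
  exact ⟨t, ⟨(equivOfEq (congrArg (adjoin k) hr.symm)).trans hy'.aevalEquivField.symm⟩⟩

/-- If one faithful representation has a purely transcendental field of invariants, then the
invariants of every faithful representation are stably purely transcendental. -/
theorem exists_fractionRing_algEquiv {k F F' G : Type} [Field k] [CharZero k] [Field F]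
    [Algebra k F] [Field F'] [Algebra k F'] [Group G] [Finite G] {a : G →* (F ≃ₐ[k] F)}
    {a' : G →* (F' ≃ₐ[k] F')} {n m : ℕ} {x : Fin n → F} {x' : Fin m → F'}
    {ρ : G →* Matrix.GeneralLinearGroup (Fin n) k} {σ : G →* Matrix.GeneralLinearGroup (Fin m) k}
    (h : LinAct a x ρ) (h' : LinAct a' x' σ) (hρ : Function.Injective ρ)
    (hσ : Function.Injective σ) (hp : InPure (inv a' (adjoin k (Set.range x')))) :
    ∃ t : ℕ, Nonempty (FractionRing (MvPolynomial (Fin m) (inv a (adjoin k (Set.range x)))) ≃ₐ[k]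
      FractionRing (MvPolynomial (Fin t) k)) := by
  have hb := linAct_ratAct (directSum ρ σ)
  have hind : AlgebraicIndependent k
      (Sum.elim (ratX k (n + m) ∘ Fin.castAdd m) (ratX k (n + m) ∘ Fin.natAdd n)) := by
    have heq : Sum.elim (ratX k (n + m) ∘ Fin.castAdd m) (ratX k (n + m) ∘ Fin.natAdd n) =
        ratX k (n + m) ∘ finSumFinEquiv := by
      funext i
      rcases i with i | i <;> simp
    rw [heq]
    exact hb.indep.comp _ finSumFinEquiv.injective
  have hind' : AlgebraicIndependent k
      (Sum.elim (ratX k (n + m) ∘ Fin.natAdd n) (ratX k (n + m) ∘ Fin.castAdd m)) := by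
    rw [← Sum.elim_swap]
    exact hind.comp _ Sum.swap_leftInverse.injective
  have h1 := hb.left.pureOver_of_injective hb.right hρ hind'
  have h2 := hb.right.pureOver_of_injective hb.left hσ hind
  rw [Set.union_comm] at h2
  obtain ⟨t, ⟨e⟩⟩ := ((h'.inPure_of_inPure hb.right hp).of_pureOver h2).exists_algEquiv
  obtain ⟨f⟩ := h1.nonempty_algEquiv
  obtain ⟨φ⟩ := h.nonempty_algEquiv hb.left
  exact ⟨t, ⟨(IsFractionRing.fieldEquivOfAlgEquiv k _ _
    (MvPolynomial.mapAlgEquiv (Fin m) φ)).trans (f.trans e)⟩⟩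

end

open MvPolynomial

set_option synthInstance.maxHeartbeats 1000000
set_option maxHeartbeats 1000000

/-- Let `k` be an algebraically closed field of characteristic zero and
let `H` be a finite subgroup of `GL₃(k)`.  Then for any faithful linear representation
`V = k^m` of `H` over `k` (given by an injective homomorphism `ρ : H →* GLₘ(k)` with
induced action `a` on the rational function field `k(V)`), the invariant field `k(V)^H`
is stably pure over `k`. -/
theorem invariant_field_of_finite_subgroup_of_GL3_stably_pure
    (k : Type) [Field k] [IsAlgClosed k] [CharZero k]
    (H : Subgroup (Matrix.GeneralLinearGroup (Fin 3) k)) [Finite H]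
    (m : ℕ)
    (ρ : H →* Matrix.GeneralLinearGroup (Fin m) k)
    (hρ : Function.Injective ρ)
    (a : H →* (FractionRing (MvPolynomial (Fin m) k) ≃ₐ[k]
      FractionRing (MvPolynomial (Fin m) k)))
    (ha : ∀ (g : H) (i : Fin m),
      a g (algebraMap (MvPolynomial (Fin m) k) (FractionRing (MvPolynomial (Fin m) k)) (X i)) =
        algebraMap (MvPolynomial (Fin m) k) (FractionRing (MvPolynomial (Fin m) k))
          (∑ j, ((ρ g⁻¹ : Matrix (Fin m) (Fin m) k) i j) • X j)) :
    ∃ r t : ℕ, Nonempty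
      (FractionRing (MvPolynomial (Fin r) (IntermediateField.fixedField a.range)) ≃ₐ[k]
       FractionRing (MvPolynomial (Fin t) k)) := by
  have hact : LinAct a (ratX k m) ρ :=
    { indep := ratX_indep m
      act := fun g i => by
        refine (ha g i).trans ?_
        rw [map_sum]
        refine Finset.sum_congr rfl fun j _ => ?_
        rw [Algebra.smul_def, Algebra.smul_def, map_mul, ← IsScalarTower.algebraMap_apply]
        rfl }
  have hp := inPure_ratAct _ H H.subtype rfl
  have := exists_fractionRing_algEquiv hact (linAct_ratAct H.subtype) hρ H.subtype_injective hp
  rw [adjoin_ratX, inv_top] at this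
  exact ⟨3, this⟩
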